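/- Let m, n be positive integers with m ≥ 2, let G = C_m ⊕ C_{mn}, and let S be a sequence over G. Then S has length 2m + mn − 3 (which equals η(G) − 1) and no short zero-sum subsequence if and only if either (a) there exist a basis {e_1, e_2} of G with ord(e_2) = mn, an integer x with gcd(x, m) = 1, and s ∈ [1, n] such that S = e_1^{m-1} · e_2^{sm-1} · (−x·e_1 + e_2)^{(n+1−s)m−1}, or (b) there exists a generating set {g_1, g_2} of G with ord(g_2) = mn such that S = g_1^{m-1} · g_2^{mn-1} · (−g_1 + g_2)^{m-1}. -/

import Mathlib

section SignedPowerSums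

open Finset PowerSeries

variable {ι R : Type*} [CommRing R] [Algebra ℚ R]

theorem sum_powerset_neg_one_pow_mul_sum_pow (J : Finset ι) (v : ι → R) (k : ℕ) :
    ∑ I ∈ J.powerset, (-1) ^ I.card * ((∑ i ∈ I, v i) ^ k * algebraMap ℚ R (1 / k.factorial)) =
      coeff k (∏ i ∈ J, (1 - rescale (v i) (exp R))) := by
  classical
  have key : ∀ I : Finset ι, ∏ i ∈ I, rescale (v i) (exp R) = rescale (∑ i ∈ I, v i) (exp R) := by
    intro I
    induction I using Finset.induction_on with
    | empty => simp
    | insert a s ha ih =>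
      rw [prod_insert ha, sum_insert ha, ih, exp_mul_exp_eq_exp_add]
  simp_rw [sub_eq_add_neg, prod_one_add, map_sum]
  refine sum_congr rfl fun I _ => ?_
  rw [prod_neg, key, ← map_one (C (R := R)), ← map_neg, ← map_pow, coeff_C_mul, coeff_rescale,
    coeff_exp]

/-- The power series `(exp (v t) - 1) / t`. -/
noncomputable def expQuotient (v : R) : PowerSeries R :=
  PowerSeries.mk fun j => v ^ (j + 1) * algebraMap ℚ R (1 / (j + 1).factorial)

theorem one_sub_rescale_exp (v : R) :
    1 - rescale v (exp R) = -X * expQuotient v := by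
  ext k
  rw [map_sub, coeff_rescale, coeff_exp, neg_mul, map_neg]
  rcases k with _ | k
  · simp
  · rw [coeff_succ_X_mul, expQuotient, coeff_mk, coeff_one]
    simp

theorem coeff_prod_one_sub_exp (J : Finset ι) (v : ι → R) (k : ℕ) :
    coeff k (∏ i ∈ J, (1 - rescale (v i) (exp R))) =
      if J.card ≤ k then (-1) ^ J.card * coeff (k - J.card) (∏ i ∈ J, expQuotient (v i))
      else 0 := by
  simp_rw [one_sub_rescale_exp, prod_mul_distrib, prod_const, neg_pow (X : PowerSeries R)]
  have : ((-1 : PowerSeries R)) ^ J.card = C ((-1) ^ J.card) := by simp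
  rw [mul_assoc, this, coeff_C_mul, coeff_X_pow_mul']
  simp

theorem coeff_prod_expQuotient (J : Finset ι) (v : ι → R) :
    coeff 0 (∏ i ∈ J, expQuotient (v i)) = ∏ i ∈ J, v i ∧
    2 * coeff 1 (∏ i ∈ J, expQuotient (v i)) = (∏ i ∈ J, v i) * ∑ i ∈ J, v i ∧
    24 * coeff 2 (∏ i ∈ J, expQuotient (v i)) =
      (∏ i ∈ J, v i) * (3 * (∑ i ∈ J, v i) ^ 2 + ∑ i ∈ J, v i ^ 2) := by
  classical
  induction J using Finset.induction_on with
  | empty => simp [coeff_one]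
  | insert a s ha ih =>
    obtain ⟨h0, h1, h2⟩ := ih
    have e0 : coeff 0 (expQuotient (v a)) = v a := by simp [expQuotient]
    have e1 : 2 * coeff 1 (expQuotient (v a)) = v a ^ 2 := by
      have : (2 : R) * algebraMap ℚ R (1 / 2) = 1 := by
        rw [← map_ofNat (algebraMap ℚ R) 2, ← map_mul]; norm_num
      simp only [expQuotient, coeff_mk]
      norm_num [Nat.factorial]
      norm_num at this
      linear_combination v a ^ 2 * this
    have e2 : 6 * coeff 2 (expQuotient (v a)) = v a ^ 3 := by
      have : (6 : R) * algebraMap ℚ R (1 / 6) = 1 := by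
        rw [← map_ofNat (algebraMap ℚ R) 6, ← map_mul]; norm_num
      simp only [expQuotient, coeff_mk]
      norm_num [Nat.factorial]
      norm_num at this
      linear_combination v a ^ 3 * this
    have a0 : antidiagonal 0 = {((0:ℕ), 0)} := rfl
    have a1 : antidiagonal 1 = {((0:ℕ), 1), (1, 0)} := rfl
    have a2 : antidiagonal 2 = {((0:ℕ), 2), (1, 1), (2, 0)} := rfl
    simp only [prod_insert ha, sum_insert ha]
    generalize hP : ∏ i ∈ s, expQuotient (v i) = P at *
    generalize expQuotient (v a) = g at *
    refine ⟨?_, ?_, ?_⟩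
    · simp only [coeff_mul, a0, sum_singleton, h0, e0]
    · rw [coeff_mul, a1, sum_insert (by decide), sum_singleton]
      simp only [e0, h0]
      linear_combination v a * h1 + (∏ i ∈ s, v i) * e1
    · rw [coeff_mul, a2, sum_insert (by decide), sum_insert (by decide), sum_singleton]
      simp only [e0, h0]
      linear_combination v a * h2 + 4 * (∏ i ∈ s, v i) * e2 + 6 * (v a ^ 2) * h1 +
        12 * (coeff 1 P) * e1

theorem sum_powerset_neg_one_pow_mul_sum_pow_of_lt {J : Finset ι} (v : ι → R) {k : ℕ}
    (hk : k < J.card) :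
    ∑ I ∈ J.powerset, (-1) ^ I.card * (∑ i ∈ I, v i) ^ k = 0 := by
  have h := sum_powerset_neg_one_pow_mul_sum_pow J v k
  rw [coeff_prod_one_sub_exp, if_neg (by omega)] at h
  simp_rw [← mul_assoc, ← sum_mul] at h
  have hu : IsUnit (algebraMap ℚ R (1 / k.factorial)) :=
    (IsUnit.mk0 _ (by positivity)).map _
  exact (hu.mul_left_eq_zero).1 h

theorem sum_powerset_neg_one_pow_mul_sum_pow_card (J : Finset ι) (v : ι → R) :
    ∑ I ∈ J.powerset, (-1) ^ I.card * (∑ i ∈ I, v i) ^ J.card =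
      (-1) ^ J.card * J.card.factorial * ∏ i ∈ J, v i := by
  have h := sum_powerset_neg_one_pow_mul_sum_pow J v J.card
  rw [coeff_prod_one_sub_exp, if_pos le_rfl, Nat.sub_self, (coeff_prod_expQuotient J v).1] at h
  simp_rw [← mul_assoc, ← sum_mul] at h
  have h1 : algebraMap ℚ R (1 / J.card.factorial) * (J.card.factorial : R) = 1 := by
    rw [← map_natCast (algebraMap ℚ R), ← map_mul, one_div_mul_cancel (by positivity), map_one]
  linear_combination (J.card.factorial : R) * h -
    (∑ I ∈ J.powerset, (-1) ^ I.card * (∑ i ∈ I, v i) ^ J.card) * h1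

theorem sum_powerset_neg_one_pow_mul_sum_pow_card_add_two (J : Finset ι) (v : ι → R) :
    24 * ∑ I ∈ J.powerset, (-1) ^ I.card * (∑ i ∈ I, v i) ^ (J.card + 2) =
      (-1) ^ J.card * (J.card + 2).factorial *
        ((∏ i ∈ J, v i) * (3 * (∑ i ∈ J, v i) ^ 2 + ∑ i ∈ J, v i ^ 2)) := by
  have h := sum_powerset_neg_one_pow_mul_sum_pow J v (J.card + 2)
  rw [coeff_prod_one_sub_exp, if_pos (by omega), Nat.add_sub_cancel_left] at h
  rw [← (coeff_prod_expQuotient J v).2.2]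
  simp_rw [← mul_assoc, ← sum_mul] at h
  have h1 : algebraMap ℚ R (1 / (J.card + 2).factorial) * ((J.card + 2).factorial : R) = 1 := by
    rw [← map_natCast (algebraMap ℚ R), ← map_mul, one_div_mul_cancel (by positivity), map_one]
  linear_combination 24 * ((J.card + 2).factorial : R) * h -
    24 * (∑ I ∈ J.powerset, (-1) ^ I.card * (∑ i ∈ I, v i) ^ (J.card + 2)) * h1

end SignedPowerSums

section MinimalZeroSumLevels

open Finset Polynomial

/-- The linear polynomial with coefficient vector `w`. -/
noncomputable def linPoly {F : Type*} [CommRing F] : F × F →ₗ[F] F[X] where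
  toFun w := C w.1 * X + C w.2
  map_add' u v := by simp; ring
  map_smul' c v := by simp [smul_eq_C_mul]; ring

theorem coeff_linPoly_pow {F : Type*} [CommRing F] (w : F × F) (k a : ℕ) :
    (linPoly w ^ k).coeff a = w.1 ^ a * w.2 ^ (k - a) * k.choose a := by
  have : linPoly w ^ k = ((X + C w.2) ^ k).comp (C w.1 * X) := by
    simp [linPoly]
  rw [this, comp_C_mul_X_coeff, coeff_X_add_C_pow]
  ring

theorem map_linPoly {F K : Type*} [CommRing F] [CommRing K] (f : F →+* K) (w : F × F) :
    (linPoly w).map f = linPoly (f w.1, f w.2) := by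
  simp [linPoly]

variable {ι : Type*}

theorem coeff_sum_linPoly_pow {F : Type*} [CommRing F] (J : Finset ι) (v : ι → F × F) (k a : ℕ) :
    (∑ I ∈ J.powerset, (-1) ^ I.card * (∑ i ∈ I, linPoly (v i)) ^ k).coeff a =
      k.choose a * ∑ I ∈ J.powerset, (-1) ^ I.card *
        ((∑ i ∈ I, v i).1 ^ a * (∑ i ∈ I, v i).2 ^ (k - a)) := by
  rw [finsetSum_coeff, mul_sum]
  refine sum_congr rfl fun I _ => ?_
  rw [← map_sum, ← C_1, ← C_neg, ← C_pow, coeff_C_mul, coeff_linPoly_pow]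
  ring

theorem int_signed_sum_eq_zero (J : Finset ι) (v : ι → ℤ × ℤ) {a b : ℕ} (h : a + b < J.card) :
    ∑ I ∈ J.powerset, (-1) ^ I.card * ((∑ i ∈ I, v i).1 ^ a * (∑ i ∈ I, v i).2 ^ b) = 0 := by
  have h1 := sum_powerset_neg_one_pow_mul_sum_pow_of_lt
    (fun i => linPoly (((v i).1 : ℚ), ((v i).2 : ℚ))) h
  have h2 := congrArg (fun P => P.coeff a) h1
  simp only [coeff_sum_linPoly_pow, Nat.add_sub_cancel_left, coeff_zero] at h2
  have h3 := (mul_eq_zero.1 h2).resolve_left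
    (by exact_mod_cast (Nat.choose_pos (Nat.le_add_right a b)).ne')
  simp only [Prod.fst_sum, Prod.snd_sum] at h3 ⊢
  exact_mod_cast h3

theorem int_signed_sum_card (J : Finset ι) (v : ι → ℤ × ℤ) {a b : ℕ} (h : a + b = J.card) :
    ∑ I ∈ J.powerset, (-1) ^ I.card * ((∑ i ∈ I, v i).1 ^ a * (∑ i ∈ I, v i).2 ^ b) =
      (-1) ^ J.card * (a.factorial * b.factorial) * (∏ i ∈ J, linPoly (v i)).coeff a := by
  have h1 := sum_powerset_neg_one_pow_mul_sum_pow_card J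
    (fun i => linPoly (((v i).1 : ℚ), ((v i).2 : ℚ)))
  have h2 := congrArg (fun P => P.coeff a) h1
  have hP : ∏ i ∈ J, linPoly (((v i).1 : ℚ), ((v i).2 : ℚ)) =
      (∏ i ∈ J, linPoly (v i)).map (Int.castRingHom ℚ) := by
    rw [Polynomial.map_prod]; simp [map_linPoly]
  have hc : ((-1 : ℚ[X]) ^ J.card * J.card.factorial) =
      C ((-1 : ℚ) ^ J.card * (J.card.factorial : ℚ)) := by
    simp
  simp only [coeff_sum_linPoly_pow, ← h, Nat.add_sub_cancel_left] at h2
  rw [h, hP, hc, coeff_C_mul, coeff_map, ← h] at h2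
  have hf : (((a + b).choose a : ℕ) : ℚ) * (a.factorial * b.factorial) = (a + b).factorial := by
    exact_mod_cast (by
      rw [← mul_assoc, Nat.choose_symm_add]
      exact Nat.add_choose_mul_factorial_mul_factorial a b)
  rw [← hf] at h2
  have h3 : (((a + b).choose a : ℕ) : ℚ) ≠ 0 :=
    by exact_mod_cast (Nat.choose_pos (Nat.le_add_right a b)).ne'
  have h4 := mul_left_cancel₀ h3 (h2.trans (by ring : _ = (((a + b).choose a : ℕ) : ℚ) *
    ((-1) ^ (a + b) * (a.factorial * b.factorial) *
      (Int.castRingHom ℚ) ((∏ i ∈ J, linPoly (v i)).coeff a))))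
  rw [← h]
  simp only [Prod.fst_sum, Prod.snd_sum, eq_intCast] at h4 ⊢
  exact_mod_cast h4

theorem int_signed_sum_card_add_two (J : Finset ι) (v : ι → ℤ × ℤ) {a b : ℕ}
    (h : a + b = J.card + 2) :
    24 * ∑ I ∈ J.powerset, (-1) ^ I.card * ((∑ i ∈ I, v i).1 ^ a * (∑ i ∈ I, v i).2 ^ b) =
      (-1) ^ J.card * (a.factorial * b.factorial) *
        ((∏ i ∈ J, linPoly (v i)) *
          (3 * (∑ i ∈ J, linPoly (v i)) ^ 2 + ∑ i ∈ J, linPoly (v i) ^ 2)).coeff a := by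
  have h1 := sum_powerset_neg_one_pow_mul_sum_pow_card_add_two J
    (fun i => linPoly (((v i).1 : ℚ), ((v i).2 : ℚ)))
  have h2 := congrArg (fun P => P.coeff a) h1
  have hP : (∏ i ∈ J, linPoly (((v i).1 : ℚ), ((v i).2 : ℚ))) *
      (3 * (∑ i ∈ J, linPoly (((v i).1 : ℚ), ((v i).2 : ℚ))) ^ 2 +
        ∑ i ∈ J, linPoly (((v i).1 : ℚ), ((v i).2 : ℚ)) ^ 2) =
      ((∏ i ∈ J, linPoly (v i)) *
          (3 * (∑ i ∈ J, linPoly (v i)) ^ 2 + ∑ i ∈ J, linPoly (v i) ^ 2)).map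
        (Int.castRingHom ℚ) := by
    simp [Polynomial.map_prod, Polynomial.map_sum, map_linPoly]
  have hc : ((-1 : ℚ[X]) ^ J.card * (J.card + 2).factorial) =
      C ((-1 : ℚ) ^ J.card * ((J.card + 2).factorial : ℚ)) := by
    simp
  have h24 : (24 : ℚ[X]) = C 24 := rfl
  rw [hP, hc, h24] at h2
  simp only [coeff_C_mul] at h2
  rw [coeff_sum_linPoly_pow, coeff_map, ← h, Nat.add_sub_cancel_left] at h2
  have hf : (((a + b).choose a : ℕ) : ℚ) * (a.factorial * b.factorial) = (a + b).factorial := by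
    exact_mod_cast (by
      rw [← mul_assoc, Nat.choose_symm_add]
      exact Nat.add_choose_mul_factorial_mul_factorial a b)
  rw [← hf, mul_left_comm] at h2
  have h3 : (((a + b).choose a : ℕ) : ℚ) ≠ 0 :=
    by exact_mod_cast (Nat.choose_pos (Nat.le_add_right a b)).ne'
  have h4 := mul_left_cancel₀ h3 ((h2.trans (by ring :
    _ = (((a + b).choose a : ℕ) : ℚ) *
    ((-1) ^ J.card * (a.factorial * b.factorial) *
      (Int.castRingHom ℚ) (((∏ i ∈ J, linPoly (v i)) *
          (3 * (∑ i ∈ J, linPoly (v i)) ^ 2 + ∑ i ∈ J, linPoly (v i) ^ 2)).coeff a)))))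
  simp only [Prod.fst_sum, Prod.snd_sum, eq_intCast] at h4 ⊢
  exact_mod_cast h4

variable {p : ℕ} [Fact p.Prime]

theorem exists_int_lift (v : ι → ZMod p × ZMod p) :
    ∃ V : ι → ℤ × ℤ, v = fun i => (((V i).1 : ZMod p), ((V i).2 : ZMod p)) := by
  choose f hf using fun i => ZMod.intCast_surjective (v i).1
  choose g hg using fun i => ZMod.intCast_surjective (v i).2
  exact ⟨fun i => (f i, g i), funext fun i => by simp [hf, hg]⟩

/-- A family with no nonempty zero-sum subfamily has signed count of zero-sum subfamilies one. -/
theorem signed_zero_sum_count (J : Finset ι) (v : ι → ZMod p × ZMod p)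
    (hJ : ∀ I ⊆ J, ∑ i ∈ I, v i = 0 → I = ∅) (hc : p - 1 < J.card) :
    ∑ I ∈ J.powerset, (-1) ^ I.card *
      ((∑ i ∈ I, v i).1 ^ (p - 1) * (∑ i ∈ I, v i).2 ^ (p - 1)) = 1 := by
  classical
  obtain ⟨V, hV⟩ := exists_int_lift v
  have h0 : ∀ a b : ℕ, a + b < J.card → ∑ I ∈ J.powerset, (-1 : ZMod p) ^ I.card *
      ((∑ i ∈ I, v i).1 ^ a * (∑ i ∈ I, v i).2 ^ b) = 0 := by
    intro a b hab
    have := congrArg (Int.cast : ℤ → ZMod p) (int_signed_sum_eq_zero J V hab)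
    simp only [Prod.fst_sum, Prod.snd_sum, hV] at this ⊢
    exact_mod_cast this
  have h1 : ∑ I ∈ J.powerset, (-1 : ZMod p) ^ I.card *
      ((1 - (∑ i ∈ I, v i).1 ^ (p - 1)) * (1 - (∑ i ∈ I, v i).2 ^ (p - 1))) = 1 := by
    have hp : p - 1 ≠ 0 := by have := (Fact.out : p.Prime).two_le; omega
    rw [sum_eq_single ∅]
    · simp [zero_pow hp]
    · intro I hI hne
      have : ∑ i ∈ I, v i ≠ 0 := fun h => hne (hJ I (mem_powerset.1 hI) h)
      by_cases hx : (∑ i ∈ I, v i).1 = 0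
      · have hy : (∑ i ∈ I, v i).2 ≠ 0 := fun hy => this (Prod.ext hx hy)
        rw [ZMod.pow_card_sub_one_eq_one hy]; ring
      · rw [ZMod.pow_card_sub_one_eq_one hx]; ring
    · simp
  have e0 := h0 0 0 (by omega)
  have e1 := h0 (p - 1) 0 (by omega)
  have e2 := h0 0 (p - 1) (by omega)
  have e : ∀ x y : ZMod p, x * y = (1 - x) * (1 - y) - x ^ 0 * y ^ 0 + x * y ^ 0 + x ^ 0 * y := by
    intros; ring
  calc _ = ∑ I ∈ J.powerset, ((-1 : ZMod p) ^ I.card *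
      ((1 - (∑ i ∈ I, v i).1 ^ (p - 1)) * (1 - (∑ i ∈ I, v i).2 ^ (p - 1))) -
      (-1 : ZMod p) ^ I.card * ((∑ i ∈ I, v i).1 ^ 0 * (∑ i ∈ I, v i).2 ^ 0) +
      (-1 : ZMod p) ^ I.card * ((∑ i ∈ I, v i).1 ^ (p - 1) * (∑ i ∈ I, v i).2 ^ 0) +
      (-1 : ZMod p) ^ I.card * ((∑ i ∈ I, v i).1 ^ 0 * (∑ i ∈ I, v i).2 ^ (p - 1))) :=
        sum_congr rfl fun I _ => by ring
    _ = 1 := by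
      rw [sum_add_distrib, sum_add_distrib, sum_sub_distrib, h1, e0, e1, e2]; ring

theorem factorial_sub_one_sq : ((p - 1).factorial * (p - 1).factorial : ZMod p) = 1 := by
  rw [ZMod.wilsons_lemma]; ring

theorem coeff_prod_linPoly (J : Finset ι) (v : ι → ZMod p × ZMod p)
    (hJ : ∀ I ⊆ J, ∑ i ∈ I, v i = 0 → I = ∅) (hc : J.card = 2 * (p - 1)) :
    (∏ i ∈ J, linPoly (v i)).coeff (p - 1) = 1 := by
  have hp := (Fact.out : p.Prime).two_le
  have h1 := signed_zero_sum_count J v hJ (by omega)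
  obtain ⟨V, rfl⟩ := exists_int_lift v
  have := congrArg (Int.cast : ℤ → ZMod p) (int_signed_sum_card J V (a := p - 1) (b := p - 1)
    (by omega))
  have hP : ∏ i ∈ J, linPoly (((V i).1 : ZMod p), ((V i).2 : ZMod p)) =
      (∏ i ∈ J, linPoly (V i)).map (Int.castRingHom (ZMod p)) := by
    rw [Polynomial.map_prod]; simp [map_linPoly]
  rw [hP, coeff_map]
  rw [hc, pow_mul] at this
  simp only [Prod.fst_sum, Prod.snd_sum] at h1 this
  push_cast at this
  rw [h1, factorial_sub_one_sq] at this
  simpa using this.symm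

theorem coeff_prod_linPoly_mul (J : Finset ι) (v : ι → ZMod p × ZMod p)
    (hJ : ∀ I ⊆ J, ∑ i ∈ I, v i = 0 → I = ∅) (hp5 : 5 ≤ p) (hc : J.card = 2 * (p - 2)) :
    ((∏ i ∈ J, linPoly (v i)) * (3 * (∑ i ∈ J, linPoly (v i)) ^ 2 +
      ∑ i ∈ J, linPoly (v i) ^ 2)).coeff (p - 1) = 24 := by
  have h1 := signed_zero_sum_count J v hJ (by omega)
  obtain ⟨V, rfl⟩ := exists_int_lift v
  have := congrArg (Int.cast : ℤ → ZMod p) (int_signed_sum_card_add_two J V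
    (a := p - 1) (b := p - 1) (by omega))
  have hP : (∏ i ∈ J, linPoly (((V i).1 : ZMod p), ((V i).2 : ZMod p))) *
      (3 * (∑ i ∈ J, linPoly (((V i).1 : ZMod p), ((V i).2 : ZMod p))) ^ 2 +
        ∑ i ∈ J, linPoly (((V i).1 : ZMod p), ((V i).2 : ZMod p)) ^ 2) =
      ((∏ i ∈ J, linPoly (V i)) *
          (3 * (∑ i ∈ J, linPoly (V i)) ^ 2 + ∑ i ∈ J, linPoly (V i) ^ 2)).map
        (Int.castRingHom (ZMod p)) := by
    simp [Polynomial.map_prod, Polynomial.map_sum, map_linPoly]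
  rw [hP, coeff_map]
  rw [hc, pow_mul] at this
  simp only [Prod.fst_sum, Prod.snd_sum] at h1 this
  push_cast at this
  rw [h1, factorial_sub_one_sq] at this
  simpa using this.symm

end MinimalZeroSumLevels

section PairAndTripleForms

open Finset Polynomial

variable {p : ℕ} [Fact p.Prime] {ι : Type*} [Fintype ι] [DecidableEq ι]

/-- A family indexed by `ι` whose only zero-sum subfamilies are the trivial ones. -/
structure IsMinZeroSum {G : Type*} [AddCommMonoid G] (v : ι → G) : Prop where
  sum_eq : ∑ i, v i = 0
  minimal : ∀ I : Finset ι, ∑ i ∈ I, v i = 0 → I = ∅ ∨ I = univ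

/-- The linear form `w ↦ coeff (p-1) (w ∏_{i ≠ a, b} v i)`. -/
noncomputable def pairForm (v : ι → ZMod p × ZMod p) (a b : ι) :
    ZMod p × ZMod p →ₗ[ZMod p] ZMod p :=
  lcoeff (ZMod p) (p - 1) ∘ₗ
    LinearMap.mulLeft (ZMod p) (∏ i ∈ univ \ {a, b}, linPoly (v i)) ∘ₗ linPoly

/-- The bilinear form `(w, w') ↦ coeff (p-1) (w w' ∏_{i ≠ a, b, c} v i)`. -/
noncomputable def tripleForm (v : ι → ZMod p × ZMod p) (a b c : ι) (w w' : ZMod p × ZMod p) :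
    ZMod p :=
  ((∏ i ∈ univ \ {a, b, c}, linPoly (v i)) * (linPoly w * linPoly w')).coeff (p - 1)

variable {v : ι → ZMod p × ZMod p}

theorem IsMinZeroSum.coeff_prod_erase (hv : IsMinZeroSum v) (hc : Fintype.card ι = 2 * p - 1)
    (b : ι) : (∏ i ∈ univ \ {b}, linPoly (v i)).coeff (p - 1) = 1 := by
  have hp := (Fact.out : p.Prime).two_le
  refine coeff_prod_linPoly _ v (fun I hI h0 => (hv.minimal I h0).resolve_right ?_) ?_
  · rintro rfl
    have := hI (mem_univ b)
    simp at this
  · rw [card_univ_sdiff, hc, card_singleton]; omega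

theorem sdiff_pair_insert {a b : ι} (hab : a ≠ b) :
    univ \ {b} = insert a (univ \ {a, b} : Finset ι) := by
  ext i
  by_cases h : i = a
  · simp [h, hab]
  · simp [h]

theorem sdiff_triple_insert {a b c : ι} (hab : a ≠ b) (hac : a ≠ c) :
    univ \ {b, c} = insert a (univ \ {a, b, c} : Finset ι) := by
  ext i
  by_cases h : i = a
  · simp [h, hab, hac]
  · simp [h]

theorem IsMinZeroSum.pairForm_left (hv : IsMinZeroSum v) (hc : Fintype.card ι = 2 * p - 1)
    {a b : ι} (hab : a ≠ b) : pairForm v a b (v a) = 1 := by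
  rw [← hv.coeff_prod_erase hc b, sdiff_pair_insert hab, prod_insert (by simp)]
  simp [pairForm, mul_comm]

theorem pairForm_comm (v : ι → ZMod p × ZMod p) (a b : ι) : pairForm v a b = pairForm v b a := by
  simp [pairForm, pair_comm]

theorem IsMinZeroSum.pairForm_right (hv : IsMinZeroSum v) (hc : Fintype.card ι = 2 * p - 1)
    {a b : ι} (hab : a ≠ b) : pairForm v a b (v b) = 1 := by
  rw [pairForm_comm, hv.pairForm_left hc hab.symm]

omit [Fact p.Prime] in
theorem tripleForm_comm (v : ι → ZMod p × ZMod p) (a b c : ι) (w w' : ZMod p × ZMod p) :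
    tripleForm v a b c w w' = tripleForm v a b c w' w := by
  rw [tripleForm, tripleForm, mul_comm (linPoly w)]

theorem tripleForm_left {a b c : ι} (hab : a ≠ b) (hac : a ≠ c) (w : ZMod p × ZMod p) :
    tripleForm v a b c (v a) w = pairForm v b c w := by
  rw [tripleForm, pairForm]
  simp only [LinearMap.comp_apply, LinearMap.mulLeft_apply, lcoeff_apply]
  rw [sdiff_triple_insert hab hac, prod_insert (by simp)]
  congr 1; ring

omit [Fact p.Prime] in
theorem tripleForm_rotate (v : ι → ZMod p × ZMod p) (a b c : ι) (w w' : ZMod p × ZMod p) :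
    tripleForm v a b c w w' = tripleForm v b c a w w' := by
  have : ({a, b, c} : Finset ι) = {b, c, a} := by ext; simp; tauto
  rw [tripleForm, this, tripleForm]

theorem tripleForm_add_smul (v : ι → ZMod p × ZMod p) (a b c : ι) (s t s' t' : ZMod p)
    (w w' : ZMod p × ZMod p) :
    tripleForm v a b c (s • w + t • w') (s' • w + t' • w') =
      s * s' * tripleForm v a b c w w + (s * t' + s' * t) * tripleForm v a b c w w' +
        t * t' * tripleForm v a b c w' w' := by
  simp only [tripleForm, map_add, map_smul, smul_eq_C_mul]
  rw [← coeff_C_mul, ← coeff_C_mul, ← coeff_C_mul, ← coeff_add, ← coeff_add]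
  congr 1
  simp only [map_mul, map_add]
  ring

theorem IsMinZeroSum.tripleForm_sum (hv : IsMinZeroSum v) (hc : Fintype.card ι = 2 * p - 1)
    (hp5 : 5 ≤ p) {a b c : ι} (hab : a ≠ b) (hac : a ≠ c) (hbc : b ≠ c) :
    ∑ i, tripleForm v a b c (v i) (v i) + 2 * (tripleForm v a b c (v a) (v a) +
      tripleForm v a b c (v b) (v b) + tripleForm v a b c (v c) (v c)) = 6 := by
  have hcard : ({a, b, c} : Finset ι).card = 3 := card_eq_three.2 ⟨a, b, c, hab, hac, hbc, rfl⟩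
  have h := coeff_prod_linPoly_mul (univ \ {a, b, c}) v
    (fun I hI h0 => (hv.minimal I h0).resolve_right ?_) hp5 ?_
  · have hs : ∑ i ∈ univ \ {a, b, c}, linPoly (v i) =
        -(linPoly (v a) + linPoly (v b) + linPoly (v c)) := by
      have h1 := sum_sdiff (f := fun i => linPoly (v i)) (subset_univ {a, b, c})
      rw [← map_sum _ _ univ, hv.sum_eq, map_zero, sum_insert (by simp [hab, hac]),
        sum_insert (by simp [hbc]), sum_singleton] at h1
      linear_combination h1
    have hs2 : ∀ f : ι → ZMod p, ∑ i, f i = ∑ i ∈ univ \ {a, b, c}, f i + (f a + f b + f c) := by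
      intro f
      rw [← sum_sdiff (subset_univ {a, b, c}), sum_insert (by simp [hab, hac]),
        sum_insert (by simp [hbc]), sum_singleton, add_assoc (f a)]
    rw [hs, mul_add, coeff_add, mul_sum, finsetSum_coeff] at h
    have hexp : (∏ i ∈ univ \ {a, b, c}, linPoly (v i)) *
        (3 * (-(linPoly (v a) + linPoly (v b) + linPoly (v c))) ^ 2) =
        C 3 * ((∏ i ∈ univ \ {a, b, c}, linPoly (v i)) * (linPoly (v a) * linPoly (v a)) +
          (∏ i ∈ univ \ {a, b, c}, linPoly (v i)) * (linPoly (v b) * linPoly (v b)) +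
          (∏ i ∈ univ \ {a, b, c}, linPoly (v i)) * (linPoly (v c) * linPoly (v c))) +
        C 6 * ((∏ i ∈ univ \ {a, b, c}, linPoly (v i)) * (linPoly (v a) * linPoly (v b)) +
          (∏ i ∈ univ \ {a, b, c}, linPoly (v i)) * (linPoly (v b) * linPoly (v c)) +
          (∏ i ∈ univ \ {a, b, c}, linPoly (v i)) * (linPoly (v c) * linPoly (v a))) := by
      rw [map_ofNat, map_ofNat]; ring
    rw [hexp, coeff_add, coeff_C_mul, coeff_C_mul] at h
    simp only [coeff_add, pow_two] at h
    have eab : tripleForm v a b c (v a) (v b) = 1 := by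
      rw [tripleForm_left hab hac, hv.pairForm_left hc hbc]
    have ebc : tripleForm v a b c (v b) (v c) = 1 := by
      rw [tripleForm_rotate, tripleForm_left hbc hab.symm, hv.pairForm_left hc hac.symm]
    have eca : tripleForm v a b c (v c) (v a) = 1 := by
      rw [tripleForm_comm, tripleForm_left hab hac, hv.pairForm_right hc hbc]
    change 3 * (tripleForm v a b c (v a) (v a) + tripleForm v a b c (v b) (v b) +
      tripleForm v a b c (v c) (v c)) + 6 * (tripleForm v a b c (v a) (v b) +
      tripleForm v a b c (v b) (v c) + tripleForm v a b c (v c) (v a)) +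
      ∑ i ∈ univ \ {a, b, c}, tripleForm v a b c (v i) (v i) = 24 at h
    rw [eab, ebc, eca] at h
    rw [hs2]
    linear_combination h
  · rintro rfl
    have := hI (mem_univ a)
    simp at this
  · rw [card_univ_sdiff, hc, hcard]; omega

theorem IsMinZeroSum.eq_of_det_eq_zero (hv : IsMinZeroSum v) (hc : Fintype.card ι = 2 * p - 1)
    (a b : ι) (h : (v a).1 * (v b).2 = (v b).1 * (v a).2) : v a = v b := by
  by_cases hab : a = b
  · rw [hab]
  have hf : ∀ w : ZMod p × ZMod p, pairForm v a b w =
      w.1 * pairForm v a b (1, 0) + w.2 * pairForm v a b (0, 1) := by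
    intro w
    rw [← smul_eq_mul, ← smul_eq_mul, ← map_smul, ← map_smul, ← map_add]
    simp
  have h1 := hv.pairForm_left hc hab
  have h2 := hv.pairForm_right hc hab
  rw [hf] at h1 h2
  ext
  · linear_combination (v b).1 * h1 - (v a).1 * h2 + pairForm v a b (0, 1) * h
  · linear_combination (v b).2 * h1 - (v a).2 * h2 - pairForm v a b (1, 0) * h

theorem IsMinZeroSum.exists_repeated (hv : IsMinZeroSum v) (hc : Fintype.card ι = 2 * p - 1)
    (hp5 : 5 ≤ p) : ∃ a b, a ≠ b ∧ v a = v b := by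
  classical
  let f : ι → Option (ZMod p) := fun i => if (v i).1 = 0 then none else some ((v i).2 / (v i).1)
  obtain ⟨a, b, hab, h⟩ := Fintype.exists_ne_map_eq_of_card_lt f (by
    rw [Fintype.card_option, ZMod.card, hc]; omega)
  refine ⟨a, b, hab, hv.eq_of_det_eq_zero hc a b ?_⟩
  simp only [f] at h
  by_cases h1 : (v a).1 = 0 <;> by_cases h2 : (v b).1 = 0
  · simp [h1, h2]
  · simp [h1, h2] at h
  · simp [h1, h2] at h
  · simp only [h1, h2, if_false, Option.some.injEq] at h
    field_simp at h
    linear_combination -h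

end PairAndTripleForms

section Coordinates

open Finset Polynomial

variable {p : ℕ} [Fact p.Prime] {ι : Type*} [Fintype ι] [DecidableEq ι]

theorem pair_relation {F : Type*} [Field F] {x y x' y' c b a m0 m1 m2 : F} (h2 : (2 : F) ≠ 0)
    (hne : y ≠ y')
    (e1 : c * x + b * y = 1) (e2 : c * x' + b * y' = 1)
    (e3 : c * (x * x') + b * (x * y' + x' * y) + a * (y * y') = 1)
    (hs : c * m2 + 2 * b * m1 + a * m0 +
      2 * (c + (c * (x * x) + b * (x * y + x * y) + a * (y * y)) +
      (c * (x' * x') + b * (x' * y' + x' * y') + a * (y' * y'))) = 6)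
    (hE : y ^ 2 * m2 + 2 * ((1 - x) * y) * m1 + ((1 - x) ^ 2 - (1 - x)) * m0 = 2 * (1 - x) * y ^ 2)
    (hE' : y' ^ 2 * m2 + 2 * ((1 - x') * y') * m1 + ((1 - x') ^ 2 - (1 - x')) * m0 =
      2 * (1 - x') * y' ^ 2) :
    ((1 - x) * y' - (1 - x') * y) ^ 2 = (1 - x) * y' ^ 2 + (1 - x') * y ^ 2 := by
  obtain ⟨D, hDd⟩ : ∃ D, D = x * y' - x' * y := ⟨_, rfl⟩
  have hc : D * c = y' - y := by linear_combination y' * e1 - y * e2 + c * hDd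
  have hb : D * b = x - x' := by linear_combination x * e2 - x' * e1 + b * hDd
  have ha : D * y * y' * a = (1 - x) * x * y' - (1 - x') * x' * y := by
    linear_combination D * e3 - x * x' * hc - (x * y' + x' * y) * hb + hDd
  have hsub : y - y' ≠ 0 := sub_ne_zero.2 hne
  have : 2 * (y - y') * (((1 - x) * y' - (1 - x') * y) ^ 2 -
      ((1 - x) * y' ^ 2 + (1 - x') * y ^ 2)) = 0 := by
    linear_combination D * y * y' * hs - hc * (y * y' * m2 + 2 * y * y' * (1 + x ^ 2 + x' ^ 2)) -
      hb * (y * y' * (2 * m1 + 4 * x * y + 4 * x' * y')) - ha * (m0 + 2 * y ^ 2 + 2 * y' ^ 2) +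
      y' * hE - y * hE' + 6 * y * y' * hDd
  rcases mul_eq_zero.1 this with h | h
  · exact absurd h (mul_ne_zero h2 hsub)
  · linear_combination h

/-- Coordinates of a minimal zero-sum family of maximal length, in which a repeated vector is
`(1, 0)`, together with the quadratic relations they satisfy. -/
structure SphericalCoords {F : Type*} [Field F] (x y : ι → F) : Prop where
  exists_base : ∃ a, x a = 1 ∧ y a = 0
  parallel : ∀ i j, x i * y j = x j * y i → x i = x j ∧ y i = y j
  sum_x : ∑ i, x i = 0
  sum_y : ∑ i, y i = 0
  single : ∀ i, y i ^ 2 * ∑ j, x j ^ 2 + 2 * ((1 - x i) * y i) * ∑ j, x j * y j +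
    ((1 - x i) ^ 2 - (1 - x i)) * ∑ j, y j ^ 2 = 2 * (1 - x i) * y i ^ 2
  pair : ∀ i j, y i ≠ 0 → y j ≠ 0 → y i ≠ y j →
    ((1 - x i) * y j - (1 - x j) * y i) ^ 2 = (1 - x i) * y j ^ 2 + (1 - x j) * y i ^ 2

theorem IsMinZeroSum.exists_coords {v : ι → ZMod p × ZMod p} (hv : IsMinZeroSum v)
    (hc : Fintype.card ι = 2 * p - 1) (hp5 : 5 ≤ p) :
    ∃ x y : ι → ZMod p, SphericalCoords x y ∧ ∀ i j, (v i = v j ↔ x i = x j ∧ y i = y j) := by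
  obtain ⟨a, b, hab, hu⟩ := hv.exists_repeated hc hp5
  obtain ⟨lam, hlam⟩ : ∃ lam, lam = pairForm v a b := ⟨_, rfl⟩
  have hlin : ∀ w : ZMod p × ZMod p, lam w = w.1 * lam (1, 0) + w.2 * lam (0, 1) := by
    intro w
    rw [← smul_eq_mul, ← smul_eq_mul, ← map_smul, ← map_smul, ← map_add]
    simp
  have hlu : lam (v a) = 1 := by rw [hlam, hv.pairForm_left hc hab]
  let x : ι → ZMod p := fun i => lam (v i)
  let y : ι → ZMod p := fun i => (v a).1 * (v i).2 - (v a).2 * (v i).1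
  let e : ZMod p × ZMod p := (-lam (0, 1), lam (1, 0))
  have hdec : ∀ i, v i = x i • v a + y i • e := by
    intro i
    have h1 := hlin (v i)
    have h2 := hlin (v a)
    rw [hlu] at h2
    simp only [x, y, e]
    ext
    · simp only [Prod.fst_add, Prod.smul_fst, smul_eq_mul, h1]
      linear_combination (v i).1 * h2
    · simp only [Prod.snd_add, Prod.smul_snd, smul_eq_mul, h1]
      linear_combination (v i).2 * h2
  have hxa : x a = 1 := hlu
  have hya : y a = 0 := by simp only [y]; ring
  have hiff : ∀ i j, (v i = v j ↔ x i = x j ∧ y i = y j) := by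
    intro i j
    refine ⟨fun h => by simp only [x, y, h, and_self], fun ⟨h1, h2⟩ => ?_⟩
    rw [hdec i, hdec j, h1, h2]
  have hdet : ∀ i j, x i * y j - x j * y i = (v i).1 * (v j).2 - (v j).1 * (v i).2 := by
    intro i j
    have h1 := hlin (v i)
    have h2 := hlin (v a)
    have h3 := hlin (v j)
    rw [hlu] at h2
    simp only [x, y]
    rw [h1, h3]
    linear_combination -((v i).1 * (v j).2 - (v j).1 * (v i).2) * h2
  have hpar : ∀ i j, x i * y j = x j * y i → x i = x j ∧ y i = y j := fun i j h =>
    (hiff i j).1 (hv.eq_of_det_eq_zero hc i j (by linear_combination h - hdet i j))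
  have htri : ∀ {i j k}, i ≠ j → i ≠ k → j ≠ k → ∃ c b' a', (∀ s t,
      tripleForm v i j k (v s) (v t) = c * (x s * x t) + b' * (x s * y t + x t * y s) +
        a' * (y s * y t)) ∧
      c * ∑ j, x j ^ 2 + 2 * b' * ∑ j, x j * y j + a' * ∑ j, y j ^ 2 +
      2 * (tripleForm v i j k (v i) (v i) +
      tripleForm v i j k (v j) (v j) + tripleForm v i j k (v k) (v k)) = 6 := by
    intro i j k hij hik hjk
    refine ⟨tripleForm v i j k (v a) (v a), tripleForm v i j k (v a) e, tripleForm v i j k e e, ?_⟩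
    have hform : ∀ s t, tripleForm v i j k (v s) (v t) =
        tripleForm v i j k (v a) (v a) * (x s * x t) +
        tripleForm v i j k (v a) e * (x s * y t + x t * y s) +
        tripleForm v i j k e e * (y s * y t) := by
      intro s t
      conv_lhs => rw [hdec s, hdec t, tripleForm_add_smul]
      ring
    refine ⟨hform, ?_⟩
    rw [← hv.tripleForm_sum hc hp5 hij hik hjk]
    congr 1
    rw [mul_sum, mul_sum, mul_sum, ← sum_add_distrib, ← sum_add_distrib]
    refine sum_congr rfl fun s _ => ?_
    rw [hform s s]; ring
  have hya0 : ∀ i, y i ≠ 0 → a ≠ i := fun i h h' => h (h' ▸ hya)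
  have hyb : y b = 0 := by simp only [y, ← hu]; ring
  have hyb0 : ∀ i, y i ≠ 0 → b ≠ i := fun i h h' => h (h' ▸ hyb)
  have h2 : (2 : ZMod p) ≠ 0 := by
    intro h
    have : ((2 : ℕ) : ZMod p) = 0 := by exact_mod_cast h
    rw [ZMod.natCast_eq_zero_iff] at this
    have := Nat.le_of_dvd (by norm_num) this
    omega
  have hsingle : ∀ i, y i ^ 2 * ∑ j, x j ^ 2 + 2 * ((1 - x i) * y i) * ∑ j, x j * y j +
      ((1 - x i) ^ 2 - (1 - x i)) * ∑ j, y j ^ 2 = 2 * (1 - x i) * y i ^ 2 := by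
    intro i
    by_cases hyi : y i = 0
    · have := (hpar i a (by rw [hya, hyi]; ring)).1
      rw [this, hxa, hyi]; ring
    have hai := hya0 i hyi
    have hbi := hyb0 i hyi
    obtain ⟨c, b', a', hf, hs⟩ := htri hab hai hbi
    have q1 : tripleForm v a b i (v a) (v a) = 1 := by
      rw [tripleForm_left hab hai, hu, hv.pairForm_left hc hbi]
    have q2 : tripleForm v a b i (v a) (v i) = 1 := by
      rw [tripleForm_left hab hai, hv.pairForm_right hc hbi]
    have q3 : tripleForm v a b i (v i) (v i) = x i := by
      rw [tripleForm_rotate, tripleForm_rotate, tripleForm_left hai.symm hbi.symm, ← hlam]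
    rw [← hu, q1, q3] at hs
    rw [hf, hxa, hya] at q1 q2
    rw [hf] at q3
    have hc1 : c = 1 := by linear_combination q1
    subst hc1
    have hb1 : b' * y i = 1 - x i := by linear_combination q2
    have ha1 : a' * y i ^ 2 = (1 - x i) ^ 2 - (1 - x i) := by
      linear_combination q3 - 2 * x i * hb1
    linear_combination y i ^ 2 * hs - 2 * y i * (∑ j, x j * y j) * hb1 - (∑ j, y j ^ 2) * ha1
  refine ⟨x, y, ⟨⟨a, hxa, hya⟩, hpar, ?_, ?_, hsingle, ?_⟩, hiff⟩
  · simp only [x]; rw [← map_sum, hv.sum_eq, map_zero]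
  · have h1 := congrArg Prod.fst hv.sum_eq
    have h2 := congrArg Prod.snd hv.sum_eq
    simp only [Prod.fst_sum, Prod.snd_sum, Prod.fst_zero, Prod.snd_zero] at h1 h2
    simp only [y]; rw [sum_sub_distrib, ← mul_sum, ← mul_sum, h1, h2]; ring
  · intro i j hyi hyj hij
    have hai := hya0 i hyi
    have haj := hya0 j hyj
    have hne : i ≠ j := fun h => hij (by rw [h])
    obtain ⟨c, b', a', hf, hs⟩ := htri hai haj hne
    have q1 : tripleForm v a i j (v a) (v i) = 1 := by
      rw [tripleForm_left hai haj, hv.pairForm_left hc hne]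
    have q2 : tripleForm v a i j (v a) (v j) = 1 := by
      rw [tripleForm_left hai haj, hv.pairForm_right hc hne]
    have q3 : tripleForm v a i j (v i) (v j) = 1 := by
      rw [tripleForm_rotate, tripleForm_left hne hai.symm, hv.pairForm_left hc haj.symm]
    rw [hf, hxa, hya] at q1 q2
    rw [hf] at q3
    simp only [hf, hxa, hya] at hs
    exact pair_relation (c := c) (b := b') (a := a') h2 hij (by linear_combination q1)
      (by linear_combination q2) q3 (by linear_combination hs) (hsingle i) (hsingle j)

end Coordinates

section Multiplicity

open Finset

variable {ι F : Type*} [Fintype ι] [Field F] {x y : ι → F}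

open Classical in
/-- The number of indices with the same coordinates as `i`. -/
noncomputable def coordMult (x y : ι → F) (i : ι) : ℕ := #{j | x j = x i ∧ y j = y i}

theorem SphericalCoords.x_eq_one (h : SphericalCoords x y) {i : ι} (hi : y i = 0) : x i = 1 := by
  obtain ⟨a, h1, h2⟩ := h.exists_base
  exact (h.parallel i a (by rw [h2, hi]; ring)).1.trans h1

theorem SphericalCoords.mult_of_forall (h : SphericalCoords x y) (h2 : (2 : F) ≠ 0)
    {i : ι} (hi : y i ≠ 0) (hx : x i ≠ 1)
    (hcls : ∀ j, y j = y i → x j = x i) : (coordMult x y i : F) = -1 := by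
  classical
  have key : ∀ j, ((1 - x j) * y i - (1 - x i) * y j) ^ 2 - (1 - x i) * y j ^ 2 -
      (1 - x j) * y i ^ 2 = if x j = x i ∧ y j = y i then -2 * (1 - x i) * y i ^ 2 else 0 := by
    intro j
    split_ifs with hj
    · rw [hj.1, hj.2]; ring
    · by_cases hy : y j = 0
      · rw [h.x_eq_one hy, hy]; ring
      · have := h.pair i j hi hy fun he => hj ⟨hcls j he.symm, he.symm⟩
        linear_combination this
  have hsum := Finset.sum_congr (rfl : (univ : Finset ι) = univ) fun j _ => key j
  rw [← sum_filter, sum_const, nsmul_eq_mul] at hsum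
  have hexp : ∑ j, (((1 - x j) * y i - (1 - x i) * y j) ^ 2 - (1 - x i) * y j ^ 2 -
      (1 - x j) * y i ^ 2) = y i ^ 2 * ∑ j, x j ^ 2 + 2 * ((1 - x i) * y i) * ∑ j, x j * y j +
    ((1 - x i) ^ 2 - (1 - x i)) * ∑ j, y j ^ 2 - y i ^ 2 * ∑ j, x j -
      2 * (1 - x i) * y i * ∑ j, y j := by
    simp only [mul_sum, ← sum_add_distrib, ← sum_sub_distrib]
    exact sum_congr rfl fun j _ => by ring
  rw [hexp, h.single, h.sum_x, h.sum_y] at hsum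
  have hne : 2 * (1 - x i) * y i ^ 2 ≠ 0 :=
    mul_ne_zero (mul_ne_zero h2 (sub_ne_zero.2 hx.symm)) (pow_ne_zero 2 hi)
  apply mul_right_cancel₀ hne
  rw [coordMult]
  linear_combination hsum

theorem SphericalCoords.mult_of_zero_one (h : SphericalCoords x y)
    (hc : (Fintype.card ι : F) = -1) {i : ι} (hx : x i = 0)
    (hcls : ∀ j, x j = 1 ∨ (x j = x i ∧ y j = y i)) : (coordMult x y i : F) = -1 := by
  classical
  have key : ∀ j, x j = 1 - if x j = x i ∧ y j = y i then 1 else 0 := by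
    intro j
    split_ifs with hj
    · rw [hj.1, hx]; ring
    · rw [(hcls j).resolve_right hj]; ring
  have hsum := Finset.sum_congr (rfl : (univ : Finset ι) = univ) fun j _ => key j
  rw [h.sum_x, sum_sub_distrib, ← sum_filter, sum_const, sum_const, card_univ, nsmul_eq_mul,
    nsmul_eq_mul, hc] at hsum
  rw [coordMult]
  linear_combination hsum

theorem SphericalCoords.exists_mult (h : SphericalCoords x y) (h2 : (2 : F) ≠ 0)
    (hc : (Fintype.card ι : F) = -1) : ∃ i, (coordMult x y i : F) = -1 := by
  classical
  by_cases hall : ∃ y0, ∀ i, y i ≠ 0 → y i = y0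
  · obtain ⟨y0, hy0⟩ := hall
    obtain ⟨a, hxa, hya⟩ := h.exists_base
    refine ⟨a, ?_⟩
    have key : ∀ j, y j = y0 - if x j = x a ∧ y j = y a then y0 else 0 := by
      intro j
      split_ifs with hj
      · rw [hj.2, hya]; ring
      · rw [sub_zero]
        exact hy0 j fun hy => hj ⟨(h.x_eq_one hy).trans hxa.symm, hy.trans hya.symm⟩
    have hsum := Finset.sum_congr (rfl : (univ : Finset ι) = univ) fun j _ => key j
    rw [h.sum_y, sum_sub_distrib, ← sum_filter, sum_const, sum_const, card_univ, nsmul_eq_mul,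
      nsmul_eq_mul, hc] at hsum
    have hne : y0 ≠ 0 := by
      rintro rfl
      have : ∀ i, x i = 1 := fun i => h.x_eq_one (by_contra fun hi => hi (hy0 i hi))
      have h1 := h.sum_x
      simp [this, hc] at h1
    apply mul_right_cancel₀ hne
    rw [coordMult]
    linear_combination hsum
  push Not at hall
  by_cases hinj : ∀ i j, y i ≠ 0 → y i = y j → x i = x j
  · obtain ⟨i, hi⟩ : ∃ i, x i ≠ 1 := by
      by_contra! hx
      have h1 := h.sum_x
      simp [hx, hc] at h1
    have hyi : y i ≠ 0 := fun hy => hi (h.x_eq_one hy)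
    exact ⟨i, h.mult_of_forall h2 hyi hi fun j hj => (hinj i j hyi hj.symm).symm⟩
  push Not at hinj
  obtain ⟨w, w', hw, hww, hxw⟩ := hinj
  have hw' : y w' ≠ 0 := hww ▸ hw
  have hout : ∀ v, y v ≠ 0 → y v ≠ y w →
      (1 - x w) * y v + (1 - x w') * y v - 2 * (1 - x v) * y w = y v := by
    intro v hv hvw
    have e1 := h.pair w v hw hv hvw.symm
    have e2 := h.pair w' v hw' hv (hww ▸ hvw.symm)
    rw [← hww] at e2
    apply mul_left_cancel₀ (mul_ne_zero (sub_ne_zero.2 hxw) hv)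
    linear_combination e2 - e1
  by_cases hs : ∃ v, y v ≠ 0 ∧ y v ≠ y w ∧ x v ≠ 1
  · obtain ⟨v, hv, hvw, hxv⟩ := hs
    refine ⟨v, h.mult_of_forall h2 hv hxv fun j hj => ?_⟩
    have e1 := hout v hv hvw
    have e2 := hout j (hj ▸ hv) (hj ▸ hvw)
    rw [hj] at e2
    apply mul_left_cancel₀ (mul_ne_zero h2 hw)
    linear_combination e2 - e1
  push Not at hs
  obtain ⟨v, hv, hvw⟩ := hall (y w)
  have h01 : ∀ j, y j = y w → x j = 1 ∨ x j = 0 := by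
    intro j hj
    have e := h.pair j v (hj ▸ hw) hv (hj ▸ hvw.symm)
    rw [hs v hv hvw] at e
    have : y v ^ 2 * ((x j - 1) * x j) = 0 := by linear_combination e
    rcases mul_eq_zero.1 ((mul_eq_zero.1 this).resolve_left (pow_ne_zero 2 hv)) with h | h
    · exact Or.inl (sub_eq_zero.1 h)
    · exact Or.inr h
  obtain ⟨i, hi, hxi⟩ : ∃ i, y i = y w ∧ x i = 0 := by
    rcases h01 w rfl with h1 | h1
    · rcases h01 w' hww.symm with h2 | h2
      · exact absurd (h1.trans h2.symm) hxw
      · exact ⟨w', hww.symm, h2⟩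
    · exact ⟨w, rfl, h1⟩
  refine ⟨i, h.mult_of_zero_one hc hxi fun j => ?_⟩
  by_cases hj : y j = 0
  · exact Or.inl (h.x_eq_one hj)
  by_cases hjw : y j = y w
  · rcases h01 j hjw with h1 | h1
    · exact Or.inl h1
    · exact Or.inr ⟨h1.trans hxi.symm, hjw.trans hi.symm⟩
  · exact Or.inl (hs j hj hjw)

end Multiplicity

section MultisetBasics

open Multiset

variable {G : Type*} [AddCommGroup G]

/-- No nonempty zero-sum subsequence of length at most `k`. -/
def NoShortZeroSum (k : ℕ) (S : Multiset G) : Prop :=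
  ∀ T ≤ S, T ≠ 0 → T.sum = 0 → k < card T

/-- No nonempty zero-sum subsequence. -/
def ZeroSumFree (S : Multiset G) : Prop := ∀ T ≤ S, T.sum = 0 → T = 0

/-- A zero-sum sequence without nontrivial zero-sum subsequences. -/
structure IsMinZeroSumSeq (T : Multiset G) : Prop where
  sum_eq : T.sum = 0
  minimal : ∀ T' ≤ T, T'.sum = 0 → T' = 0 ∨ T' = T

theorem NoShortZeroSum.mono {k : ℕ} {S S' : Multiset G} (h : NoShortZeroSum k S) (hS : S' ≤ S) :
    NoShortZeroSum k S' := fun T hT => h T (hT.trans hS)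

theorem ZeroSumFree.mono {S S' : Multiset G} (h : ZeroSumFree S) (hS : S' ≤ S) :
    ZeroSumFree S' := fun T hT => h T (hT.trans hS)

theorem ZeroSumFree.isMinZeroSumSeq {S : Multiset G} (h : ZeroSumFree S) :
    IsMinZeroSumSeq ((-S.sum) ::ₘ S) := by
  classical
  refine ⟨by simp, fun T hT h0 => ?_⟩
  by_cases hmem : -S.sum ∈ T
  · right
    obtain ⟨T', rfl⟩ := Multiset.exists_cons_of_mem hmem
    rw [Multiset.cons_le_cons_iff] at hT
    obtain ⟨R, rfl⟩ := Multiset.le_iff_exists_add.1 hT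
    have : R = 0 := h R (Multiset.le_add_left _ _) (by
      simp only [sum_cons, sum_add] at h0
      have : -R.sum = 0 := by rw [← h0]; abel
      exact neg_eq_zero.1 this)
    simp [this]
  · left
    exact h T ((Multiset.le_cons_of_notMem hmem).1 hT) h0

theorem IsMinZeroSumSeq.zeroSumFree_of_lt {S T : Multiset G} (h : IsMinZeroSumSeq S) (hT : T < S) :
    ZeroSumFree T := fun T' hT' h0 =>
  (h.minimal T' (hT'.trans hT.le) h0).resolve_right fun he => (he ▸ hT').not_gt hT

theorem NoShortZeroSum.isMinZeroSumSeq {k : ℕ} {S : Multiset G} (h : NoShortZeroSum k S)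
    (hS : S.sum = 0) (hc : card S ≤ 2 * k + 1) : IsMinZeroSumSeq S := by
  refine ⟨hS, fun T hT h0 => ?_⟩
  by_contra! hne
  obtain ⟨R, rfl⟩ := Multiset.le_iff_exists_add.1 hT
  have hR : R ≠ 0 := by rintro rfl; simp at hne
  have h1 := h T hT hne.1 h0
  have h2 := h R (Multiset.le_add_left _ _) hR (by simpa [h0] using hS)
  rw [card_add] at hc
  omega

theorem ZeroSumFree.noShort {S : Multiset G} (h : ZeroSumFree S) (k : ℕ) : NoShortZeroSum k S :=
  fun T hT h0 hs => absurd (h T hT hs) h0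

theorem NoShortZeroSum.zeroSumFree {k : ℕ} {S : Multiset G} (h : NoShortZeroSum k S)
    (hc : card S ≤ k) : ZeroSumFree S := fun T hT hs => by
  by_contra h0
  have := h T hT h0 hs
  have := card_le_card hT
  omega

theorem NoShortZeroSum.count_lt [DecidableEq G] {k : ℕ} {S : Multiset G} (h : NoShortZeroSum k S)
    (hk : 0 < k) {g : G} (hg : k • g = 0) : S.count g < k := by
  by_contra! hc
  have := h (replicate k g) (Multiset.le_count_iff_replicate_le.1 hc)
    (fun h0 => by have := congrArg card h0; simp at this; omega) (by simp [hg])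
  simp at this

theorem exists_le_of_le_map {α β : Type*} {f : α → β} {T : Multiset β} {S : Multiset α}
    (h : T ≤ S.map f) : ∃ T' ≤ S, T'.map f = T := by
  induction T using Multiset.induction generalizing S with
  | empty => exact ⟨0, Multiset.zero_le _, rfl⟩
  | cons a T ih =>
    obtain ⟨b, hb, rfl⟩ := Multiset.mem_map.1 (Multiset.mem_of_le h (Multiset.mem_cons_self _ _))
    obtain ⟨S', rfl⟩ := Multiset.exists_cons_of_mem hb
    rw [Multiset.map_cons, Multiset.cons_le_cons_iff] at h
    obtain ⟨T', hT', rfl⟩ := ih h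
    exact ⟨b ::ₘ T', Multiset.cons_le_cons _ hT', by simp⟩

theorem exists_le_card_eq {α : Type*} {S : Multiset α} {n : ℕ} (h : n ≤ card S) :
    ∃ T ≤ S, card T = n := by
  refine ⟨(S.toList.take n : Multiset α), ?_, by simpa using h⟩
  conv_rhs => rw [← Multiset.coe_toList S]
  exact (List.take_sublist n S.toList).subperm

end MultisetBasics

theorem zmod_three_pair_sum :
    ∀ v : ZMod 3 × ZMod 3, ({v, -v} : Finset (ZMod 3 × ZMod 3)).val.sum = 0 := by
  decide

section MinZeroSumPrime

open Multiset

variable {p : ℕ} [Fact p.Prime]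

theorem IsMinZeroSumSeq.family {G : Type*} [AddCommGroup G] [DecidableEq G] {T : Multiset G}
    (hT : IsMinZeroSumSeq T) : IsMinZeroSum (fun i : T => (i : G)) := by
  refine ⟨?_, fun I hI => ?_⟩
  · rw [Finset.sum, Multiset.map_univ_coe, hT.sum_eq]
  · have hle : I.val.map (fun i : T => (i : G)) ≤ T := by
      conv_rhs => rw [← Multiset.map_univ_coe T]
      exact Multiset.map_le_map (Finset.val_le_iff.2 (Finset.subset_univ I))
    rcases hT.minimal _ hle hI with h | h
    · left
      simpa using h
    · right
      have hcard := congrArg card h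
      rw [card_map] at hcard
      apply Finset.eq_univ_of_card
      rw [Multiset.card_coe]; exact hcard

theorem IsMinZeroSumSeq.count_lt_prime {T : Multiset (ZMod p × ZMod p)} (hT : IsMinZeroSumSeq T)
    (hp : 2 ≤ p) (hc : card T = 2 * p - 1) (g : ZMod p × ZMod p) : T.count g < p := by
  by_contra! hle
  rcases hT.minimal _ (Multiset.le_count_iff_replicate_le.1 hle) (by ext <;> simp) with h0 | h0
  · have := congrArg card h0
    simp at this; omega
  · have := congrArg card h0
    simp [hc] at this; omega

theorem IsMinZeroSumSeq.exists_count_of_five_le {T : Multiset (ZMod p × ZMod p)}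
    (hT : IsMinZeroSumSeq T)
    (hp5 : 5 ≤ p) (hc : card T = 2 * p - 1) : ∃ g, T.count g = p - 1 := by
  classical
  have hcard : Fintype.card T = 2 * p - 1 := by rw [Multiset.card_coe, hc]
  obtain ⟨x, y, h, hiff⟩ := hT.family.exists_coords hcard hp5
  have h2 : (2 : ZMod p) ≠ 0 := by
    intro h
    have : ((2 : ℕ) : ZMod p) = 0 := by exact_mod_cast h
    rw [ZMod.natCast_eq_zero_iff] at this
    have := Nat.le_of_dvd (by norm_num) this
    omega
  obtain ⟨i, hi⟩ := h.exists_mult h2 (by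
    rw [hcard, Nat.cast_sub (by omega)]; simp)
  refine ⟨i, ?_⟩
  have hcount : ∀ g, T.count g = Multiset.card
      (Multiset.filter (fun j : T => g = (j : ZMod p × ZMod p)) Finset.univ.val) := fun g => by
    rw [Multiset.count_eq_card_filter_eq]
    conv_lhs => rw [← Multiset.map_univ_coe T, Multiset.filter_map, card_map]
    rfl
  have hm : coordMult x y i = T.count (i : ZMod p × ZMod p) := by
    rw [hcount]
    simp only [coordMult, Finset.card_def, Finset.filter_val]
    convert congrArg card (Multiset.filter_congr (s := (Finset.univ : Finset T).val)
      fun j _ => (hiff j i).symm.trans eq_comm)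
  rw [hm] at hi
  have hlt := hT.count_lt_prime (by omega) hc (i : ZMod p × ZMod p)
  have : ((T.count (i : ZMod p × ZMod p) + 1 : ℕ) : ZMod p) = 0 := by
    push_cast; rw [hi]; ring
  rw [ZMod.natCast_eq_zero_iff] at this
  have := Nat.le_of_dvd (by omega) this
  omega

theorem IsMinZeroSumSeq.exists_count {T : Multiset (ZMod p × ZMod p)} (hT : IsMinZeroSumSeq T)
    (hp3 : 3 ≤ p) (hc : card T = 2 * p - 1) : ∃ g, T.count g = p - 1 := by
  by_cases hp5 : 5 ≤ p
  · exact hT.exists_count_of_five_le hp5 hc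
  obtain rfl : p = 3 := by
    have := (Fact.out : p.Prime)
    interval_cases p
    · rfl
    · exact absurd this (by norm_num)
  by_contra! hne
  have hnd : T.Nodup := Multiset.nodup_iff_count_le_one.2 fun g => by
    have := hT.count_lt_prime (by omega) hc g
    have := hne g
    omega
  have hneg : ∀ v ∈ T, -v ∉ T := by
    intro v hv hv'
    have hle : ({v, -v} : Finset (ZMod 3 × ZMod 3)).val ≤ T := by
      rw [Multiset.le_iff_subset (Finset.nodup _)]
      intro x hx
      rw [Finset.mem_val, Finset.mem_insert, Finset.mem_singleton] at hx
      rcases hx with rfl | rfl <;> assumption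
    rcases hT.minimal _ hle (zmod_three_pair_sum v) with h0 | h0
    · exact Finset.insert_ne_empty _ _ (Finset.val_eq_zero.1 h0)
    · have := congrArg card h0
      rw [hc, Finset.card_val] at this
      have := Finset.card_le_two (a := v) (b := -v)
      omega
  have hdisj : Disjoint T.toFinset (T.toFinset.map (Equiv.neg _).toEmbedding) := by
    rw [Finset.disjoint_right]
    intro x hx hx'
    simp only [Finset.mem_map, mem_toFinset, Equiv.coe_toEmbedding, Equiv.neg_apply] at hx hx'
    obtain ⟨v, hv, rfl⟩ := hx
    exact hneg v hv hx'
  have := Finset.card_le_univ (T.toFinset ∪ T.toFinset.map (Equiv.neg _).toEmbedding)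
  rw [Finset.card_union_of_disjoint hdisj, Finset.card_map, Multiset.toFinset_card_of_nodup hnd, hc,
    Fintype.card_prod, ZMod.card] at this
  omega

end MinZeroSumPrime

section Davenport

open MvPolynomial

variable {p : ℕ} [Fact p.Prime]

theorem exists_nonempty_sum_eq_zero {ι : Type*} [Fintype ι] {d : ℕ} (v : ι → Fin d → ZMod p)
    (h : d * (p - 1) < Fintype.card ι) : ∃ I : Finset ι, I.Nonempty ∧ ∑ i ∈ I, v i = 0 := by
  classical
  have hp := (Fact.out : p.Prime)
  have hp1 : p - 1 ≠ 0 := by have := hp.two_le; omega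
  let f : Fin d → MvPolynomial ι (ZMod p) := fun k => ∑ i, C (v i k) * X i ^ (p - 1)
  have hdeg : ∑ k, (f k).totalDegree < Fintype.card ι := by
    refine lt_of_le_of_lt (Finset.sum_le_card_nsmul _ _ (p - 1) fun k _ => ?_) (by simpa using h)
    refine totalDegree_finsetSum_le fun i _ => ?_
    refine (totalDegree_mul _ _).trans ?_
    rw [totalDegree_C, zero_add, totalDegree_X_pow]
  have hdvd := char_dvd_card_solutions_of_fintype_sum_lt p hdeg
  have h0 : ∀ k, eval (0 : ι → ZMod p) (f k) = 0 := fun k => by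
    simp [f, hp1]
  have hgt : 1 < Fintype.card {x : ι → ZMod p // ∀ k, eval x (f k) = 0} := by
    refine lt_of_lt_of_le hp.one_lt (Nat.le_of_dvd (Fintype.card_pos_iff.2 ⟨⟨0, h0⟩⟩) ?_)
    convert hdvd
  obtain ⟨⟨x, hx⟩, hne⟩ := Fintype.exists_ne_of_one_lt_card hgt ⟨0, h0⟩
  refine ⟨Finset.univ.filter fun i => x i ≠ 0, ?_, ?_⟩
  · by_contra hemp
    rw [Finset.not_nonempty_iff_eq_empty, Finset.filter_eq_empty_iff] at hemp
    exact hne (Subtype.ext (funext fun i => by simpa using hemp (Finset.mem_univ i)))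
  · ext k
    have := hx k
    simp only [f, map_sum, map_mul, eval_C, map_pow, eval_X] at this
    rw [Finset.sum_filter, Finset.sum_apply, Pi.zero_apply]
    refine (Finset.sum_congr rfl fun i _ => ?_).trans this
    split_ifs with hi
    · rw [ZMod.pow_card_sub_one_eq_one hi, mul_one]
    · rw [not_ne_iff.1 hi]; simp [hp1]

theorem exists_le_map_sum_eq_zero {α : Type*} {d : ℕ} (v : α → Fin d → ZMod p) (S : Multiset α)
    (h : d * (p - 1) < Multiset.card S) : ∃ T ≤ S, T ≠ 0 ∧ ∀ k, (T.map fun a => v a k).sum = 0 := by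
  classical
  obtain ⟨I, hne, hI⟩ := exists_nonempty_sum_eq_zero (fun i : S => v i) (by simpa using h)
  refine ⟨I.val.map (fun i : S => (i : α)), ?_, ?_, ?_⟩
  · conv_rhs => rw [← Multiset.map_univ_coe S]
    exact Multiset.map_le_map (Finset.val_le_iff.2 (Finset.subset_univ I))
  · simpa using hne.ne_empty
  · intro k
    rw [Multiset.map_map]
    simpa using congrFun hI k

end Davenport

section EtaPrime

open Multiset

variable {p : ℕ} [Fact p.Prime]

theorem sum_eq_zero_of_fst_snd {A B : Type*} [AddCommMonoid A] [AddCommMonoid B]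
    {T : Multiset (A × B)} (h1 : (T.map Prod.fst).sum = 0) (h2 : (T.map Prod.snd).sum = 0) :
    T.sum = 0 :=
  Prod.ext ((map_multiset_sum (AddMonoidHom.fst A B) T).trans h1)
    ((map_multiset_sum (AddMonoidHom.snd A B) T).trans h2)

theorem ZeroSumFree.card_le {S : Multiset (ZMod p × ZMod p)} (hS : ZeroSumFree S) :
    card S ≤ 2 * (p - 1) := by
  by_contra! h
  obtain ⟨T, hT, h0, hs⟩ := exists_le_map_sum_eq_zero (fun g => ![g.1, g.2]) S h
  exact h0 (hS T hT (sum_eq_zero_of_fst_snd (hs 0) (hs 1)))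

theorem exists_zeroSum_dvd_card {S : Multiset (ZMod p × ZMod p)} (h : 3 * (p - 1) < card S) :
    ∃ T ≤ S, T ≠ 0 ∧ T.sum = 0 ∧ p ∣ card T := by
  obtain ⟨T, hT, h0, hs⟩ := exists_le_map_sum_eq_zero (fun g => ![g.1, g.2, 1]) S h
  refine ⟨T, hT, h0, sum_eq_zero_of_fst_snd (hs 0) (hs 1), ?_⟩
  have := hs 2
  simpa [ZMod.natCast_eq_zero_iff] using this

theorem exists_zeroSum_dvd_card_or {S : Multiset (ZMod p × ZMod p)} (h : 3 * (p - 1) ≤ card S) :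
    ∃ T ≤ S, T ≠ 0 ∧ T.sum = 0 ∧ (p ∣ card T ∨ p ∣ card T + 1) := by
  have hp := (Fact.out : p.Prime).two_le
  obtain ⟨T, hT, h0, hs⟩ := exists_le_map_sum_eq_zero
    (fun o : Option (ZMod p × ZMod p) => o.elim ![0, 0, 1] fun g => ![g.1, g.2, 1])
    (none ::ₘ S.map some) (d := 3) (by simpa using by omega)
  have hcase : (∃ T' ≤ S, T = T'.map some) ∨ ∃ T' ≤ S, T = none ::ₘ T'.map some := by
    by_cases hmem : none ∈ T
    · right
      obtain ⟨U, rfl⟩ := Multiset.exists_cons_of_mem hmem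
      rw [Multiset.cons_le_cons_iff] at hT
      obtain ⟨T', hT', rfl⟩ := exists_le_of_le_map hT
      exact ⟨T', hT', rfl⟩
    · left
      obtain ⟨T', hT', rfl⟩ := exists_le_of_le_map ((Multiset.le_cons_of_notMem hmem).1 hT)
      exact ⟨T', hT', rfl⟩
  obtain ⟨T', hT', rfl⟩ | ⟨T', hT', rfl⟩ := hcase
  · refine ⟨T', hT', by rintro rfl; simp at h0, sum_eq_zero_of_fst_snd ?_ ?_, Or.inl ?_⟩
    · simpa [Multiset.map_map, Function.comp_def] using hs 0
    · simpa [Multiset.map_map, Function.comp_def] using hs 1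
    · simpa [Multiset.map_map, Function.comp_def, ZMod.natCast_eq_zero_iff] using hs 2
  · refine ⟨T', hT', ?_, sum_eq_zero_of_fst_snd ?_ ?_, Or.inr ?_⟩
    · rintro rfl; simpa using hs 2
    · simpa [Multiset.map_map, Function.comp_def] using hs 0
    · simpa [Multiset.map_map, Function.comp_def] using hs 1
    · have := hs 2
      rw [← ZMod.natCast_eq_zero_iff]
      simpa [Multiset.map_map, Function.comp_def, add_comm] using this

/-- A zero-sum sequence of length `2 p` over `C_p ⊕ C_p` splits. -/
theorem exists_short_of_card_eq {S : Multiset (ZMod p × ZMod p)} (hs : S.sum = 0)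
    (hc : card S = 2 * p) : ¬ NoShortZeroSum p S := fun h => by
  have hp := (Fact.out : p.Prime).two_le
  have hmin := h.isMinZeroSumSeq hs (by omega)
  obtain ⟨g, hg⟩ : ∃ g, g ∈ S := Multiset.card_pos_iff_exists_mem.1 (by omega)
  obtain ⟨S', rfl⟩ := Multiset.exists_cons_of_mem hg
  have := (hmin.zeroSumFree_of_lt (Multiset.lt_cons_self S' g)).card_le
  rw [card_cons] at hc
  omega

theorem NoShortZeroSum.card_le_of_prime {S : Multiset (ZMod p × ZMod p)} (h : NoShortZeroSum p S) :
    card S ≤ 3 * (p - 1) := by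
  have hp := (Fact.out : p.Prime).two_le
  by_contra! hc
  obtain ⟨S', hS', hc'⟩ := exists_le_card_eq (S := S) (n := 3 * (p - 1) + 1) (by omega)
  obtain ⟨T, hT, h0, hs, k, hk⟩ := exists_zeroSum_dvd_card (S := S') (by omega)
  have h' := h.mono (hT.trans hS')
  have h1 := h' T le_rfl h0 hs
  have h2 := Multiset.card_le_card hT
  have hk1 : 1 < k := by by_contra!; nlinarith
  have hk2 : k < 3 := by by_contra!; nlinarith [Nat.sub_add_cancel (by omega : 1 ≤ p)]
  obtain rfl : k = 2 := by omega
  exact exists_short_of_card_eq hs (by omega) h'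

end EtaPrime

section Rigidity

open Multiset

variable {G : Type*} [AddCommGroup G]

theorem exists_add_eq_of_le_add {α : Type*} {T A B : Multiset α} (h : T ≤ A + B) :
    ∃ A' ≤ A, ∃ B' ≤ B, T = A' + B' := by
  classical
  exact ⟨T ∩ A, Multiset.inter_le_right, T - A, tsub_le_iff_left.2 h, by
    rw [add_comm, Multiset.sub_add_inter]⟩

theorem ZeroSumFree.card_lt_card_subsums [DecidableEq G] [Finite G] {W : Multiset G}
    (hW : ZeroSumFree W) : card W < (W.powerset.map sum).toFinset.card := by
  induction W using Multiset.induction with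
  | empty => simp
  | cons a W ih =>
    have ih := ih (hW.mono (Multiset.le_cons_self W a))
    have hsub : (W.powerset.map sum).toFinset ⊆ ((a ::ₘ W).powerset.map sum).toFinset := by
      intro x hx
      simp only [mem_toFinset, mem_map, mem_powerset] at hx ⊢
      obtain ⟨T, hT, rfl⟩ := hx
      exact ⟨T, hT.trans (Multiset.le_cons_self W a), rfl⟩
    rw [card_cons]
    refine lt_of_le_of_lt ih (Finset.card_lt_card ((Finset.ssubset_iff_of_subset hsub).2 ?_))
    by_contra! hall
    have hshift : (W.powerset.map sum).toFinset.map (addLeftEmbedding a) =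
        (W.powerset.map sum).toFinset := by
      refine Finset.eq_of_subset_of_card_le (fun x hx => hall x ?_) (by simp)
      simp only [Finset.mem_map, mem_toFinset, mem_map, mem_powerset,
        addLeftEmbedding_apply] at hx ⊢
      obtain ⟨_, ⟨T, hT, rfl⟩, rfl⟩ := hx
      exact ⟨a ::ₘ T, Multiset.cons_le_cons a hT, by simp⟩
    have h0 : (0 : G) ∈ (W.powerset.map sum).toFinset := by
      simp only [mem_toFinset, mem_map, mem_powerset]
      exact ⟨0, Multiset.zero_le _, by simp⟩
    rw [← hshift] at h0
    simp only [Finset.mem_map, mem_toFinset, mem_map, mem_powerset, addLeftEmbedding_apply] at h0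
    obtain ⟨_, ⟨T, hT, rfl⟩, h0⟩ := h0
    have := hW (a ::ₘ T) (Multiset.cons_le_cons a hT) (by simpa using h0)
    simp at this

theorem ZeroSumFree.card_lt [Finite G] {W : Multiset G} (hW : ZeroSumFree W) :
    card W < Nat.card G := by
  classical
  have := Fintype.ofFinite G
  rw [Nat.card_eq_fintype_card]
  exact hW.card_lt_card_subsums.trans_le (Finset.card_le_univ _)

theorem ZeroSumFree.eq_of_mem [Finite G] {W : Multiset G} (hW : ZeroSumFree W)
    (hc : Nat.card G ≤ card W + 1) {a b : G} (ha : a ∈ W) (hb : b ∈ W) : a = b := by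
  classical
  have := Fintype.ofFinite G
  by_contra hab
  obtain ⟨W, rfl⟩ := Multiset.exists_cons_of_mem ha
  obtain ⟨W, rfl⟩ := Multiset.exists_cons_of_mem
    ((Multiset.mem_cons.1 hb).resolve_left (Ne.symm hab))
  have hle : W ≤ a ::ₘ b ::ₘ W := (Multiset.le_cons_self _ _).trans (Multiset.le_cons_self _ _)
  have h1 := (hW.mono hle).card_lt_card_subsums
  have hna : a ≠ 0 := fun h => by
    have := hW {a} (by simp) (by simp [h]); simp at this
  have hnb : b ≠ 0 := fun h => by
    have := hW {b} (by simp) (by simp [h]); simp at this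
  have hdisj : Disjoint (W.powerset.map sum).toFinset {-a, -b, -(a + b)} := by
    rw [Finset.disjoint_right]
    intro x hx hx'
    simp only [mem_toFinset, mem_map, mem_powerset] at hx'
    obtain ⟨T, hT, rfl⟩ := hx'
    simp only [Finset.mem_insert, Finset.mem_singleton] at hx
    have key : ∀ U : Multiset G, U ≠ 0 → U ≤ {a, b} → T.sum ≠ -U.sum := fun U h0 hU hs => by
      have hle : U + T ≤ a ::ₘ b ::ₘ W := by
        have := add_le_add hU hT
        simpa using this
      have := hW (U + T) hle (by rw [sum_add, hs]; abel)
      exact h0 (Multiset.le_zero.1 (this ▸ Multiset.le_add_right U T))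
    rcases hx with h | h | h
    · exact key {a} (by simp) (by simp) (by simpa using h)
    · exact key {b} (by simp) (by simp) (by simpa using h)
    · exact key {a, b} (by simp) le_rfl (by simpa using h)
  have h3 : ({-a, -b, -(a + b)} : Finset G).card = 3 := by
    rw [Finset.card_eq_three]
    exact ⟨_, _, _, by simpa using hab, by simpa using hnb, by simpa using hna, rfl⟩
  have h4 := Finset.card_le_univ ((W.powerset.map sum).toFinset ∪ {-a, -b, -(a + b)})
  rw [Finset.card_union_of_disjoint hdisj, h3, ← Nat.card_eq_fintype_card] at h4
  simp only [card_cons] at hc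
  omega

theorem ZeroSumFree.map_quotient {g : G} (hg : 0 < addOrderOf g) {K : Multiset G}
    (h : ZeroSumFree (replicate (addOrderOf g - 1) g + K)) :
    ZeroSumFree (K.map (QuotientAddGroup.mk' (AddSubgroup.zmultiples g))) := by
  intro T hT h0
  obtain ⟨T, hTK, rfl⟩ := exists_le_of_le_map hT
  rw [← map_multiset_sum, QuotientAddGroup.mk'_apply, QuotientAddGroup.eq_zero_iff,
    ← neg_mem_iff] at h0
  obtain ⟨k, hk⟩ := h0
  obtain ⟨c, hc, hcs⟩ : ∃ c < addOrderOf g, c • g = -T.sum := by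
    refine ⟨(k % addOrderOf g).toNat, ?_, ?_⟩
    · have := Int.emod_lt_of_pos k (by exact_mod_cast hg : (0 : ℤ) < addOrderOf g)
      have := Int.emod_nonneg k (by omega : (addOrderOf g : ℤ) ≠ 0)
      omega
    · rw [← hk, ← natCast_zsmul, Int.toNat_of_nonneg (Int.emod_nonneg k (by omega)),
        mod_addOrderOf_zsmul]
  have := h (replicate c g + T) (add_le_add (Multiset.replicate_le_replicate _ |>.2 (by omega)) hTK)
    (by rw [sum_add, sum_replicate, hcs]; abel)
  have hT0 : T = 0 := Multiset.le_zero.1 (this ▸ Multiset.le_add_left T _)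
  simp [hT0]

theorem ZeroSumFree.sub_mem_zmultiples [Finite G] {g : G} {K : Multiset G}
    (h : ZeroSumFree (replicate (addOrderOf g - 1) g + K))
    (hc : Nat.card G ≤ addOrderOf g * (card K + 1)) {a b : G} (ha : a ∈ K) (hb : b ∈ K) :
    a - b ∈ AddSubgroup.zmultiples g := by
  have hg : 0 < addOrderOf g := addOrderOf_pos g
  have hcard : Nat.card G = Nat.card (G ⧸ AddSubgroup.zmultiples g) * addOrderOf g := by
    rw [AddSubgroup.card_eq_card_quotient_mul_card_addSubgroup (AddSubgroup.zmultiples g),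
      Nat.card_zmultiples]
  have := (h.map_quotient hg).eq_of_mem (by
    rw [card_map]; rw [hcard, mul_comm] at hc; exact Nat.le_of_mul_le_mul_left hc hg)
    (Multiset.mem_map_of_mem _ ha) (Multiset.mem_map_of_mem _ hb)
  rw [← sub_eq_zero, ← map_sub] at this
  exact (QuotientAddGroup.eq_zero_iff _).1 this

end Rigidity

section PropertyCPrime

open Multiset

variable {p : ℕ} [Fact p.Prime]

theorem ZMod.prod_nsmul_self {m : ℕ} (g : ZMod m × ZMod m) : m • g = 0 := by
  ext <;> simp

theorem zeroSumFree_of_replicate_add {e : ZMod p × ZMod p} {R : Multiset (ZMod p × ZMod p)}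
    (h : NoShortZeroSum p (replicate (p - 1) e + R)) (hc : card R ≤ 2 * p) : ZeroSumFree R := by
  have hp := (Fact.out : p.Prime).two_le
  intro J hJ hs
  by_contra h0
  have hJp : p < card J := h J (hJ.trans (Multiset.le_add_left _ _)) h0 hs
  have hJ2 := Multiset.card_le_card hJ
  refine exists_short_of_card_eq (S := J.map (· - e) + replicate (2 * p - card J) (-e)) ?_ ?_ ?_
  · rw [sum_add, Multiset.sum_map_sub, sum_replicate, map_const', sum_replicate,
      Multiset.map_id', hs]
    rw [zero_sub, smul_neg, ← neg_add, ← add_nsmul, Nat.add_sub_cancel' (by omega), mul_comm,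
      mul_nsmul, ZMod.prod_nsmul_self]; simp
  · simp; omega
  · intro T hT hT0 hTs
    by_contra! hTc
    obtain ⟨A, hA, B, hB, rfl⟩ := exists_add_eq_of_le_add hT
    obtain ⟨J', hJ', rfl⟩ := exists_le_of_le_map hA
    obtain ⟨c, hc', rfl⟩ := Multiset.le_replicate_iff.1 hB
    have hpos : 0 < card J' + c := by
      by_contra! h
      have h1 : card J' = 0 := by omega
      have h2 : c = 0 := by omega
      rw [card_eq_zero] at h1
      simp [h1, h2] at hT0
    simp only [card_add, card_map, card_replicate] at hTc
    rw [sum_add, Multiset.sum_map_sub, sum_replicate, map_const', sum_replicate, Multiset.map_id',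
      smul_neg, ← sub_eq_add_neg, sub_sub, ← add_nsmul, sub_eq_zero] at hTs
    have := h (replicate (p - card J' - c) e + J')
      (add_le_add ((Multiset.replicate_le_replicate _).2 (by omega)) (hJ'.trans hJ))
      (fun h => by
        have := congrArg card h
        simp only [card_add, card_replicate, card_zero] at this; omega)
      (by rw [sum_add, hTs, sum_replicate, ← add_nsmul,
            show p - card J' - c + (card J' + c) = p by omega, ZMod.prod_nsmul_self])
    simp only [card_add, card_replicate] at this
    omega

theorem zeroSumFree_map_sub_of_replicate_add {e : ZMod p × ZMod p}
    {R : Multiset (ZMod p × ZMod p)}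
    (h : NoShortZeroSum p (replicate (p - 1) e + R)) (hc : card R ≤ 2 * p) :
    ZeroSumFree (R.map (· - e)) := by
  have hp := (Fact.out : p.Prime).two_le
  intro J hJ hs
  obtain ⟨J, hJR, rfl⟩ := exists_le_of_le_map hJ
  by_contra h0
  have hJ0 : 0 < card J := card_pos.2 (by rintro rfl; simp at h0)
  have hJ2 := Multiset.card_le_card hJR
  rw [Multiset.sum_map_sub, map_const', sum_replicate, Multiset.map_id', sub_eq_zero] at hs
  have key : ∀ k, k ≤ p - 1 → p ∣ k + card J → k + card J ≤ 2 * p → False := by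
    rintro k hk ⟨l, hl⟩ hk2
    have hle : replicate k e + J ≤ replicate (p - 1) e + R :=
      add_le_add ((Multiset.replicate_le_replicate _).2 hk) hJR
    have hsum : (replicate k e + J).sum = 0 := by
      rw [sum_add, sum_replicate, hs, ← add_nsmul, hl, mul_nsmul, ZMod.prod_nsmul_self]; simp
    have hl2 : l ≤ 2 := by by_contra!; nlinarith
    interval_cases l
    · omega
    · have := h _ hle (fun h => by
        have := congrArg card h
        simp only [card_add, card_replicate, card_zero] at this; omega) hsum
      simp at this; omega
    · exact exists_short_of_card_eq hsum (by simp; omega) (h.mono hle)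
  rcases le_or_gt (card J) p with hle | hlt
  · exact key (p - card J) (by omega) ⟨1, by omega⟩ (by omega)
  · exact key (2 * p - card J) (by omega) ⟨2, by omega⟩ (by omega)

theorem ZeroSumFree.exists_count (hp3 : 3 ≤ p) {R : Multiset (ZMod p × ZMod p)}
    (h : ZeroSumFree R) (hc : card R = 2 * p - 2) :
    (∃ g, R.count g = p - 1) ∨ R.count (-R.sum) = p - 2 := by
  obtain ⟨g, hg⟩ := h.isMinZeroSumSeq.exists_count hp3 (by rw [card_cons]; omega)
  by_cases hgs : g = -R.sum
  · right
    rw [hgs, count_cons_self] at hg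
    omega
  · left
    exact ⟨g, by rwa [count_cons_of_ne hgs] at hg⟩

theorem NoShortZeroSum.ne_zero {G : Type*} [AddCommGroup G] {k : ℕ} {S : Multiset G}
    (h : NoShortZeroSum k S) (hk : 0 < k) {g : G} (hg : g ∈ S) : g ≠ 0 := by
  rintro rfl
  have := h {0} (by simpa) (by simp) (by simp)
  simp at this; omega

/-- In a sequence without short zero-sum subsequence, an element of multiplicity `p - 1`
spans a line containing no other term. -/
theorem NoShortZeroSum.notMem_zmultiples {e g : ZMod p × ZMod p} {S : Multiset (ZMod p × ZMod p)}
    (h : NoShortZeroSum p (replicate (p - 1) e + S)) (hg : g ∈ S) :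
    ∀ t : ZMod p, g ≠ t • e := by
  have hp := (Fact.out : p.Prime).two_le
  rintro t rfl
  have hne := h.ne_zero (by omega) (Multiset.mem_add.2 (Or.inr hg))
  have ht : t ≠ 0 := by rintro rfl; simp at hne
  have htv : t.val ≠ 0 := by simpa using ht
  have hle : replicate (p - t.val) e + {t • e} ≤ replicate (p - 1) e + S :=
    add_le_add ((Multiset.replicate_le_replicate _).2 (by omega)) (by simpa)
  have htl := ZMod.val_lt t
  have := h _ hle (by simp) (by
    rw [sum_add, sum_replicate, sum_singleton, ← Nat.cast_smul_eq_nsmul (ZMod p), ← add_smul,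
      Nat.cast_sub htl.le]
    simp)
  simp at this; omega

theorem addOrderOf_eq_of_ne_zero {g : ZMod p × ZMod p} (hg : g ≠ 0) : addOrderOf g = p :=
  addOrderOf_eq_prime (ZMod.prod_nsmul_self g) hg

theorem ZeroSumFree.exists_sub_eq_smul {g : ZMod p × ZMod p} {K : Multiset (ZMod p × ZMod p)}
    (h : ZeroSumFree (replicate (p - 1) g + K)) (hc : p ≤ card K + 1) {a b : ZMod p × ZMod p}
    (ha : a ∈ K) (hb : b ∈ K) : ∃ t : ZMod p, a - b = t • g := by
  have hp := (Fact.out : p.Prime).two_le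
  have hg : g ≠ 0 := (h.noShort 1).ne_zero one_pos (Multiset.mem_add.2 (Or.inl
    (by rw [mem_replicate]; exact ⟨by omega, rfl⟩)))
  have ho := addOrderOf_eq_of_ne_zero hg
  obtain ⟨k, hk⟩ := ZeroSumFree.sub_mem_zmultiples (g := g) (K := K) (by rwa [ho])
    (by rw [ho]; simp only [Nat.card_prod, Nat.card_zmod]; exact Nat.mul_le_mul_left _ hc) ha hb
  exact ⟨k, by rw [Int.cast_smul_eq_zsmul]; exact hk.symm⟩

end PropertyCPrime

section PropertyCPrimeLarge

open Multiset

variable {p : ℕ} [Fact p.Prime]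

theorem exists_replicate_add {α : Type*} [DecidableEq α] {S : Multiset α} {a : α} {k : ℕ}
    (h : k ≤ S.count a) : ∃ R, S = replicate k a + R :=
  Multiset.le_iff_exists_add.1 (Multiset.le_count_iff_replicate_le.1 h)

theorem mem_replicate_add {α : Type*} {k : ℕ} (hk : 0 < k) (a : α) (S : Multiset α) :
    a ∈ replicate k a + S :=
  Multiset.mem_add.2 (Or.inl (Multiset.mem_replicate.2 ⟨hk.ne', rfl⟩))

theorem NoShortZeroSum.exists_count_of_replicate_add (hp3 : 3 ≤ p) {e : ZMod p × ZMod p}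
    {R : Multiset (ZMod p × ZMod p)} (h : NoShortZeroSum p (replicate (p - 1) e + R))
    (hc : card R = 2 * p - 2) : ∃ g, R.count g = p - 1 := by
  have he : e ≠ 0 := h.ne_zero (by omega) (mem_replicate_add (by omega) _ _)
  have hR := zeroSumFree_of_replicate_add h (by omega)
  have hR' := zeroSumFree_map_sub_of_replicate_add h (by omega)
  have hcount : ∀ x, (R.map (· - e)).count x = R.count (x + e) := fun x => by
    have := Multiset.count_map_eq_count' (· - e) R sub_left_injective (x + e)
    simpa using this
  have hsum : -(R.map (· - e)).sum = -R.sum - e - e := by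
    rw [Multiset.sum_map_sub, map_const', sum_replicate, Multiset.map_id', hc]
    have h2 : (2 * p - 2) • e = -(2 • e) := by
      rw [eq_neg_iff_add_eq_zero, ← add_nsmul, Nat.sub_add_cancel (by omega), mul_nsmul,
        ZMod.prod_nsmul_self]
    rw [h2, two_nsmul]; abel
  rcases hR.exists_count hp3 hc with hg | h0
  · exact hg
  rcases hR'.exists_count hp3 (by rw [card_map, hc]) with ⟨g, hg⟩ | h1
  · exact ⟨g + e, by rw [← hcount, hg]⟩
  exfalso
  rw [hcount, hsum, sub_add_cancel] at h1
  obtain ⟨g, hg⟩ : ∃ g, g = -R.sum - e := ⟨_, rfl⟩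
  have hg0 : -R.sum = g + e := by rw [hg, sub_add_cancel]
  rw [← hg] at h1
  rw [hg0] at h0
  have hne : g ≠ g + e := by simpa using he
  obtain ⟨R₁, rfl⟩ := exists_replicate_add h0.ge
  rw [count_add, count_replicate, if_neg (Ne.symm hne), zero_add] at h1
  obtain ⟨H, rfl⟩ := exists_replicate_add h1.ge
  have hH : card H = 2 := by simp at hc; omega
  obtain ⟨a, b, rfl⟩ := card_eq_two.1 hH
  have hmin := hR.isMinZeroSumSeq
  have hmin' := hR'.isMinZeroSumSeq
  rw [hg0] at hmin
  rw [hsum, hg0, add_sub_cancel_right] at hmin'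
  have hZ : ZeroSumFree (replicate (p - 1) (g + e) + (replicate (p - 2) g + {a})) := by
    refine hmin.zeroSumFree_of_lt ?_
    rw [show p - 1 = p - 2 + 1 by omega, replicate_succ]
    refine lt_of_lt_of_eq (Multiset.lt_cons_self _ b) ?_
    simp only [insert_eq_cons, ← singleton_add]
    abel
  have hZ' : ZeroSumFree (replicate (p - 1) (g - e) + (replicate (p - 2) g + {a - e})) := by
    refine hmin'.zeroSumFree_of_lt ?_
    rw [show p - 1 = p - 2 + 1 by omega, replicate_succ]
    refine lt_of_lt_of_eq (Multiset.lt_cons_self _ (b - e)) ?_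
    simp only [Multiset.map_add, map_replicate, add_sub_cancel_right, insert_eq_cons,
      map_singleton, ← singleton_add]
    abel
  have hgK : ∀ x : ZMod p × ZMod p, g ∈ replicate (p - 2) g + {x} := fun x =>
    mem_replicate_add (by omega) _ _
  obtain ⟨α, hα⟩ := hZ.exists_sub_eq_smul (a := a) (b := g) (by simp; omega) (by simp) (hgK _)
  obtain ⟨β, hβ⟩ := hZ'.exists_sub_eq_smul (a := a - e) (b := g) (by simp; omega) (by simp) (hgK _)
  have hge := h.notMem_zmultiples (g := g)
    (Multiset.mem_add.2 (Or.inr (mem_replicate_add (by omega) _ _)))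
  have hrel : (α - β) • g = (1 - β - α) • e := by
    rw [sub_sub, add_comm e g, ← sub_sub, hα, smul_add, smul_sub, sub_eq_iff_eq_add] at hβ
    rw [sub_smul, sub_smul, sub_smul, one_smul]
    linear_combination (exp := 1) hβ
  have hαβ : α = β := by
    by_contra hne
    refine hge ((α - β)⁻¹ * (1 - β - α)) ?_
    rw [mul_smul, ← hrel, inv_smul_smul₀ (sub_ne_zero.2 hne)]
  have h2α : 2 * α = 1 := by
    rw [hαβ, sub_self, zero_smul, eq_comm, smul_eq_zero] at hrel
    have := hrel.resolve_right he
    rw [hαβ]; linear_combination -this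
  obtain ⟨k, hk⟩ : ∃ k, p = 2 * k + 1 :=
    (Fact.out : p.Prime).odd_of_ne_two (by omega)
  have hk2 : 2 * (k : ZMod p) = -1 := by
    have : ((2 * k + 1 : ℕ) : ZMod p) = 0 := by rw [← hk]; simp
    push_cast at this
    linear_combination this
  have hαk : α + k = 0 := by
    have h2 : (2 : ZMod p) ≠ 0 := by rintro h; rw [h, zero_mul] at h2α; exact zero_ne_one h2α
    refine (mul_eq_zero.1 (?_ : 2 * (α + k) = 0)).resolve_left h2
    rw [mul_add, h2α, hk2]; ring
  have hle : replicate k e + (replicate (k - 1) g + {a}) ≤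
      replicate (p - 1) e + (replicate (p - 2) (g + e) + (replicate (p - 2) g + {a, b})) := by
    refine add_le_add ((Multiset.replicate_le_replicate _).2 (by omega))
      (le_add_of_nonneg_of_le (Multiset.zero_le _) (add_le_add
        ((Multiset.replicate_le_replicate _).2 (by omega)) (by simp)))
  have := h _ hle (by simp) (by
    have ha : a = g + α • (g + e) := by rw [← hα]; abel
    rw [sum_add, sum_add, sum_replicate, sum_replicate, sum_singleton, ha,
      ← Nat.cast_smul_eq_nsmul (ZMod p), ← Nat.cast_smul_eq_nsmul (ZMod p), Nat.cast_sub (by omega),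
      eq_neg_of_add_eq_zero_left hαk, smul_add, sub_smul]
    simp only [neg_smul, Nat.cast_one, one_smul]
    abel)
  simp at this
  omega

theorem NoShortZeroSum.eq_of_replicate_add {e g : ZMod p × ZMod p}
    {R : Multiset (ZMod p × ZMod p)}
    (h : NoShortZeroSum p (replicate (p - 1) e + (replicate (p - 1) g + R)))
    (hc : card R = p - 1) : ∃ c, R = replicate (p - 1) c := by
  have hp := (Fact.out : p.Prime).two_le
  obtain ⟨c, hcR⟩ : ∃ c, c ∈ R := card_pos_iff_exists_mem.1 (by omega)
  refine ⟨c, Multiset.eq_replicate.2 ⟨hc, fun b hb => ?_⟩⟩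
  have h' : NoShortZeroSum p (replicate (p - 1) g + (replicate (p - 1) e + R)) := by
    rwa [add_left_comm]
  obtain ⟨s, hs⟩ := (zeroSumFree_of_replicate_add h (by simp; omega)).exists_sub_eq_smul (by omega)
    hb hcR
  obtain ⟨t, ht⟩ := (zeroSumFree_of_replicate_add h' (by simp; omega)).exists_sub_eq_smul (by omega)
    hb hcR
  have hge := h.notMem_zmultiples (g := g) (mem_replicate_add (by omega) _ _)
  by_cases hs0 : s = 0
  · rw [hs0, zero_smul] at hs
    exact sub_eq_zero.1 hs
  · exfalso
    refine hge (s⁻¹ * t) ?_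
    rw [mul_smul, ← ht, hs, inv_smul_smul₀ hs0]

/-- Sequences of length `3 m - 3` over `C_m ⊕ C_m` without short zero-sum subsequence have
three distinct terms. -/
def PropertyC (m : ℕ) : Prop :=
  ∀ S : Multiset (ZMod m × ZMod m), card S = 3 * m - 3 → NoShortZeroSum m S →
    ∃ a b c, S = replicate (m - 1) a + (replicate (m - 1) b + replicate (m - 1) c)

theorem propertyC_of_prime_of_three_le (hp3 : 3 ≤ p) : PropertyC p := by
  intro S hc h
  obtain ⟨T, hTS, hT0, hTs, hdvd⟩ := exists_zeroSum_dvd_card_or (S := S) (by omega)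
  have hTp := h T hTS hT0 hTs
  have hTc := Multiset.card_le_card hTS
  have hT2 : card T = 2 * p - 1 := by
    rcases hdvd with ⟨k, hk⟩ | ⟨k, hk⟩
    · have hk1 : 1 < k := by by_contra!; nlinarith
      have hk2 : k < 3 := by by_contra!; nlinarith [Nat.sub_add_cancel (by omega : 3 ≤ 3 * p)]
      obtain rfl : k = 2 := by omega
      exact absurd (h.mono hTS) (exists_short_of_card_eq hTs (by omega))
    · have hk1 : 1 < k := by by_contra!; nlinarith
      have hk2 : k < 3 := by by_contra!; nlinarith [Nat.sub_add_cancel (by omega : 3 ≤ 3 * p)]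
      obtain rfl : k = 2 := by omega
      omega
  obtain ⟨e, he⟩ := ((h.mono hTS).isMinZeroSumSeq hTs (by omega)).exists_count hp3 hT2
  obtain ⟨R, rfl⟩ := exists_replicate_add (he.ge.trans (Multiset.count_le_of_le e hTS))
  have hR : card R = 2 * p - 2 := by simp at hc; omega
  obtain ⟨g, hg⟩ := h.exists_count_of_replicate_add hp3 hR
  obtain ⟨R, rfl⟩ := exists_replicate_add hg.ge
  obtain ⟨c, rfl⟩ := h.eq_of_replicate_add (by simp at hR; omega)
  exact ⟨e, g, c, rfl⟩

theorem propertyC_of_prime : PropertyC p := by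
  by_cases hp3 : 3 ≤ p
  · exact propertyC_of_prime_of_three_le hp3
  · obtain rfl : p = 2 := by have := (Fact.out : p.Prime).two_le; omega
    intro S hc _
    obtain ⟨a, b, c, rfl⟩ := card_eq_three.1 hc
    exact ⟨a, b, c, rfl⟩

end PropertyCPrimeLarge

section Blocks

open Multiset

variable {G K : Type*} [AddCommGroup G] [AddCommGroup K]
  {φ : G →+ K} {a b t : ℕ} {S R : Multiset G} {Bs : Multiset (Multiset G)}

/-- A short sequence whose image under `φ` has sum zero. -/
structure IsBlock (φ : G →+ K) (a : ℕ) (T : Multiset G) : Prop where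
  ne_zero : T ≠ 0
  card_le : card T ≤ a
  map_sum : φ T.sum = 0

/-- A decomposition of a sequence into blocks and a remainder. -/
structure BlockDecomp (φ : G →+ K) (a : ℕ) (S : Multiset G) (Bs : Multiset (Multiset G))
    (R : Multiset G) : Prop where
  eq : S = Bs.join + R
  block : ∀ T ∈ Bs, IsBlock φ a T

theorem BlockDecomp.card_join_le (h : BlockDecomp φ a S Bs R) : card Bs.join ≤ a * card Bs := by
  rw [card_join, mul_comm, ← smul_eq_mul, ← card_map card Bs]
  refine Multiset.sum_le_card_nsmul _ _ fun x hx => ?_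
  obtain ⟨T, hT, rfl⟩ := Multiset.mem_map.1 hx
  exact (h.block T hT).card_le

theorem BlockDecomp.noShort (h : BlockDecomp φ a S Bs R) (hS : NoShortZeroSum (a * b) S) :
    NoShortZeroSum b (Bs.map sum) := by
  intro U hU hU0 hUs
  obtain ⟨U, hUB, rfl⟩ := exists_le_of_le_map hU
  obtain ⟨V, rfl⟩ := Multiset.le_iff_exists_add.1 hUB
  have hle : U.join ≤ S := by
    rw [h.eq, join_add, add_assoc]; exact Multiset.le_add_right _ _
  have hd : BlockDecomp φ a U.join U 0 :=
    ⟨by simp, fun T hT => h.block T (Multiset.mem_add.2 (Or.inl hT))⟩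
  have hne : U.join ≠ 0 := by
    rintro h0
    obtain ⟨T, hT⟩ := Multiset.exists_mem_of_ne_zero (s := U) (by rintro rfl; simp at hU0)
    refine (hd.block T hT).ne_zero (Multiset.eq_zero_of_forall_notMem fun x hx => ?_)
    have : x ∈ U.join := mem_join.2 ⟨T, hT, hx⟩
    simp [h0] at this
  have := hS _ hle hne (by rw [sum_join, hUs])
  rw [card_map]
  exact Nat.lt_of_mul_lt_mul_left (this.trans_le hd.card_join_le)

theorem BlockDecomp.extend {T : Multiset G} (h : BlockDecomp φ a S Bs (T + R))
    (hT : IsBlock φ a T) : BlockDecomp φ a S (T ::ₘ Bs) R :=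
  ⟨by rw [h.eq, join_cons]; abel, by simpa using ⟨hT, h.block⟩⟩

theorem BlockDecomp.remove {T : Multiset G} (h : BlockDecomp φ a S (T ::ₘ Bs) R) :
    BlockDecomp φ a S Bs (T + R) :=
  ⟨by rw [h.eq, join_cons]; abel, fun U hU => h.block U (Multiset.mem_cons_of_mem hU)⟩

theorem exists_isBlock_of_not_noShort (h : ¬ NoShortZeroSum a (R.map φ)) :
    ∃ T ≤ R, IsBlock φ a T := by
  simp only [NoShortZeroSum, not_forall, not_lt] at h
  obtain ⟨T, hT, h0, hs, hc⟩ := h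
  obtain ⟨T, hTR, rfl⟩ := exists_le_of_le_map hT
  exact ⟨T, hTR, by rintro rfl; simp at h0, by simpa using hc, by rw [map_multiset_sum, hs]⟩

variable [DecidableEq K]

/-- The hypotheses under which short zero-sum subsequences are studied by means of `φ`: `K` plays
the role of `C_a ⊕ C_a`, and the kernel of `φ` that of a group of exponent `b` in which `t` is the
maximal length of a sequence without short zero-sum subsequence. -/
structure BlockSetup (φ : G →+ K) (a b t : ℕ) : Prop where
  two_le : 2 ≤ a
  nsmul_eq_zero : ∀ k : K, a • k = 0
  card_le : ∀ R : Multiset K, NoShortZeroSum a R → card R ≤ 3 * a - 3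
  count_eq : ∀ R : Multiset K, card R = 3 * a - 3 → NoShortZeroSum a R →
    ∀ x ∈ R, R.count x = a - 1
  ker_card_le : ∀ L : Multiset G, (∀ g ∈ L, φ g = 0) → NoShortZeroSum b L → card L ≤ t
  ker_rigid : ∀ (W : Multiset G) (σ σ' : G), (∀ g ∈ W, φ g = 0) → φ σ = 0 → φ σ' = 0 →
    card W + 1 = t → NoShortZeroSum b (σ ::ₘ W) → NoShortZeroSum b (σ' ::ₘ W) → σ = σ'

theorem BlockDecomp.card_le (h : BlockDecomp φ a S Bs R) (hφ : BlockSetup φ a b t)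
    (hS : NoShortZeroSum (a * b) S) : card Bs ≤ t := by
  rw [← card_map sum]
  refine hφ.ker_card_le _ (fun g hg => ?_) (h.noShort hS)
  obtain ⟨T, hT, rfl⟩ := Multiset.mem_map.1 hg
  exact (h.block T hT).map_sum

theorem BlockSetup.exists_isBlock (hφ : BlockSetup φ a b t) (h : 3 * a - 3 < card R) :
    ∃ T ≤ R, IsBlock φ a T :=
  exists_isBlock_of_not_noShort fun h' => by
    have := hφ.card_le _ h'
    rw [card_map] at this
    omega

theorem BlockSetup.exists_blockDecomp (hφ : BlockSetup φ a b t) (k : ℕ)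
    (h : 3 * a - 3 + a * k ≤ card S) : ∃ Bs R, BlockDecomp φ a S Bs R ∧ card Bs = k := by
  induction k with
  | zero => exact ⟨0, S, ⟨by simp, by simp⟩, by simp⟩
  | succ k ih =>
    rw [mul_add] at h
    obtain ⟨Bs, R, hd, hk⟩ := ih (by omega)
    have hcard := congrArg card hd.eq
    have hle := hd.card_join_le
    have := hφ.two_le
    rw [card_add] at hcard
    rw [hk] at hle
    obtain ⟨T, hT, hTb⟩ := hφ.exists_isBlock (R := R) (by omega)
    obtain ⟨R, rfl⟩ := Multiset.le_iff_exists_add.1 hT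
    exact ⟨_, _, hd.extend hTb, by rw [card_cons, hk]⟩

theorem BlockDecomp.noShort_map (h : BlockDecomp φ a S Bs R) (hφ : BlockSetup φ a b t)
    (hS : NoShortZeroSum (a * b) S) (ht : card Bs = t) : NoShortZeroSum a (R.map φ) := by
  by_contra hR
  obtain ⟨T, hT, hTb⟩ := exists_isBlock_of_not_noShort hR
  obtain ⟨R, rfl⟩ := Multiset.le_iff_exists_add.1 hT
  have := (h.extend hTb).card_le hφ hS
  rw [card_cons] at this
  omega

theorem BlockSetup.card_le_of_noShort (hφ : BlockSetup φ a b t) (hS : NoShortZeroSum (a * b) S) :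
    card S ≤ 3 * a - 3 + a * t := by
  by_contra! hlt
  obtain ⟨Bs, R, hd, ht⟩ := hφ.exists_blockDecomp t hlt.le
  have hcard := congrArg card hd.eq
  have hle := hd.card_join_le
  have hR := hφ.card_le _ (hd.noShort_map hφ hS ht)
  rw [card_add] at hcard
  rw [ht] at hle
  rw [card_map] at hR
  omega

/-- A decomposition of an extremal sequence into the maximal number of blocks. -/
structure FullDecomp (φ : G →+ K) (a b t : ℕ) (S : Multiset G) (Bs : Multiset (Multiset G))
    (R : Multiset G) : Prop extends BlockDecomp φ a S Bs R where
  setup : BlockSetup φ a b t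
  noShortZeroSum : NoShortZeroSum (a * b) S
  card_eq : card S = 3 * a - 3 + a * t
  card_blocks : card Bs = t

namespace FullDecomp

variable {T : Multiset G}

theorem noShort_remainder (h : FullDecomp φ a b t S Bs R) : NoShortZeroSum a (R.map φ) :=
  h.toBlockDecomp.noShort_map h.setup h.noShortZeroSum h.card_blocks

theorem card_remainder (h : FullDecomp φ a b t S Bs R) : card R = 3 * a - 3 := by
  have hcard := congrArg card h.eq
  have hle := h.card_join_le
  have hR := h.setup.card_le _ h.noShort_remainder
  rw [card_add, h.card_eq] at hcard
  rw [h.card_blocks] at hle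
  rw [card_map] at hR
  omega

theorem card_block (h : FullDecomp φ a b t S (T ::ₘ Bs) R) : card T = a := by
  have hcard := congrArg card h.remove.eq
  have hle := h.remove.card_join_le
  have ht := h.card_blocks
  rw [card_cons] at ht
  rw [card_add, card_add, h.card_eq, h.card_remainder, ← ht, mul_add] at hcard
  have := (h.block T (by simp)).card_le
  omega

theorem count_remainder (h : FullDecomp φ a b t S Bs R) {r : G} (hr : r ∈ R) :
    (R.map φ).count (φ r) = a - 1 :=
  h.setup.count_eq _ (by rw [card_map, h.card_remainder]) h.noShort_remainder _
    (Multiset.mem_map_of_mem _ hr)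

theorem exchange {T' R' : Multiset G} (h : FullDecomp φ a b t S (T ::ₘ Bs) R)
    (hT' : IsBlock φ a T') (he : T + R = T' + R') : FullDecomp φ a b t S (T' ::ₘ Bs) R' where
  toBlockDecomp := (he ▸ h.remove).extend hT'
  setup := h.setup
  noShortZeroSum := h.noShortZeroSum
  card_eq := h.card_eq
  card_blocks := by simpa using h.card_blocks

end FullDecomp

end Blocks

section BlockShape

open Multiset

variable {G K : Type*} [AddCommGroup G] [AddCommGroup K] [DecidableEq K]
  {φ : G →+ K} {a b t : ℕ} {S R T : Multiset G} {Bs : Multiset (Multiset G)}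

omit [DecidableEq K] in
theorem map_eq_of_card_add_one (hK : ∀ k : K, a • k = 0) {x : G} {k : K}
    (hT : ∀ y ∈ T, φ y = k) (hc : card T + 1 = a) (hs : φ (x ::ₘ T).sum = 0) : φ x = k := by
  have : T.map φ = replicate (card T) k := Multiset.eq_replicate.2
    ⟨card_map _ _, fun y hy => by obtain ⟨z, hz, rfl⟩ := Multiset.mem_map.1 hy; exact hT z hz⟩
  rw [sum_cons, _root_.map_add, map_multiset_sum, this, sum_replicate] at hs
  have hk := hK k
  rw [← hc, add_nsmul, one_nsmul, ← hs, add_comm] at hk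
  exact (add_right_cancel hk).symm

namespace FullDecomp

theorem isBlock_class (h : FullDecomp φ a b t S Bs R) {r s : G} (hr : r ∈ R) (hs : φ s = φ r) :
    IsBlock φ a (s ::ₘ R.filter (φ · = φ r)) := by
  have h2 := h.setup.two_le
  have hcard : card (R.filter (φ · = φ r)) + 1 = a := by
    have := h.count_remainder hr
    rw [count_map] at this
    simp only [eq_comm (a := φ r)] at this
    omega
  have hmap : (R.filter (φ · = φ r)).map φ = replicate (card (R.filter (φ · = φ r))) (φ r) :=
    Multiset.eq_replicate.2 ⟨card_map _ _, fun y hy => by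
      obtain ⟨z, hz, rfl⟩ := Multiset.mem_map.1 hy; exact (Multiset.mem_filter.1 hz).2⟩
  refine ⟨by simp, by rw [card_cons, hcard], ?_⟩
  rw [sum_cons, _root_.map_add, map_multiset_sum, hmap, sum_replicate, hs, ← succ_nsmul', hcard,
    h.setup.nsmul_eq_zero]

theorem count_map_filter_ne {x y : G} (h : φ y ≠ φ x) :
    ((R.filter (¬φ · = φ x)).map φ).count (φ y) = (R.map φ).count (φ y) := by
  conv_rhs => rw [← Multiset.filter_add_not (φ · = φ x) R, Multiset.map_add, count_add]
  rw [Multiset.count_eq_zero_of_notMem (s := (R.filter (φ · = φ x)).map φ), zero_add]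
  intro hmem
  obtain ⟨z, hz, hzy⟩ := Multiset.mem_map.1 hmem
  exact h (hzy.symm.trans (Multiset.mem_filter.1 hz).2)

theorem exchange_class (h : FullDecomp φ a b t S (T ::ₘ Bs) R) {s r : G} {T₁ : Multiset G}
    (hT : T = s ::ₘ T₁) (hr : r ∈ R) (hs : φ s = φ r) :
    FullDecomp φ a b t S ((s ::ₘ R.filter (φ · = φ r)) ::ₘ Bs) (T₁ + R.filter (¬φ · = φ r)) := by
  refine h.exchange (h.isBlock_class hr hs) ?_
  conv_lhs => rw [← Multiset.filter_add_not (φ · = φ r) R]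
  rw [hT, ← singleton_add, ← singleton_add]
  abel

theorem exists_map_eq (h : FullDecomp φ a b t S (T ::ₘ Bs) R) {x : G} (hx : x ∈ T) :
    ∃ r ∈ R, φ r = φ x := by
  by_contra! hne
  have h2 := h.setup.two_le
  have hTc := h.card_block
  have hTs := (h.block T (by simp)).map_sum
  obtain ⟨T₁, rfl⟩ := Multiset.exists_cons_of_mem hx
  rw [card_cons] at hTc
  have hcount0 : ∀ {k : K} {U : Multiset G}, (∀ y ∈ U, φ y ≠ k) → (U.map φ).count k = 0 :=
    fun {k U} hU => Multiset.count_eq_zero_of_notMem fun hk => by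
      obtain ⟨z, hz, hzk⟩ := Multiset.mem_map.1 hk
      exact hU z hz hzk
  have hcountall : ∀ {k : K} {U : Multiset G}, (U.map φ).count k = card U → ∀ y ∈ U, φ y = k :=
    fun {k U} hU y hy => (Multiset.count_eq_card.1 (hU.trans (card_map φ U).symm) _
      (Multiset.mem_map_of_mem _ hy)).symm
  by_cases hs : ∃ s ∈ T₁, ∀ r ∈ R, φ r ≠ φ s
  · obtain ⟨s, hs, hsR⟩ := hs
    obtain ⟨T', hT', hTb⟩ := h.setup.exists_isBlock (R := x ::ₘ R)
      (by rw [card_cons, h.card_remainder]; omega)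
    have hxT : x ∈ T' := by
      by_contra hxT
      have := h.noShort_remainder (T'.map φ)
        (Multiset.map_le_map ((Multiset.le_cons_of_notMem hxT).1 hT'))
        (by simpa using hTb.ne_zero) (by rw [← map_multiset_sum, hTb.map_sum])
      rw [card_map] at this
      exact absurd hTb.card_le this.not_ge
    obtain ⟨U, rfl⟩ := Multiset.exists_cons_of_mem hxT
    rw [Multiset.cons_le_cons_iff] at hT'
    obtain ⟨R₂, rfl⟩ := Multiset.le_iff_exists_add.1 hT'
    have h' := h.exchange (R' := T₁ + R₂) hTb (by simp only [← singleton_add]; abel)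
    have hU := h'.card_block
    rw [card_cons] at hU
    have hTall : ∀ y ∈ T₁, φ y = φ s := by
      refine hcountall ?_
      have := h'.count_remainder (Multiset.mem_add.2 (Or.inl hs))
      rw [Multiset.map_add, count_add, hcount0 (U := R₂) fun y hy =>
        hsR y (Multiset.mem_add.2 (Or.inr hy))] at this
      omega
    have hxs : φ x = φ s := map_eq_of_card_add_one h.setup.nsmul_eq_zero hTall hTc hTs
    obtain ⟨r, hr⟩ : ∃ r, r ∈ U := card_pos_iff_exists_mem.1 (by omega)
    have hrR : r ∈ U + R₂ := Multiset.mem_add.2 (Or.inl hr)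
    have hcR := h.count_remainder hrR
    rw [Multiset.map_add, count_add] at hcR
    have hpos : 0 < (U.map φ).count (φ r) := Multiset.count_pos.2 (Multiset.mem_map_of_mem _ hr)
    have h0 : (R₂.map φ).count (φ r) = 0 := by
      refine hcount0 fun y hy hyr => ?_
      have := h'.count_remainder (Multiset.mem_add.2 (Or.inr hy))
      rw [Multiset.map_add, count_add, hyr, hcount0 (U := T₁) fun z hz => by
        rw [hTall z hz, ← hxs]; exact (hne r hrR).symm] at this
      omega
    refine hne r hrR (map_eq_of_card_add_one h.setup.nsmul_eq_zero (hcountall ?_) hU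
      hTb.map_sum).symm
    omega
  · push Not at hs
    obtain ⟨s, hsT⟩ : ∃ s, s ∈ T₁ := card_pos_iff_exists_mem.1 (by omega)
    obtain ⟨r, hr, hrs⟩ := hs s hsT
    obtain ⟨T₂, rfl⟩ := Multiset.exists_cons_of_mem hsT
    have h' := h.exchange_class (s := s) (T₁ := x ::ₘ T₂) (Multiset.cons_swap _ _ _) hr hrs.symm
    have hc := h'.count_remainder (r := x) (by simp)
    rw [Multiset.map_add, count_add, count_map_filter_ne (hne r hr).symm, map_cons, count_cons_self,
      hcount0 (U := R) hne, hcount0 (U := T₂) fun y hy => by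
        obtain ⟨r', hr', hy'⟩ := hs y (Multiset.mem_cons_of_mem hy)
        rw [← hy']; exact hne r' hr'] at hc
    rw [card_cons] at hTc
    have hT₂ : T₂ = 0 := card_eq_zero.1 (by omega)
    subst hT₂
    exact hne r hr (hrs.trans (map_eq_of_card_add_one h.setup.nsmul_eq_zero (by simp)
      (by simpa using hTc) hTs).symm)

theorem map_eq_map (h : FullDecomp φ a b t S (T ::ₘ Bs) R) {x y : G} (hx : x ∈ T) (hy : y ∈ T) :
    φ x = φ y := by
  by_contra hne
  obtain ⟨r, hr, hrx⟩ := h.exists_map_eq hx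
  obtain ⟨r', hr', hry⟩ := h.exists_map_eq hy
  obtain ⟨T₁, hT₁⟩ := Multiset.exists_cons_of_mem hx
  have hy₁ : y ∈ T₁ := (Multiset.mem_cons.1 (hT₁ ▸ hy)).resolve_left fun h => hne (h ▸ rfl)
  have hc := (h.exchange_class hT₁ hr hrx.symm).count_remainder (Multiset.mem_add.2 (Or.inl hy₁))
  rw [Multiset.map_add, count_add, count_map_filter_ne (by rw [hrx]; exact fun h => hne h.symm),
    ← hry, h.count_remainder hr', hry] at hc
  have : 0 < (T₁.map φ).count (φ y) := Multiset.count_pos.2 (Multiset.mem_map_of_mem _ hy₁)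
  omega

theorem eq_of_map_eq (h : FullDecomp φ a b t S (T ::ₘ Bs) R) {x r : G} (hx : x ∈ T) (hr : r ∈ R)
    (hxr : φ x = φ r) : x = r := by
  obtain ⟨T₁, rfl⟩ := Multiset.exists_cons_of_mem hx
  obtain ⟨R₁, rfl⟩ := Multiset.exists_cons_of_mem hr
  have hb := h.block _ (Multiset.mem_cons_self _ _)
  have hb' : IsBlock φ a (r ::ₘ T₁) :=
    ⟨by simp, by simpa using hb.card_le, by simpa [hxr] using hb.map_sum⟩
  have h' := h.exchange (R' := x ::ₘ R₁) hb' (by simp only [← singleton_add]; abel)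
  have := h.setup.ker_rigid (Bs.map sum) (x ::ₘ T₁).sum (r ::ₘ T₁).sum (fun g hg => by
      obtain ⟨U, hU, rfl⟩ := Multiset.mem_map.1 hg
      exact (h.block U (Multiset.mem_cons_of_mem hU)).map_sum) hb.map_sum hb'.map_sum
    (by rw [card_map, ← card_cons, h.card_blocks])
    (by simpa using h.noShort h.noShortZeroSum) (by simpa using h'.noShort h.noShortZeroSum)
  simpa using this

end FullDecomp

theorem join_map_replicate {α : Type*} (k : ℕ) (L : Multiset α) :
    (L.map (replicate k)).join = k • L := by
  classical
  induction L using Multiset.induction with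
  | empty => simp
  | cons g L ih =>
    rw [map_cons, join_cons, ih, ← singleton_add, nsmul_add, nsmul_singleton]

theorem exists_map_eq_of_forall {α β : Type*} {f : α → β} {p : α → Prop} (B : Multiset β)
    (h : ∀ y ∈ B, ∃ x, p x ∧ f x = y) : ∃ L : Multiset α, L.map f = B ∧ ∀ x ∈ L, p x := by
  induction B using Multiset.induction with
  | empty => exact ⟨0, by simp⟩
  | cons y B ih =>
    obtain ⟨L, rfl, hL⟩ := ih fun y hy => h y (Multiset.mem_cons_of_mem hy)
    obtain ⟨x, hx, rfl⟩ := h y (Multiset.mem_cons_self _ _)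
    exact ⟨x ::ₘ L, by simp, by simpa using ⟨hx, hL⟩⟩

/-- In an extremal sequence all blocks are constant. -/
theorem BlockSetup.exists_shape (hφ : BlockSetup φ a b t) (hS : NoShortZeroSum (a * b) S)
    (hc : card S = 3 * a - 3 + a * t) : ∃ L R : Multiset G,
      FullDecomp φ a b t S (L.map (replicate a)) R ∧
      ∀ g ∈ L, g ∈ R ∧ ∀ r ∈ R, φ r = φ g → r = g := by
  obtain ⟨Bs, R, hd, ht⟩ := hφ.exists_blockDecomp t hc.ge
  have h : FullDecomp φ a b t S Bs R := ⟨hd, hφ, hS, hc, ht⟩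
  obtain ⟨L, rfl, hL⟩ := exists_map_eq_of_forall (f := replicate a)
    (p := fun g => g ∈ R ∧ ∀ r ∈ R, φ r = φ g → r = g) Bs fun T hT => by
      obtain ⟨Bs', rfl⟩ := Multiset.exists_cons_of_mem hT
      have hTc := h.card_block
      obtain ⟨g, hg⟩ : ∃ g, g ∈ T := card_pos_iff_exists_mem.1 (by have := hφ.two_le; omega)
      obtain ⟨r, hr, hrg⟩ := h.exists_map_eq hg
      obtain rfl := h.eq_of_map_eq hg hr hrg.symm
      refine ⟨g, ⟨hr, fun r' hr' he => (h.eq_of_map_eq hg hr' he.symm).symm⟩, ?_⟩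
      exact (Multiset.eq_replicate.2
        ⟨hTc, fun y hy => h.eq_of_map_eq hy hr (h.map_eq_map hy hg)⟩).symm
  exact ⟨L, R, h, hL⟩

end BlockShape

section Multiplicativity

open Multiset

/-- Multiplication by `a` as an embedding of `ℤ/b` into `ℤ/ab`. -/
def ZMod.mulLeftHom (a b : ℕ) : ZMod b →+ ZMod (a * b) :=
  ZMod.lift b ⟨zmultiplesHom _ (a : ZMod (a * b)), by
    rw [zmultiplesHom_apply, natCast_zsmul, nsmul_eq_mul, mul_comm, ← Nat.cast_mul,
      ZMod.natCast_self]⟩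

theorem ZMod.mulLeftHom_intCast (a b : ℕ) (z : ℤ) :
    ZMod.mulLeftHom a b z = (a * z : ℤ) := by
  simp [ZMod.mulLeftHom, mul_comm]

theorem ZMod.mulLeftHom_natCast (a b k : ℕ) : ZMod.mulLeftHom a b k = (a * k : ℕ) := by
  simpa using ZMod.mulLeftHom_intCast a b k

theorem ZMod.mulLeftHom_injective {a : ℕ} (ha : 0 < a) (b : ℕ) :
    Function.Injective (ZMod.mulLeftHom a b) := by
  rw [injective_iff_map_eq_zero]
  intro x hx
  obtain ⟨z, rfl⟩ := ZMod.intCast_surjective x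
  rw [ZMod.mulLeftHom_intCast, ZMod.intCast_zmod_eq_zero_iff_dvd] at hx
  rw [ZMod.intCast_zmod_eq_zero_iff_dvd]
  push_cast at hx
  exact Int.dvd_of_mul_dvd_mul_left (by omega) hx

theorem ZMod.exists_mulLeftHom_eq {a b : ℕ} {x : ZMod (a * b)}
    (hx : ZMod.castHom (dvd_mul_right a b) (ZMod a) x = 0) : ∃ y, ZMod.mulLeftHom a b y = x := by
  obtain ⟨z, rfl⟩ := ZMod.intCast_surjective x
  rw [map_intCast, ZMod.intCast_zmod_eq_zero_iff_dvd] at hx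
  obtain ⟨w, rfl⟩ := hx
  exact ⟨w, ZMod.mulLeftHom_intCast a b w⟩

theorem NoShortZeroSum.of_map {G H : Type*} [AddCommGroup G] [AddCommGroup H] (ψ : H →+ G) {k : ℕ}
    {L : Multiset H} (h : NoShortZeroSum k (L.map ψ)) : NoShortZeroSum k L := fun T hT h0 hs => by
  have := h (T.map ψ) (Multiset.map_le_map hT) (by simpa using h0)
    (by rw [← map_multiset_sum, hs, _root_.map_zero])
  rwa [card_map] at this

theorem BlockSetup.of_kernel {G K H : Type*} [AddCommGroup G] [AddCommGroup K] [AddCommGroup H]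
    [DecidableEq K] {φ : G →+ K} {a b t : ℕ} (ψ : H →+ G) (hψ : ∀ g, φ g = 0 → ∃ h, ψ h = g)
    (two_le : 2 ≤ a) (nsmul_eq_zero : ∀ k : K, a • k = 0)
    (card_le : ∀ R : Multiset K, NoShortZeroSum a R → card R ≤ 3 * a - 3)
    (count_eq : ∀ R : Multiset K, card R = 3 * a - 3 → NoShortZeroSum a R →
      ∀ x ∈ R, R.count x = a - 1)
    (hcard : ∀ L : Multiset H, NoShortZeroSum b L → card L ≤ t)
    (hrigid : ∀ (W : Multiset H) (σ σ' : H), card W + 1 = t → NoShortZeroSum b (σ ::ₘ W) →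
      NoShortZeroSum b (σ' ::ₘ W) → σ = σ') : BlockSetup φ a b t where
  two_le := two_le
  nsmul_eq_zero := nsmul_eq_zero
  card_le := card_le
  count_eq := count_eq
  ker_card_le L hL h := by
    obtain ⟨L, rfl, -⟩ := exists_map_eq_of_forall (f := ψ) (p := fun _ => True) L
      fun g hg => by simpa using hψ g (hL g hg)
    rw [card_map]
    exact hcard L (h.of_map ψ)
  ker_rigid W σ σ' hW hσ hσ' hc h h' := by
    obtain ⟨W, rfl, -⟩ := exists_map_eq_of_forall (f := ψ) (p := fun _ => True) W
      fun g hg => by simpa using hψ g (hW g hg)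
    obtain ⟨s, rfl⟩ := hψ σ hσ
    obtain ⟨s', rfl⟩ := hψ σ' hσ'
    rw [card_map] at hc
    rw [← map_cons] at h h'
    rw [hrigid W s s' hc (h.of_map ψ) (h'.of_map ψ)]

/-- The upper bound `3 m - 2` for `η(C_m ⊕ C_m)`. -/
def EtaBound (m : ℕ) : Prop :=
  ∀ S : Multiset (ZMod m × ZMod m), NoShortZeroSum m S → card S ≤ 3 * m - 3

theorem etaBound_of_prime {p : ℕ} [Fact p.Prime] : EtaBound p := fun S hS => by
  have := hS.card_le_of_prime
  omega

theorem NoShortZeroSum.count_le {m : ℕ} (hm : 0 < m) {S : Multiset (ZMod m × ZMod m)}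
    (h : NoShortZeroSum m S) (g : ZMod m × ZMod m) : S.count g ≤ m - 1 := by
  have := h.count_lt hm (ZMod.prod_nsmul_self g)
  omega

theorem PropertyC.count_eq {m : ℕ} (hm : 0 < m) (hC : PropertyC m)
    {S : Multiset (ZMod m × ZMod m)} (hc : card S = 3 * m - 3) (h : NoShortZeroSum m S)
    {x : ZMod m × ZMod m} (hx : x ∈ S) : S.count x = m - 1 := by
  refine le_antisymm (h.count_le hm x) ?_
  obtain ⟨a, b, c, rfl⟩ := hC S hc h
  simp only [Multiset.mem_add, mem_replicate] at hx
  simp only [count_add, count_replicate]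
  rcases hx with hx | hx | hx <;> simp [hx.2] <;> omega

theorem noShortZeroSum_two_rigid : ∀ x y σ σ' : ZMod 2 × ZMod 2,
    (σ ≠ 0 ∧ σ ≠ x ∧ σ ≠ y ∧ x ≠ 0 ∧ y ≠ 0 ∧ x ≠ y) ∧ (σ' ≠ 0 ∧ σ' ≠ x ∧ σ' ≠ y) →
      σ = σ' := by
  set_option synthInstance.maxHeartbeats 400000 in
  set_option synthInstance.maxSize 1000 in
  decide

theorem PropertyC.rigid {m : ℕ} (hm : 2 ≤ m) (hC : PropertyC m) {W : Multiset (ZMod m × ZMod m)}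
    {σ σ' : ZMod m × ZMod m} (hc : card W + 1 = 3 * m - 3) (h : NoShortZeroSum m (σ ::ₘ W))
    (h' : NoShortZeroSum m (σ' ::ₘ W)) : σ = σ' := by
  rcases hm.eq_or_lt with rfl | hm3
  · obtain ⟨x, y, rfl⟩ := card_eq_two.1 (by omega : card W = 2)
    have key : ∀ {s : ZMod 2 × ZMod 2}, NoShortZeroSum 2 (s ::ₘ {x, y}) →
        s ≠ 0 ∧ s ≠ x ∧ s ≠ y ∧ x ≠ 0 ∧ y ≠ 0 ∧ x ≠ y := by
      intro s hs
      have hn := fun g hg => hs.ne_zero two_pos (g := g) hg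
      have hcnt := hs.count_le two_pos
      refine ⟨hn s (by simp), ?_, ?_, hn x (by simp), hn y (by simp), ?_⟩
      · rintro rfl; have := hcnt s; simp at this
      · rintro rfl; have := hcnt s; simp [count_cons] at this
      · rintro rfl; have := hcnt x; simp [count_cons] at this; omega
    obtain ⟨h1, h2, h3, -⟩ := key h'
    exact noShortZeroSum_two_rigid x y σ σ' ⟨key h, h1, h2, h3⟩
  · by_contra hne
    have h1 := hC.count_eq (by omega) (by simpa using hc) h (mem_cons_self σ W)
    rw [count_cons_self] at h1
    have hσ : σ ∈ W := count_pos.1 (by omega)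
    have h2 := hC.count_eq (by omega) (by simpa using hc) h' (mem_cons_of_mem hσ)
    rw [count_cons_of_ne hne] at h2
    omega

/-- Reduction modulo `a` from `C_{ab} ⊕ C_{ab}` to `C_a ⊕ C_a`. -/
def reduceHom (a b : ℕ) : ZMod (a * b) × ZMod (a * b) →+ ZMod a × ZMod a :=
  AddMonoidHom.prodMap (ZMod.castHom (dvd_mul_right a b) (ZMod a)).toAddMonoidHom
    (ZMod.castHom (dvd_mul_right a b) (ZMod a)).toAddMonoidHom

theorem blockSetup_reduceHom {a b : ℕ} (ha : 2 ≤ a) (hb : 2 ≤ b) (hEa : EtaBound a)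
    (hCa : PropertyC a) (hEb : EtaBound b) (hCb : PropertyC b) :
    BlockSetup (reduceHom a b) a b (3 * b - 3) :=
  BlockSetup.of_kernel (AddMonoidHom.prodMap (ZMod.mulLeftHom a b) (ZMod.mulLeftHom a b))
    (fun g hg => by
      obtain ⟨y, hy⟩ := ZMod.exists_mulLeftHom_eq (congrArg Prod.fst hg)
      obtain ⟨z, hz⟩ := ZMod.exists_mulLeftHom_eq (congrArg Prod.snd hg)
      exact ⟨(y, z), Prod.ext hy hz⟩)
    ha ZMod.prod_nsmul_self hEa (fun R hc h x hx => hCa.count_eq (by omega) hc h hx) hEb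
    (fun W σ σ' hc h h' => hCb.rigid hb hc h h')

theorem EtaBound.mul {a b : ℕ} (ha : 2 ≤ a) (hb : 2 ≤ b) (hEa : EtaBound a)
    (hCa : PropertyC a) (hEb : EtaBound b) (hCb : PropertyC b) : EtaBound (a * b) := fun S hS => by
  have := (blockSetup_reduceHom ha hb hEa hCa hEb hCb).card_le_of_noShort hS
  rw [Nat.mul_sub, mul_left_comm a 3 b] at this
  have h1 : a * 1 ≤ a * b := Nat.mul_le_mul_left a (by omega)
  omega

theorem eq_replicate_of_count {α : Type*} [DecidableEq α] {S : Multiset α} {k : ℕ} {D : Finset α}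
    (hD : D.card = 3) (hk : ∀ g ∈ D, k ≤ S.count g) (hS : card S = 3 * k) :
    ∃ a b c, S = replicate k a + (replicate k b + replicate k c) := by
  obtain ⟨a, b, c, hab, hac, hbc, rfl⟩ := Finset.card_eq_three.1 hD
  refine ⟨a, b, c, (Multiset.eq_of_le_of_card_le ?_ (by simp [hS]; omega)).symm⟩
  have h1 := hk a (by simp)
  have h2 := hk b (by simp)
  have h3 := hk c (by simp)
  rw [Multiset.le_iff_count]
  intro x
  simp only [count_add, count_replicate]
  split_ifs with ha hb hc hc hb hc hc <;> subst_vars <;> first | omega | simp_all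

theorem PropertyC.mul {a b : ℕ} (ha : 2 ≤ a) (hb : 2 ≤ b) (hEa : EtaBound a)
    (hCa : PropertyC a) (hEb : EtaBound b) (hCb : PropertyC b) : PropertyC (a * b) := by
  intro S hc hS
  have hab : a * 1 ≤ a * b := Nat.mul_le_mul_left a (by omega)
  obtain ⟨L, R, h, hL⟩ := (blockSetup_reduceHom ha hb hEa hCa hEb hCb).exists_shape hS
    (by rw [hc, Nat.mul_sub, mul_left_comm a 3 b]; omega)
  have hLc : card L = 3 * b - 3 := by simpa using h.card_blocks
  have hSL : S = a • L + R := by rw [h.eq, join_map_replicate]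
  have hRc : ∀ g ∈ L, R.count g = a - 1 := fun g hg => by
    rw [← h.count_remainder (hL g hg).1, count_map, count_eq_card_filter_eq]
    congr 1
    exact Multiset.filter_congr fun r hr =>
      ⟨fun h => h ▸ rfl, fun h => ((hL g hg).2 r hr h.symm).symm⟩
  have hcount : ∀ g ∈ L, L.count g ≤ b - 1 := fun g hg => by
    have h1 := hS.count_le (by omega) g
    rw [hSL, count_add, count_nsmul, hRc g hg] at h1
    refine Nat.le_of_lt_succ (Nat.lt_of_mul_lt_mul_left (a := a) ?_)
    rw [Nat.succ_eq_add_one, Nat.sub_add_cancel (by omega)]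
    omega
  have hD3 : L.toFinset.card ≤ 3 := by
    have h1 : ∑ g ∈ L.toFinset, R.count g ≤ card R := by
      rw [← Multiset.toFinset_sum_count_eq]
      exact Finset.sum_le_sum_of_subset fun g hg => by
        rw [mem_toFinset] at hg ⊢; exact (hL g hg).1
    rw [Finset.sum_congr rfl fun g hg => hRc g (mem_toFinset.1 hg), Finset.sum_const,
      smul_eq_mul, h.card_remainder, show 3 * a - 3 = 3 * (a - 1) by omega] at h1
    exact Nat.le_of_mul_le_mul_right h1 (by omega)
  have hsum := Multiset.toFinset_sum_count_eq L
  have hle : ∑ g ∈ L.toFinset, L.count g ≤ ∑ g ∈ L.toFinset, (b - 1) :=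
    Finset.sum_le_sum fun g hg => hcount g (mem_toFinset.1 hg)
  have hD : L.toFinset.card = 3 := by
    rw [hsum, hLc, Finset.sum_const, smul_eq_mul, show 3 * b - 3 = 3 * (b - 1) by omega] at hle
    exact le_antisymm hD3 (Nat.le_of_mul_le_mul_right hle (by omega))
  have heq := (Finset.sum_eq_sum_iff_of_le fun g hg => hcount g (mem_toFinset.1 hg)).1
    (by rw [hsum, hLc, Finset.sum_const, hD, smul_eq_mul]; omega)
  refine eq_replicate_of_count hD (fun g hg => ?_) (by rw [hc]; omega)
  rw [hSL, count_add, count_nsmul, heq g hg, hRc g (mem_toFinset.1 hg), Nat.mul_sub]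
  omega

theorem etaBound_and_propertyC {m : ℕ} (hm : 0 < m) : EtaBound m ∧ PropertyC m := by
  induction m using induction_on_primes with
  | zero => omega
  | one =>
    refine ⟨fun S hS => ?_, fun S hc _ => ⟨0, 0, 0, by simpa using hc⟩⟩
    by_contra! hlt
    obtain ⟨g, hg⟩ := card_pos_iff_exists_mem.1 (by omega : 0 < card S)
    exact hS.ne_zero one_pos hg (Subsingleton.elim _ _)
  | prime_mul p b hp ih =>
    have := Fact.mk hp
    obtain ⟨hE, hC⟩ := ih (Nat.pos_of_mul_pos_left hm)
    rcases Nat.eq_or_lt_of_le (Nat.pos_of_mul_pos_left hm : 1 ≤ b) with rfl | hb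
    · rw [Nat.succ_eq_add_one, zero_add, mul_one]; exact ⟨etaBound_of_prime, propertyC_of_prime⟩
    · exact ⟨etaBound_of_prime.mul hp.two_le hb propertyC_of_prime hE hC,
        propertyC_of_prime.mul hp.two_le hb etaBound_of_prime hE hC⟩

end Multiplicativity

section Interval

variable {d : ℕ} [NeZero d]

theorem ZMod.card_filter_val_lt {L : ℕ} (hL : L ≤ d) :
    (Finset.univ.filter fun i : ZMod d => i.val < L).card = L := by
  rw [← Finset.card_range L]
  refine Finset.card_bij (fun i _ => i.val) (by simp) (fun _ _ _ _ h => ZMod.val_injective d h) ?_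
  intro x hx
  have hx' := Finset.mem_range.1 hx
  exact ⟨(x : ZMod d), by simpa [ZMod.val_cast_of_lt (hx'.trans_le hL)] using hx',
    ZMod.val_cast_of_lt (hx'.trans_le hL)⟩

theorem ZMod.eq_of_val_lt_iff {f : ZMod d → ZMod d} (hf : Function.Injective f) {L L' : ℕ}
    (hL : L ≤ d) (hL' : L' ≤ d) (h : ∀ i, i.val < L ↔ (f i).val < L') : L = L' := by
  rw [← ZMod.card_filter_val_lt hL, ← ZMod.card_filter_val_lt hL']
  refine Finset.card_bij (fun i _ => f i) (by simpa using fun i => (h i).1)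
    (fun _ _ _ _ e => hf e) fun y hy => ?_
  obtain ⟨i, rfl⟩ := (Finite.injective_iff_surjective.1 hf) y
  exact ⟨i, by simpa [h] using hy, rfl⟩

theorem ZMod.eq_zero_of_val_lt_iff {c : ZMod d} {L : ℕ} (hL : 0 < L) (hLd : L < d)
    (h : ∀ i, i.val < L ↔ (i + c).val < L) : c = 0 := by
  by_contra hc
  have h0 : c.val < L := by simpa [hL] using h 0
  have hpos : 0 < c.val := Nat.pos_of_ne_zero fun h => hc ((ZMod.val_eq_zero c).1 h)
  have h1 : ((L - c.val : ℕ) : ZMod d) + c = L := by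
    rw [Nat.cast_sub h0.le, ZMod.natCast_val, ZMod.cast_id', id]; ring
  have h2 := h (L - c.val : ℕ)
  rw [h1, ZMod.val_cast_of_lt hLd, ZMod.val_cast_of_lt (by omega)] at h2
  omega

theorem ZMod.eq_one_of_val_lt_iff {ε c : ZMod d} {L : ℕ} (hL : 2 ≤ L) (hLd : L + 2 ≤ d)
    (h : ∀ i, i.val < L ↔ (ε * i + c).val < L) (he : 2 * ε.val ≤ d) : ε = 1 := by
  have hstep : ∀ i : ℕ, ε * (i + 1 : ℕ) + c = ε * i + c + ε := fun i => by push_cast; ring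
  have hlt : ∀ i : ℕ, i < d → (i < L ↔ (ε * i + c).val < L) := fun i hi => by
    rw [← h, ZMod.val_cast_of_lt hi]
  have hε : ε ≠ 0 := by
    rintro rfl
    have h1 := hlt 0 (by omega)
    have h2 := hlt L (by omega)
    simp only [zero_mul] at h1 h2
    omega
  have hpos : 0 < ε.val := Nat.pos_of_ne_zero fun h => hε ((ZMod.val_eq_zero ε).1 h)
  suffices ε.val ≤ 1 by
    have h1 : ε.val = 1 := by omega
    rw [← ZMod.natCast_zmod_val ε, h1, Nat.cast_one]
  rcases le_or_gt (ε.val + L) d with hle | hgt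
  · have key : ∀ i : ℕ, i < L → (ε * i + c).val = c.val + i * ε.val := by
      intro i
      induction i with
      | zero => simp
      | succ i ih =>
        intro hi
        have h1 := (hlt i (by omega)).1 (by omega)
        rw [hstep, ZMod.val_add_of_lt (by omega), ih (by omega), Nat.succ_mul, add_assoc]
    have h1 := key (L - 1) (by omega)
    have h2 := (hlt (L - 1) (by omega)).1 (by omega)
    by_contra! hcon
    have : (L - 1) * 2 ≤ (L - 1) * ε.val := Nat.mul_le_mul_left _ hcon
    omega
  · have key : ∀ i : ℕ, L + i < d →
        (ε * ((L + i : ℕ) : ZMod d) + c).val = (ε * L + c).val + i * ε.val := by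
      intro i
      induction i with
      | zero => simp
      | succ i ih =>
        intro hi
        have h1 := (hlt (L + (i + 1)) (by omega)).not.1 (by omega)
        have h3 := ZMod.val_lt (ε * ((L + i : ℕ) : ZMod d) + c)
        rw [← add_assoc, hstep] at h1 ⊢
        have h2 : (ε * ((L + i : ℕ) : ZMod d) + c).val + ε.val < d := by
          by_contra! hcon
          rw [ZMod.val_add, Nat.mod_eq_sub_mod hcon, Nat.mod_eq_of_lt (by omega)] at h1
          omega
        rw [ZMod.val_add_of_lt h2, ih (by omega), Nat.succ_mul, add_assoc]
    have h1 := key (d - 1 - L) (by omega)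
    have h2 := (hlt L (by omega)).not.1 (by omega)
    have h3 := ZMod.val_lt (ε * ((L + (d - 1 - L) : ℕ) : ZMod d) + c)
    by_contra! hcon
    have : (d - 1 - L) * 2 ≤ (d - 1 - L) * ε.val := Nat.mul_le_mul_left _ hcon
    omega

theorem ZMod.val_sub_lt_iff {L : ℕ} (hL : 0 < L) (hLd : L ≤ d) (x : ZMod d) :
    ((L - 1 : ℕ) - x : ZMod d).val < L ↔ x.val < L := by
  have key : ∀ x : ZMod d, x.val < L → ((L - 1 : ℕ) - x : ZMod d).val < L := fun x hx => by
    have h1 : ((L - 1 : ℕ) : ZMod d).val = L - 1 := ZMod.val_cast_of_lt (by omega)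
    rw [ZMod.val_sub (by omega), h1]
    omega
  exact ⟨fun h => by simpa using key _ h, key x⟩

/-- An affine map of `ℤ/d` preserving an interval of length between `2` and `d - 2` has
slope `±1`. -/
theorem ZMod.eq_one_or_neg_one_of_val_lt_iff {ε c : ZMod d} {L : ℕ} (hL : 2 ≤ L)
    (hLd : L + 2 ≤ d) (h : ∀ i, i.val < L ↔ (ε * i + c).val < L) : ε = 1 ∨ ε = -1 := by
  rcases le_or_gt (2 * ε.val) d with he | he
  · exact .inl (ZMod.eq_one_of_val_lt_iff hL hLd h he)
  · right
    rw [← neg_eq_iff_eq_neg]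
    refine ZMod.eq_one_of_val_lt_iff (c := (L - 1 : ℕ) - c) hL hLd (fun i => ?_) ?_
    · rw [h, ← ZMod.val_sub_lt_iff (by omega) (by omega)]
      ring_nf
    · have := ZMod.val_lt ε
      rw [ZMod.neg_val]
      split_ifs <;> omega

end Interval

section Balanced

/-- Four residues with sum zero such that the least nonnegative representatives of all their
nonzero multiples add up to twice the modulus. -/
structure IsBalanced (m : ℕ) (α β γ δ : ZMod m) : Prop where
  sum_eq : α + β + γ + δ = 0
  val_add : ∀ k, k ≠ 0 → (k * α).val + (k * β).val + (k * γ).val + (k * δ).val = 2 * m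

theorem ZMod.val_add_val_neg_le {m : ℕ} [NeZero m] (x : ZMod m) : x.val + (-x).val ≤ m := by
  have := x.val_lt
  rw [ZMod.neg_val]
  split_ifs with h
  · simp [h]
  · omega

namespace IsBalanced

variable {m : ℕ} {α β γ δ : ZMod m}

theorem swap₁₂ (h : IsBalanced m α β γ δ) : IsBalanced m β α γ δ :=
  ⟨by rw [← h.sum_eq]; ring, fun k hk => by rw [← h.val_add k hk]; ring⟩

theorem swap₂₃ (h : IsBalanced m α β γ δ) : IsBalanced m α γ β δ :=
  ⟨by rw [← h.sum_eq]; ring, fun k hk => by rw [← h.val_add k hk]; ring⟩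

theorem swap₃₄ (h : IsBalanced m α β γ δ) : IsBalanced m α β δ γ :=
  ⟨by rw [← h.sum_eq]; ring, fun k hk => by rw [← h.val_add k hk]; ring⟩

theorem mul_ne_zero [NeZero m] (h : IsBalanced m α β γ δ) {k : ZMod m} (hk : k ≠ 0) :
    k * α ≠ 0 := by
  intro h0
  have h1 := h.val_add k hk
  have h2 := h.val_add (-k) (neg_ne_zero.2 hk)
  simp only [neg_mul, h0, neg_zero, ZMod.val_zero] at h1 h2
  have h3 := ZMod.val_add_val_neg_le (k * β)
  have h4 := ZMod.val_add_val_neg_le (k * γ)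
  have h5 := ZMod.val_add_val_neg_le (k * δ)
  have := NeZero.pos m
  omega

theorem isUnit [NeZero m] (h : IsBalanced m α β γ δ) : IsUnit α := by
  have hα : α ∈ nonZeroDivisors (ZMod m) := by
    refine mem_nonZeroDivisors_iff_right.2 fun k hk => ?_
    by_contra h0
    exact h.mul_ne_zero h0 hk
  exact isUnit_iff_mem_nonZeroDivisors_of_finite.2 hα

theorem mul_left (h : IsBalanced m α β γ δ) {u : ZMod m} (hu : IsUnit u) :
    IsBalanced m (u * α) (u * β) (u * γ) (u * δ) :=
  ⟨by rw [← mul_add, ← mul_add, ← mul_add, h.sum_eq, mul_zero], fun k hk => by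
    simpa only [mul_assoc] using h.val_add (k * u) (by simpa [hu.mul_left_eq_zero] using hk)⟩

theorem val_add_neg [NeZero m] (h : IsBalanced m α β γ δ) (k : ZMod m) :
    (k * α).val + (k * β).val = (k * -γ).val + (k * -δ).val := by
  rcases eq_or_ne k 0 with rfl | hk
  · simp
  have h1 := h.val_add k hk
  have h2 := h.swap₂₃.swap₁₂.mul_ne_zero hk
  have h3 := h.swap₃₄.swap₂₃.swap₁₂.mul_ne_zero hk
  have := (k * γ).val_lt
  have := (k * δ).val_lt
  rw [mul_neg, mul_neg, ZMod.neg_val, ZMod.neg_val, if_neg h2, if_neg h3]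
  omega

theorem val_le_iff [NeZero m] (h : IsBalanced m α β γ δ) (k : ZMod m) :
    (k * α).val ≤ (k * (α + β)).val ↔ (k * -γ).val ≤ (k * (α + β)).val := by
  have h1 := h.val_add_neg k
  have h2 : k * (α + β) = k * -γ + k * -δ := by linear_combination k * h.sum_eq
  have h3 := ZMod.val_add (k * α) (k * β)
  rw [← mul_add] at h3
  have := (k * α).val_lt
  have := (k * β).val_lt
  have := (k * -γ).val_lt
  have := (k * -δ).val_lt
  rcases lt_or_ge ((k * α).val + (k * β).val) m with hlt | hge
  · rw [Nat.mod_eq_of_lt hlt] at h3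
    omega
  · rw [Nat.mod_eq_sub_mod hge, Nat.mod_eq_of_lt (by omega)] at h3
    omega

theorem castHom {p d : ℕ} [NeZero p] [NeZero d] {α β γ δ : ZMod (p * d)}
    (h : IsBalanced (p * d) α β γ δ) :
    IsBalanced d (ZMod.castHom (dvd_mul_left d p) (ZMod d) α)
      (ZMod.castHom (dvd_mul_left d p) (ZMod d) β) (ZMod.castHom (dvd_mul_left d p) (ZMod d) γ)
      (ZMod.castHom (dvd_mul_left d p) (ZMod d) δ) := by
  refine ⟨by rw [← _root_.map_add, ← _root_.map_add, ← _root_.map_add, h.sum_eq, _root_.map_zero],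
    fun k hk => ?_⟩
  have hk' : ZMod.mulLeftHom p d k ≠ 0 := fun h0 =>
    hk (ZMod.mulLeftHom_injective (NeZero.pos p) d (by rw [h0, _root_.map_zero]))
  have key : ∀ x : ZMod (p * d), (ZMod.mulLeftHom p d k * x).val =
      p * (k * ZMod.castHom (dvd_mul_left d p) (ZMod d) x).val := fun x => by
    obtain ⟨n, rfl⟩ := ZMod.natCast_zmod_surjective k
    obtain ⟨z, rfl⟩ := ZMod.natCast_zmod_surjective x
    rw [ZMod.mulLeftHom_natCast, map_natCast, ← Nat.cast_mul, ← Nat.cast_mul, ZMod.val_natCast,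
      ZMod.val_natCast, ← Nat.mul_mod_mul_left, mul_assoc]
  have := h.val_add _ hk'
  rw [key, key, key, key] at this
  exact Nat.eq_of_mul_eq_mul_left (NeZero.pos p) (by linarith)

end IsBalanced

end Balanced

section Pairing

open Multiset

section Progression

variable {p d : ℕ} [NeZero p] [NeZero d]

theorem ZMod.val_progression (x : ZMod (p * d)) (κ j : ℕ) :
    (((κ + p * j : ℕ) : ZMod (p * d)) * x).val = κ * x.val % p +
      p * ((κ * x.val / p : ℕ) + (j : ZMod d) *
        ZMod.castHom (dvd_mul_left d p) (ZMod d) x).val := by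
  obtain ⟨z, hz⟩ : ∃ z, z = x.val := ⟨_, rfl⟩
  have hx : x = (z : ZMod (p * d)) := by rw [hz, ZMod.natCast_zmod_val]
  have h1 : (κ + p * j) * z = κ * z + p * (j * z) := by ring
  rw [← hz, hx, map_natCast, ← Nat.cast_mul, ← Nat.cast_mul, ← Nat.cast_add, ZMod.val_natCast,
    ZMod.val_natCast, Nat.mod_mul, h1, Nat.add_mul_mod_self_left,
    Nat.add_mul_div_left _ _ (NeZero.pos p)]

theorem ZMod.val_progression_le_iff (x : ZMod (p * d)) {κ : ℕ} (hκ : 0 < κ) (hκp : κ < p)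
    (hpd : p ≤ d) (j : ℕ) :
    (((κ + p * j : ℕ) : ZMod (p * d)) * x).val ≤ (((κ + p * j : ℕ) : ZMod (p * d)) * d).val ↔
      ((κ * x.val / p : ℕ) + (j : ZMod d) * ZMod.castHom (dvd_mul_left d p) (ZMod d) x).val <
        (κ * d - κ * x.val % p) / p + 1 := by
  have h1 : (((κ + p * j : ℕ) : ZMod (p * d)) * d).val = κ * d := by
    have h1 : (κ + p * j) * d = κ * d + p * d * j := by ring
    rw [← Nat.cast_mul, ZMod.val_natCast, h1, Nat.add_mul_mod_self_left,
      Nat.mod_eq_of_lt (Nat.mul_lt_mul_of_pos_right hκp (NeZero.pos d))]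
  have h2 : κ * x.val % p ≤ κ * d :=
    (Nat.mod_lt _ (NeZero.pos p)).le.trans (hpd.trans (Nat.le_mul_of_pos_left d hκ))
  rw [h1, ZMod.val_progression, Nat.lt_succ_iff, Nat.le_div_iff_mul_le (NeZero.pos p), mul_comm _ p]
  omega

variable {x y : ZMod (p * d)}

theorem ZMod.interval_iff (hx : IsUnit x) (hy : IsUnit y) (hpd : p ≤ d)
    (H : ∀ k, (k * x).val ≤ (k * d).val ↔ (k * y).val ≤ (k * d).val)
    {κ : ℕ} (hκ : 0 < κ) (hκp : κ < p) {ε : ZMod d}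
    (hε : ZMod.castHom (dvd_mul_left d p) (ZMod d) y =
      ε * ZMod.castHom (dvd_mul_left d p) (ZMod d) x)
    (hL : (κ * d - κ * x.val % p) / p < d) (hL' : (κ * d - κ * y.val % p) / p < d) (i : ZMod d) :
    i.val < (κ * d - κ * x.val % p) / p + 1 ↔
      (ε * i + ((κ * y.val / p : ℕ) - ε * (κ * x.val / p : ℕ))).val <
        (κ * d - κ * x.val % p) / p + 1 := by
  obtain ⟨u, hu⟩ := (hx.map (ZMod.castHom (dvd_mul_left d p) (ZMod d))).exists_left_inv
  have hεu : IsUnit ε := by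
    have := hy.map (ZMod.castHom (dvd_mul_left d p) (ZMod d))
    rw [hε] at this
    exact isUnit_of_mul_isUnit_left this
  have key : ∀ i : ZMod d, i.val < (κ * d - κ * x.val % p) / p + 1 ↔
      (ε * i + ((κ * y.val / p : ℕ) - ε * (κ * x.val / p : ℕ))).val <
        (κ * d - κ * y.val % p) / p + 1 := by
    intro i
    obtain ⟨j, hj⟩ := ZMod.natCast_zmod_surjective
      ((i - ((κ * x.val / p : ℕ) : ZMod d)) * u)
    have h1 := H (κ + p * j : ℕ)
    rw [ZMod.val_progression_le_iff x hκ hκp hpd, ZMod.val_progression_le_iff y hκ hκp hpd, hj,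
      hε] at h1
    convert h1 using 3
    · linear_combination (((κ * x.val / p : ℕ) : ZMod d) - i) * hu
    · linear_combination ε * (((κ * x.val / p : ℕ) : ZMod d) - i) * hu
  have hLL := ZMod.eq_of_val_lt_iff (fun i i' h => hεu.mul_left_cancel (add_right_cancel h))
    hL hL' key
  rw [key, Nat.succ.inj hLL]

theorem ZMod.mod_pos_of_isUnit (hp : p.Prime) (hx : IsUnit x) {κ : ℕ} (hκ : 0 < κ) (hκp : κ < p) :
    0 < κ * x.val % p := by
  have := Fact.mk hp
  refine Nat.pos_of_ne_zero fun h => ?_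
  rcases (hp.dvd_mul.1 (Nat.dvd_of_mod_eq_zero h)) with h | h
  · exact absurd (Nat.le_of_dvd hκ h) (by omega)
  · have h1 := hx.map (ZMod.castHom (dvd_mul_right p d) (ZMod p))
    rw [← ZMod.natCast_zmod_val x, map_natCast, (ZMod.natCast_eq_zero_iff _ _).2 h] at h1
    exact not_isUnit_zero h1

theorem ZMod.eq_of_interval_iff (hp : p.Prime) (hx : IsUnit x) (hy : IsUnit y) (hpd : p ≤ d)
    (H : ∀ k, (k * x).val ≤ (k * d).val ↔ (k * y).val ≤ (k * d).val)
    (h : ZMod.castHom (dvd_mul_left d p) (ZMod d) y =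
      ZMod.castHom (dvd_mul_left d p) (ZMod d) x) : y = x := by
  have h2 := hp.two_le
  have hb : ∀ z : ZMod (p * d), IsUnit z → (1 * d - 1 * z.val % p) / p + 1 < d := fun z hz => by
    have h1 := ZMod.mod_pos_of_isUnit hp hz one_pos hp.one_lt
    have := Nat.div_le_div_left (a := 1 * d - 1 * z.val % p) h2 two_pos
    omega
  have hxb := hb x hx
  have hyb := hb y hy
  have h1 := ZMod.eq_zero_of_val_lt_iff (Nat.succ_pos _) hxb fun i => by
    simpa only [one_mul] using ZMod.interval_iff hx hy hpd H one_pos hp.one_lt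
      (ε := 1) (by rw [one_mul, h]) (by omega) (by omega) i
  have hdiv : ∀ z : ZMod (p * d), z.val / p < d := fun z =>
    Nat.div_lt_of_lt_mul z.val_lt
  rw [sub_eq_zero, ZMod.natCast_eq_natCast_iff', Nat.mod_eq_of_lt (hdiv x),
    Nat.mod_eq_of_lt (hdiv y)] at h1
  have h3 : y.val ≡ x.val [MOD d] := by
    rw [← ZMod.natCast_eq_natCast_iff]
    simpa only [← map_natCast (ZMod.castHom (dvd_mul_left d p) (ZMod d)), ZMod.natCast_zmod_val]
  rw [← Nat.div_add_mod y.val p, ← Nat.div_add_mod x.val p, h1] at h3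
  have h4 := Nat.ModEq.add_left_cancel' _ h3
  have hmod : ∀ z : ℕ, z % p < d := fun z => (Nat.mod_lt _ hp.pos).trans_le hpd
  rw [Nat.ModEq, Nat.mod_eq_of_lt (hmod _), Nat.mod_eq_of_lt (hmod _)] at h4
  apply ZMod.val_injective
  rw [← Nat.div_add_mod y.val p, ← Nat.div_add_mod x.val p, h1, h4]

theorem ZMod.castHom_eq_or_neg_of_interval_iff (hp : p.Prime) (hx : IsUnit x) (hy : IsUnit y)
    (hpd : p ≤ d) (H : ∀ k, (k * x).val ≤ (k * d).val ↔ (k * y).val ≤ (k * d).val) :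
    ZMod.castHom (dvd_mul_left d p) (ZMod d) y = ZMod.castHom (dvd_mul_left d p) (ZMod d) x ∨
      ZMod.castHom (dvd_mul_left d p) (ZMod d) y =
        -ZMod.castHom (dvd_mul_left d p) (ZMod d) x := by
  have h2 := hp.two_le
  obtain ⟨u, hu⟩ := (hx.map (ZMod.castHom (dvd_mul_left d p) (ZMod d))).exists_left_inv
  obtain ⟨v, hv⟩ := (hy.map (ZMod.castHom (dvd_mul_left d p) (ZMod d))).exists_left_inv
  rcases le_or_gt d 4 with hd | hd
  · generalize ZMod.castHom (dvd_mul_left d p) (ZMod d) x = x' at *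
    generalize ZMod.castHom (dvd_mul_left d p) (ZMod d) y = y' at *
    have h2d := h2.trans hpd
    clear H hx hy hpd h2
    interval_cases d <;> revert x' y' u v <;> decide
  have hε : ZMod.castHom (dvd_mul_left d p) (ZMod d) y =
      (ZMod.castHom (dvd_mul_left d p) (ZMod d) y * u) *
        ZMod.castHom (dvd_mul_left d p) (ZMod d) x := by rw [mul_assoc, hu, mul_one]
  obtain ⟨κ, hκ, hκp, hb⟩ : ∃ κ : ℕ, 0 < κ ∧ κ < p ∧ ∀ z : ZMod (p * d), IsUnit z →
      1 ≤ (κ * d - κ * z.val % p) / p ∧ (κ * d - κ * z.val % p) / p + 3 ≤ d := by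
    rcases Nat.lt_or_ge p 4 with hp4 | hp4
    · refine ⟨1, one_pos, hp.one_lt, fun z hz => ?_⟩
      have h1 := ZMod.mod_pos_of_isUnit hp hz one_pos hp.one_lt
      have h3 := Nat.mod_lt (1 * z.val) hp.pos
      generalize 1 * z.val % p = r at *
      interval_cases p <;> omega
    · refine ⟨2, two_pos, by omega, fun z hz => ?_⟩
      have h1 := ZMod.mod_pos_of_isUnit hp hz two_pos (by omega)
      have h3 := Nat.mod_lt (2 * z.val) hp.pos
      have h4 := Nat.div_le_div_left (a := 2 * d - 2 * z.val % p) hp4 (by omega)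
      exact ⟨Nat.div_pos (by omega) hp.pos, by omega⟩
  have h3 := hb x hx
  have h4 := hb y hy
  rcases ZMod.eq_one_or_neg_one_of_val_lt_iff (by omega) (by omega)
    (ZMod.interval_iff hx hy hpd H hκ hκp hε (by omega) (by omega)) with h | h
  · left; rw [hε, h, one_mul]
  · right; rw [hε, h, neg_one_mul]

end Progression

namespace IsBalanced

variable {p d : ℕ} {α β γ δ : ZMod (p * d)}

theorem pairing_of_add_eq [NeZero p] [NeZero d] (hp : p.Prime) (hpd : p ≤ d)
    (h : IsBalanced (p * d) α β γ δ)
    (hs : α + β = d) : α + γ = 0 ∨ β + γ = 0 := by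
  have H := h.val_le_iff
  have H' := h.swap₁₂.val_le_iff
  rw [add_comm β α] at H'
  rw [hs] at H H'
  have hα := h.isUnit
  have hβ := h.swap₁₂.isUnit
  have hγ := h.swap₂₃.swap₁₂.isUnit.neg
  have h0 := congrArg (ZMod.castHom (dvd_mul_left d p) (ZMod d)) hs
  rw [map_natCast, ZMod.natCast_self, _root_.map_add, add_eq_zero_iff_neg_eq] at h0
  rcases ZMod.castHom_eq_or_neg_of_interval_iff hp hα hγ hpd H with h1 | h1
  · left
    rw [← ZMod.eq_of_interval_iff hp hα hγ hpd H h1, neg_add_cancel]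
  · right
    rw [← ZMod.eq_of_interval_iff hp hβ hγ hpd H' (h1.trans h0), neg_add_cancel]

theorem pairing_of_castHom [NeZero p] [NeZero d] (hp : p.Prime) (hpd : p ≤ d)
    (h : IsBalanced (p * d) α β γ δ)
    (hs : ZMod.castHom (dvd_mul_left d p) (ZMod d) (α + β) = 0) :
    α + β = 0 ∨ α + γ = 0 ∨ β + γ = 0 := by
  refine or_iff_not_imp_left.2 fun h0 => ?_
  have := Fact.mk hp
  suffices ∃ u : ZMod (p * d), IsUnit u ∧ u * (α + β) = d by
    obtain ⟨u, hu, hus⟩ := this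
    have := (h.mul_left hu).pairing_of_add_eq hp hpd (by rw [← hus, mul_add])
    simpa only [← mul_add, hu.mul_right_eq_zero] using this
  generalize α + β = s at *
  obtain ⟨z, rfl⟩ := ZMod.natCast_zmod_surjective s
  rw [map_natCast, ZMod.natCast_eq_zero_iff] at hs
  obtain ⟨w, rfl⟩ := hs
  have hw : (w : ZMod p) ≠ 0 := fun hw => h0 <| by
    rw [ZMod.natCast_eq_zero_iff] at hw ⊢
    rw [mul_comm p d]
    exact mul_dvd_mul_left d hw
  obtain ⟨u, hu⟩ := ZMod.unitsMap_surjective (dvd_mul_right p d) (Units.mk0 _ (inv_ne_zero hw))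
  refine ⟨u, u.isUnit, ?_⟩
  have h1 := congrArg Units.val hu
  rw [ZMod.unitsMap_val, Units.val_mk0] at h1
  obtain ⟨z, hz⟩ := ZMod.natCast_zmod_surjective (u : ZMod (p * d))
  rw [← hz, ZMod.cast_natCast (dvd_mul_right p d)] at h1
  rw [← hz, ← Nat.cast_mul, ZMod.natCast_eq_natCast_iff, mul_left_comm]
  have h2 : z * w ≡ 1 [MOD p] := by
    rw [← ZMod.natCast_eq_natCast_iff, Nat.cast_mul, h1, inv_mul_cancel₀ hw, Nat.cast_one]
  simpa [mul_comm p d] using h2.mul_left' d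

end IsBalanced

end Pairing

section PairingTheorem

open Multiset

theorem exists_of_le_replicate_add {G : Type*} {U : Multiset G} {a b c : G} {i j l : ℕ}
    (h : U ≤ replicate i a + (replicate j b + replicate l c)) :
    ∃ i' ≤ i, ∃ j' ≤ j, ∃ l' ≤ l, U = replicate i' a + (replicate j' b + replicate l' c) := by
  obtain ⟨A, hA, W, hW, rfl⟩ := exists_add_eq_of_le_add h
  obtain ⟨B, hB, C, hC, rfl⟩ := exists_add_eq_of_le_add hW
  obtain ⟨i', hi, rfl⟩ := le_replicate_iff.1 hA
  obtain ⟨j', hj, rfl⟩ := le_replicate_iff.1 hB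
  obtain ⟨l', hl, rfl⟩ := le_replicate_iff.1 hC
  exact ⟨i', hi, j', hj, l', hl, rfl⟩

theorem ZMod.add_eq_zero_of_ne_zero_two : ∀ a b : ZMod 2, a ≠ 0 → b ≠ 0 → a + b = 0 := by
  decide

namespace IsBalanced

theorem pairing_of_prime {p : ℕ} [Fact p.Prime] {α β γ δ : ZMod p} (h : IsBalanced p α β γ δ) :
    α + β = 0 ∨ α + γ = 0 ∨ β + γ = 0 := by
  have hα := h.isUnit.ne_zero
  have hβ := h.swap₁₂.isUnit.ne_zero
  have hγ := h.swap₂₃.swap₁₂.isUnit.ne_zero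
  have hδ := h.swap₃₄.swap₂₃.swap₁₂.isUnit.ne_zero
  have hp := (Fact.out : p.Prime)
  have hp1 : Fact (1 < p) := ⟨hp.one_lt⟩
  rcases hp.two_le.eq_or_lt with rfl | hp3
  · left
    exact ZMod.add_eq_zero_of_ne_zero_two α β hα hβ
  have hk : δ⁻¹ ≠ 0 := inv_ne_zero hδ
  have hval := h.val_add _ hk
  rw [inv_mul_cancel₀ hδ, ZMod.val_one] at hval
  have hneg : ∀ x, (δ⁻¹ * x).val = p - 1 → x + δ = 0 := fun x hx => by
    have h1 := ZMod.natCast_zmod_val (δ⁻¹ * x)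
    rw [hx, Nat.cast_sub hp.one_le, ZMod.natCast_self, Nat.cast_one, zero_sub] at h1
    rw [← mul_right_inj' hk, mul_add, ← h1, inv_mul_cancel₀ hδ, mul_zero, neg_add_cancel]
  set c : ZMod p × ZMod p := (-(γ⁻¹ * α), -(γ⁻¹ * β)) with hc
  have hac : ((1, 0) : ZMod p × ZMod p) ≠ c := fun h => by
    simpa [hc, hβ, hγ] using congrArg Prod.snd h
  have hbc : ((0, 1) : ZMod p × ZMod p) ≠ c := fun h => by
    simpa [hc, hα, hγ] using congrArg Prod.fst h
  have hab : ((1, 0) : ZMod p × ZMod p) ≠ (0, 1) := by simp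
  have hTc : card (replicate (δ⁻¹ * α).val ((1, 0) : ZMod p × ZMod p) +
      (replicate (δ⁻¹ * β).val (0, 1) + replicate (δ⁻¹ * γ).val c)) = 2 * p - 1 := by
    simp only [card_add, card_replicate]
    omega
  have hmin : IsMinZeroSumSeq (replicate (δ⁻¹ * α).val ((1, 0) : ZMod p × ZMod p) +
      (replicate (δ⁻¹ * β).val (0, 1) + replicate (δ⁻¹ * γ).val c)) := by
    refine NoShortZeroSum.isMinZeroSumSeq (k := p) (fun U hU hU0 hUs => ?_) ?_ (by omega)
    · obtain ⟨i, hi, j, hj, l, hl, rfl⟩ := exists_of_le_replicate_add hU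
      simp only [sum_add, sum_replicate, hc, Prod.smul_mk, Prod.mk_add_mk, Prod.mk_eq_zero,
        nsmul_eq_mul, mul_one, mul_zero, zero_add] at hUs
      have hi0 : (i : ZMod p) = l * (γ⁻¹ * α) := by linear_combination hUs.1
      have hj0 : (j : ZMod p) = l * (γ⁻¹ * β) := by linear_combination hUs.2
      have hlt := fun x : ZMod p => x.val_lt
      have hi' : i = ((l * γ⁻¹) * α).val := by
        rw [mul_assoc, ← hi0, ZMod.val_cast_of_lt (hi.trans_lt (hlt _))]
      have hj' : j = ((l * γ⁻¹) * β).val := by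
        rw [mul_assoc, ← hj0, ZMod.val_cast_of_lt (hj.trans_lt (hlt _))]
      have hl' : l = ((l * γ⁻¹) * γ).val := by
        rw [mul_assoc, inv_mul_cancel₀ hγ, mul_one, ZMod.val_cast_of_lt (hl.trans_lt (hlt _))]
      have hk' : (l * γ⁻¹ : ZMod p) ≠ 0 := by
        intro h0
        rw [h0, zero_mul, ZMod.val_zero] at hi' hj' hl'
        simp [hi', hj', hl'] at hU0
      have h1 := h.val_add _ hk'
      have h2 := hlt (l * γ⁻¹ * δ)
      simp only [card_add, card_replicate]
      omega
    · simp only [sum_add, sum_replicate, hc, Prod.smul_mk, Prod.mk_add_mk, Prod.mk_eq_zero,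
        nsmul_eq_mul, ZMod.natCast_zmod_val]
      constructor <;> field_simp <;> ring
  obtain ⟨g, hg⟩ := hmin.exists_count hp3 hTc
  simp only [count_add, count_replicate] at hg
  have hs := h.sum_eq
  split_ifs at hg <;> first | omega | (subst_vars; simp_all; done) | skip
  · right; right
    linear_combination hs - hneg α (by omega)
  · right; left
    linear_combination hs - hneg β (by omega)
  · left
    linear_combination hs - hneg γ (by omega)

/-- Two of the four residues of a balanced quadruple have sum zero. -/
theorem pairing {m : ℕ} (hm : 2 ≤ m) {α β γ δ : ZMod m} (h : IsBalanced m α β γ δ) :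
    α + β = 0 ∨ α + γ = 0 ∨ β + γ = 0 := by
  induction m using Nat.strong_induction_on with
  | _ m ih =>
  by_cases hp : m.Prime
  · have := Fact.mk hp
    exact h.pairing_of_prime
  obtain ⟨d, hd⟩ := Nat.minFac_dvd m
  have hpp := Nat.minFac_prime (by omega : m ≠ 1)
  have hpd := Nat.minFac_le_div (by omega) hp
  rw [Nat.div_eq_of_eq_mul_right hpp.pos hd] at hpd
  generalize m.minFac = p at *
  subst hd
  have hd2 : 2 ≤ d := hpp.two_le.trans hpd
  have : NeZero p := ⟨hpp.ne_zero⟩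
  have : NeZero d := ⟨by omega⟩
  have hlt : d < p * d := by
    have := Nat.mul_le_mul_right d hpp.two_le
    omega
  rcases ih d hlt hd2 h.castHom with h1 | h1 | h1 <;> rw [← _root_.map_add] at h1
  · exact h.pairing_of_castHom hpp hpd h1
  · have := h.swap₂₃.pairing_of_castHom hpp hpd h1
    rw [add_comm γ β] at this
    tauto
  · have := h.swap₁₂.swap₂₃.pairing_of_castHom hpp hpd h1
    rw [add_comm γ α, add_comm β α] at this
    tauto

end IsBalanced

end PairingTheorem

section SequencePairing

open Multiset

/-- The condition that `a ^ (m - 1) b ^ (m - 1) c ^ (m - 1)` has no short zero-sum subsequence. -/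
def NoShortTriple (m : ℕ) (a b c : ZMod m × ZMod m) : Prop :=
  ∀ i j k : ZMod m, i • a + j • b + k • c = 0 → (i ≠ 0 ∨ j ≠ 0 ∨ k ≠ 0) →
    m < i.val + j.val + k.val

theorem ZMod.val_nsmul_eq_smul {m : ℕ} [NeZero m] {M : Type*} [AddCommGroup M] [Module (ZMod m) M]
    (i : ZMod m) (a : M) : i.val • a = i • a := by
  rw [← Nat.cast_smul_eq_nsmul (ZMod m), ZMod.natCast_zmod_val]

/-- A pair of elements generating `C_m ⊕ C_m`, hence a basis. -/
structure IsModBasis {K : Type*} [AddCommGroup K] (m : ℕ) (a b : K) : Prop where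
  dvd : ∀ i j : ℤ, i • a + j • b = 0 → (m : ℤ) ∣ i ∧ (m : ℤ) ∣ j
  exists_eq : ∀ g, ∃ i j : ℤ, g = i • a + j • b

namespace NoShortTriple

variable {m : ℕ} [NeZero m] {a b c : ZMod m × ZMod m}

theorem of_noShortZeroSum (h : NoShortZeroSum m
    (replicate (m - 1) a + (replicate (m - 1) b + replicate (m - 1) c))) :
    NoShortTriple m a b c := fun i j k h0 hne => by
  have hle : ∀ i : ZMod m, i.val ≤ m - 1 := fun i => by have := i.val_lt; omega
  have := h (replicate i.val a + (replicate j.val b + replicate k.val c))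
    (add_le_add (replicate_mono _ (hle i))
      (add_le_add (replicate_mono _ (hle j)) (replicate_mono _ (hle k))))
    (fun h0 => by
      have := congrArg card h0
      simp only [card_add, card_replicate, card_zero] at this
      simp only [ne_eq, ← ZMod.val_eq_zero] at hne
      omega)
    (by simpa only [sum_add, sum_replicate, ZMod.val_nsmul_eq_smul, add_assoc] using h0)
  simpa only [card_add, card_replicate, add_assoc] using this

omit [NeZero m] in
theorem swap₁₂ (h : NoShortTriple m a b c) : NoShortTriple m b a c := fun i j k h0 hne => by
  have := h j i k (by rw [← h0]; abel) (by tauto)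
  omega

omit [NeZero m] in
theorem swap₂₃ (h : NoShortTriple m a b c) : NoShortTriple m a c b := fun i j k h0 hne => by
  have := h i k j (by rw [← h0]; abel) (by tauto)
  omega

theorem eq_zero (h : NoShortTriple m a b c) {i j : ZMod m} (h0 : i • a + j • b = 0) :
    i = 0 ∧ j = 0 := by
  by_contra hne
  have hne' : i ≠ 0 ∨ j ≠ 0 := by tauto
  have h1 := h i j 0 (by rw [h0]; simp) (by tauto)
  have h2 := h (-i) (-j) 0
    (by rw [neg_smul, neg_smul, zero_smul, add_zero, ← neg_add, h0, neg_zero])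
    (by simpa using hne')
  have h3 := ZMod.val_add_val_neg_le i
  have h4 := ZMod.val_add_val_neg_le j
  simp only [ZMod.val_zero] at h1 h2
  omega

theorem exists_eq (h : NoShortTriple m a b c) (g : ZMod m × ZMod m) :
    ∃ i j : ZMod m, g = i • a + j • b := by
  have hinj : Function.Injective fun x : ZMod m × ZMod m => x.1 • a + x.2 • b := by
    intro x y hxy
    have := h.eq_zero (i := x.1 - y.1) (j := x.2 - y.2)
      (by rw [sub_smul, sub_smul, sub_add_sub_comm]; exact sub_eq_zero.2 hxy)
    exact Prod.ext (sub_eq_zero.1 this.1) (sub_eq_zero.1 this.2)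
  obtain ⟨x, rfl⟩ := Finite.injective_iff_surjective.1 hinj g
  exact ⟨x.1, x.2, rfl⟩

theorem isModBasis (h : NoShortTriple m a b c) : IsModBasis m a b where
  dvd i j h0 := by
    have := h.eq_zero (i := i) (j := j) (by rwa [Int.cast_smul_eq_zsmul, Int.cast_smul_eq_zsmul])
    rwa [ZMod.intCast_zmod_eq_zero_iff_dvd, ZMod.intCast_zmod_eq_zero_iff_dvd] at this
  exists_eq g := by
    obtain ⟨i, j, rfl⟩ := h.exists_eq g
    obtain ⟨i, rfl⟩ := ZMod.intCast_surjective i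
    obtain ⟨j, rfl⟩ := ZMod.intCast_surjective j
    exact ⟨i, j, by rw [Int.cast_smul_eq_zsmul, Int.cast_smul_eq_zsmul]⟩

theorem isBalanced (h : NoShortTriple m a b c) {u v : ZMod m} (hc : c = u • a + v • b) :
    IsBalanced m u v (-1) (1 - u - v) := by
  refine ⟨by ring, fun k hk => ?_⟩
  have key : ∀ k : ZMod m, (k * u) • a + (k * v) • b + (k * -1) • c = 0 := fun k => by
    rw [hc, mul_smul, mul_smul, mul_smul, neg_one_smul]
    simp only [smul_neg, smul_add]
    abel
  have h1 := h _ _ _ (key k) (by simp [hk])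
  have h2 := h _ _ _ (key (-k)) (by simp [hk])
  simp only [neg_mul k] at h2
  have h3 := ZMod.val_add_val_neg_le (k * u)
  have h4 := ZMod.val_add_val_neg_le (k * v)
  have h5 := ZMod.val_add_val_neg_le (k * -1)
  have h6 := (k * (1 - u - v)).val_lt
  have h7 : m ∣ (k * u).val + (k * v).val + (k * -1).val + (k * (1 - u - v)).val := by
    rw [← ZMod.natCast_eq_zero_iff]
    push_cast
    simp only [ZMod.natCast_val, ZMod.cast_id', id]
    ring
  obtain ⟨q, hq⟩ := h7
  have hq1 : 1 < q := Nat.lt_of_mul_lt_mul_left (a := m) (by omega)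
  have hq3 : q < 3 := Nat.lt_of_mul_lt_mul_left (a := m) (by omega)
  obtain rfl : q = 2 := by omega
  omega

end NoShortTriple

theorem PropertyC.exists_pairing {m : ℕ} (hm : 2 ≤ m) (hC : PropertyC m)
    {S : Multiset (ZMod m × ZMod m)} (hS : NoShortZeroSum m S) (hc : card S = 3 * m - 3) :
    ∃ A B C : ZMod m × ZMod m, ∃ x : ℕ, IsModBasis m A B ∧ 0 < x ∧ x < m ∧ x.Coprime m ∧
      C + x • A = B ∧ S = replicate (m - 1) A + (replicate (m - 1) B + replicate (m - 1) C) := by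
  have : NeZero m := ⟨by omega⟩
  have : Fact (1 < m) := ⟨hm⟩
  obtain ⟨a, b, c, rfl⟩ := hC S hc hS
  have h := NoShortTriple.of_noShortZeroSum hS
  obtain ⟨u, v, hcuv⟩ := h.exists_eq c
  have hbal := h.isBalanced hcuv
  have hval : ∀ w : ZMod m, IsUnit w → 0 < w.val ∧ w.val < m ∧ w.val.Coprime m := fun w hw =>
    ⟨Nat.pos_of_ne_zero fun h => hw.ne_zero ((ZMod.val_eq_zero w).1 h), w.val_lt, by
      obtain ⟨w, rfl⟩ := hw
      exact ZMod.val_coe_unit_coprime w⟩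
  rcases hbal.pairing hm with h1 | h1 | h1
  · obtain ⟨w, hw⟩ := hbal.isUnit.exists_left_inv
    have hwu : IsUnit w := IsUnit.of_mul_eq_one _ hw
    obtain ⟨p1, p2, p3⟩ := hval w hwu
    refine ⟨c, a, b, w.val, h.swap₂₃.swap₁₂.isModBasis, p1, p2, p3, ?_, by abel⟩
    rw [ZMod.val_nsmul_eq_smul, hcuv, eq_neg_of_add_eq_zero_right h1, smul_add, smul_smul, hw,
      smul_smul, mul_neg, hw, neg_one_smul, one_smul]
    abel
  · obtain ⟨p1, p2, p3⟩ := hval (-v) hbal.swap₁₂.isUnit.neg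
    refine ⟨b, a, c, (-v).val, h.swap₁₂.isModBasis, p1, p2, p3, ?_, by abel⟩
    rw [ZMod.val_nsmul_eq_smul, hcuv, add_neg_eq_zero.1 h1, one_smul, neg_smul]
    abel
  · obtain ⟨p1, p2, p3⟩ := hval (-u) hbal.isUnit.neg
    refine ⟨a, b, c, (-u).val, h.isModBasis, p1, p2, p3, ?_, rfl⟩
    rw [ZMod.val_nsmul_eq_smul, hcuv, add_neg_eq_zero.1 h1, one_smul, neg_smul]
    abel

end SequencePairing

section Shape

open Multiset

theorem NoShortZeroSum.card_le_of_zmod {n : ℕ} [NeZero n] {L : Multiset (ZMod n)}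
    (hL : NoShortZeroSum n L) : card L ≤ n - 1 := by
  by_contra! hlt
  obtain ⟨T, hT, hTc⟩ := exists_le_card_eq (by omega : n ≤ card L)
  have := ((hL.mono hT).zeroSumFree hTc.le).card_lt
  rw [Nat.card_zmod] at this
  omega

theorem NoShortZeroSum.rigid_of_zmod {n : ℕ} [NeZero n] {W : Multiset (ZMod n)} {σ σ' : ZMod n}
    (hc : card W + 1 = n - 1) (h : NoShortZeroSum n (σ ::ₘ W))
    (h' : NoShortZeroSum n (σ' ::ₘ W)) : σ = σ' := by
  have hz := h.zeroSumFree (by rw [card_cons]; omega)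
  have hz' := h'.zeroSumFree (by rw [card_cons]; omega)
  rcases W.empty_or_exists_mem with rfl | ⟨w, hw⟩
  · obtain rfl : n = 2 := by rw [card_zero] at hc; omega
    have key : ∀ a b : ZMod 2, a ≠ 0 → b ≠ 0 → a = b := by decide
    exact key σ σ' (h.ne_zero two_pos (by simp)) (h'.ne_zero two_pos (by simp))
  · have hle : Nat.card (ZMod n) ≤ card (σ ::ₘ W) + 1 := by
      rw [Nat.card_zmod, card_cons]; omega
    rw [hz.eq_of_mem hle (mem_cons_self _ _) (mem_cons_of_mem hw)]
    exact hz'.eq_of_mem (by rwa [card_cons] at hle ⊢) (mem_cons_of_mem hw) (mem_cons_self _ _)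

/-- Reduction of `C_m ⊕ C_{mn}` modulo `m`. -/
def reduceSnd (m n : ℕ) : ZMod m × ZMod (m * n) →+ ZMod m × ZMod m :=
  AddMonoidHom.prodMap (AddMonoidHom.id _)
    (ZMod.castHom (dvd_mul_right m n) (ZMod m)).toAddMonoidHom

/-- The embedding of `C_n` as the kernel of `reduceSnd m n`. -/
def kernelHom (m n : ℕ) : ZMod n →+ ZMod m × ZMod (m * n) :=
  (AddMonoidHom.inr _ _).comp (ZMod.mulLeftHom m n)

theorem exists_kernelHom_eq {m n : ℕ} {g : ZMod m × ZMod (m * n)} (hg : reduceSnd m n g = 0) :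
    ∃ y, kernelHom m n y = g := by
  obtain ⟨y, hy⟩ := ZMod.exists_mulLeftHom_eq (congrArg Prod.snd hg)
  exact ⟨y, Prod.ext (congrArg Prod.fst hg).symm hy⟩

theorem reduceSnd_kernelHom (m n : ℕ) (y : ZMod n) : reduceSnd m n (kernelHom m n y) = 0 := by
  obtain ⟨y, rfl⟩ := ZMod.intCast_surjective y
  refine Prod.ext rfl ?_
  change ZMod.castHom (dvd_mul_right m n) (ZMod m) (ZMod.mulLeftHom m n y) = 0
  rw [ZMod.mulLeftHom_intCast]
  simp

theorem kernelHom_injective {m : ℕ} (hm : 0 < m) (n : ℕ) : Function.Injective (kernelHom m n) :=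
  fun _ _ h => ZMod.mulLeftHom_injective hm n (congrArg Prod.snd h)

theorem blockSetup_reduceSnd {m n : ℕ} [NeZero n] (hm : 2 ≤ m) :
    BlockSetup (reduceSnd m n) m n (n - 1) := by
  obtain ⟨hE, hC⟩ := etaBound_and_propertyC (by omega : 0 < m)
  exact BlockSetup.of_kernel (kernelHom m n) (fun g hg => exists_kernelHom_eq hg) hm
    ZMod.prod_nsmul_self hE (fun R hc h x hx => hC.count_eq (by omega) hc h hx)
    (fun L hL => NoShortZeroSum.card_le_of_zmod hL)
    (fun W σ σ' hc h h' => NoShortZeroSum.rigid_of_zmod hc h h')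

/-- The common block sum of a full decomposition generates the kernel. -/
theorem FullDecomp.exists_generator {m n : ℕ} [NeZero n] (hm : 2 ≤ m)
    {S L R : Multiset (ZMod m × ZMod (m * n))}
    (h : FullDecomp (reduceSnd m n) m n (n - 1) S (L.map (replicate m)) R) :
    ∃ x₀, reduceSnd m n x₀ = 0 ∧ addOrderOf x₀ = n ∧ (∀ g ∈ L, m • g = x₀) ∧
      ∀ g, reduceSnd m n g = 0 → ∃ z : ℤ, z • x₀ = g := by
  have hn := NeZero.pos n
  have hker : ∀ g ∈ L.map (m • ·), ∃ y, kernelHom m n y = g := fun g hg => by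
    obtain ⟨g, -, rfl⟩ := Multiset.mem_map.1 hg
    refine exists_kernelHom_eq ?_
    rw [_root_.map_nsmul, h.setup.nsmul_eq_zero]
  obtain ⟨M, hM, -⟩ := exists_map_eq_of_forall (f := kernelHom m n) (p := fun _ => True)
    (L.map (m • ·)) fun g hg => by simpa using hker g hg
  have hc : card M = n - 1 := by
    rw [← card_map (kernelHom m n), hM, card_map, ← h.card_blocks, card_map]
  have hz : ZeroSumFree M := by
    refine NoShortZeroSum.zeroSumFree (k := n) (NoShortZeroSum.of_map (kernelHom m n) ?_)
      (by omega)
    have := h.noShort h.noShortZeroSum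
    rw [Multiset.map_map] at this
    rw [hM]
    convert this using 2
    simp
  obtain ⟨y₀, hy₀⟩ : ∃ y₀, ∀ y ∈ M, y = y₀ := by
    rcases M.empty_or_exists_mem with rfl | ⟨y₀, hy₀⟩
    · exact ⟨0, by simp⟩
    · exact ⟨y₀, fun y hy => hz.eq_of_mem (by rw [Nat.card_zmod]; omega) hy hy₀⟩
  have hMr : M = replicate (n - 1) y₀ := Multiset.eq_replicate.2 ⟨hc, hy₀⟩
  have hord : addOrderOf y₀ = n := by
    have hdvd : addOrderOf y₀ ∣ n := addOrderOf_dvd_of_nsmul_eq_zero (by simp)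
    refine le_antisymm (Nat.le_of_dvd hn hdvd) ?_
    by_contra! hlt
    have hpos := Nat.pos_of_dvd_of_pos hdvd hn
    have := congrArg card (hz (replicate (addOrderOf y₀) y₀)
      (hMr ▸ replicate_mono _ (by omega)) (by rw [sum_replicate, addOrderOf_nsmul_eq_zero]))
    simp only [card_replicate, card_zero] at this
    omega
  refine ⟨kernelHom m n y₀, reduceSnd_kernelHom m n y₀, ?_, fun g hg => ?_, fun g hg => ?_⟩
  · rw [addOrderOf_injective _ (kernelHom_injective (by omega) n), hord]
  · have : m • g ∈ M.map (kernelHom m n) := hM ▸ Multiset.mem_map_of_mem _ hg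
    obtain ⟨y, hy, hyg⟩ := Multiset.mem_map.1 this
    rw [← hyg, hy₀ y hy]
  · obtain ⟨y, rfl⟩ := exists_kernelHom_eq hg
    have htop : AddSubgroup.zmultiples y₀ = ⊤ :=
      AddSubgroup.eq_top_of_card_eq _ (by rw [Nat.card_zmultiples, hord, Nat.card_zmod])
    obtain ⟨z, hz⟩ := AddSubgroup.mem_zmultiples_iff.1 (htop ▸ AddSubgroup.mem_top y)
    exact ⟨z, by rw [← hz, _root_.map_zsmul]⟩

theorem FullDecomp.sum_eq {m n : ℕ} [NeZero n] {S L R K : Multiset (ZMod m × ZMod (m * n))}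
    {x₀ : ZMod m × ZMod (m * n)}
    (h : FullDecomp (reduceSnd m n) m n (n - 1) S (L.map (replicate m)) R)
    (hord : addOrderOf x₀ = n) (hL : ∀ g ∈ L, m • g = x₀)
    (hker : ∀ g, reduceSnd m n g = 0 → ∃ z : ℤ, z • x₀ = g) (hK : K ≤ R) (hK0 : K ≠ 0)
    (hKs : reduceSnd m n K.sum = 0) (hKc : card K < 2 * m) : K.sum = x₀ := by
  have hn := NeZero.pos n
  have hn0 : n • x₀ = 0 := by
    have := addOrderOf_nsmul_eq_zero x₀
    rwa [hord] at this
  obtain ⟨c, hc0, hcn, hc⟩ : ∃ c : ℕ, 0 < c ∧ c ≤ n ∧ c • x₀ = K.sum := by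
    obtain ⟨z, hz⟩ := hker _ hKs
    rw [← mod_addOrderOf_zsmul, hord] at hz
    obtain ⟨c, hc⟩ := Int.eq_ofNat_of_zero_le (Int.emod_nonneg z (by omega : (n : ℤ) ≠ 0))
    have hcn := Int.emod_lt_of_pos z (by omega : (0 : ℤ) < n)
    rw [hc] at hz hcn
    rw [natCast_zsmul] at hz
    rcases Nat.eq_zero_or_pos c with rfl | hpos
    · exact ⟨n, hn, le_rfl, by rw [← hz, zero_nsmul, hn0]⟩
    · exact ⟨c, hpos, by omega, hz⟩
  have hLc : card L = n - 1 := by simpa using h.card_blocks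
  obtain ⟨L', hL', hLc'⟩ := exists_le_card_eq (by omega : n - c ≤ card L)
  have hLs : (m • L').sum = (n - c) • x₀ := by
    have : (L'.map (m • ·)).sum = m • L'.sum := by rw [Multiset.sum_map_nsmul, map_id']
    rw [sum_nsmul, ← this, Multiset.map_congr rfl fun g hg => hL g (mem_of_le hL' hg),
      map_const', sum_replicate, hLc']
  have := h.noShortZeroSum (m • L' + K)
    (by rw [h.eq, join_map_replicate]; exact add_le_add (nsmul_le_nsmul_right hL' m) hK)
    (fun h0 => hK0 (add_eq_zero.1 h0).2)
    (by rw [sum_add, hLs, ← hc, ← add_nsmul, Nat.sub_add_cancel hcn, hn0])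
  rw [card_add, card_nsmul, hLc', Nat.mul_sub] at this
  have h1 : m * c ≤ m * n := Nat.mul_le_mul_left m hcn
  have h2 : c < 2 := Nat.lt_of_mul_lt_mul_left (a := m) (by omega)
  rw [← hc, show c = 1 by omega, one_nsmul]

end Shape

section Triple

open Multiset

variable {G K : Type*} [AddCommGroup G] [AddCommGroup K]

theorem mod_nsmul_of_nsmul_eq_zero {m : ℕ} {g : G} (hg : m • g = 0) (k : ℕ) :
    (k % m) • g = k • g := by
  conv_rhs => rw [← Nat.div_add_mod k m, add_nsmul, mul_nsmul, hg, nsmul_zero, zero_add]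

/-- The elements of an extremal sequence, together with the generator `x₀` of the kernel of `φ`. -/
structure IsTriple (m n : ℕ) (φ : G →+ K) (A B C x₀ : G) (x : ℕ) : Prop where
  two_le : 2 ≤ m
  pos : 0 < x
  lt : x < m
  coprime : x.Coprime m
  map_eq_zero : φ x₀ = 0
  addOrderOf_eq : addOrderOf x₀ = n
  exists_zsmul : ∀ g, φ g = 0 → ∃ z : ℤ, z • x₀ = g
  nsmul_eq_zero : ∀ k : K, m • k = 0
  basis : IsModBasis m (φ A) (φ B)
  map_eq : φ C + x • φ A = φ B
  rel : ∀ k, 0 < k → k < m → (k * x % m) • A + ((m - k) • B + k • C) = x₀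

theorem map_sum_of_forall {φ : G →+ K} {T : Multiset G} {k : K} (h : ∀ g ∈ T, φ g = k) :
    φ T.sum = card T • k := by
  rw [map_multiset_sum, Multiset.map_congr rfl h, map_const', sum_replicate]

theorem exists_replicate_of_forall {α : Type*} {a b c : α} (L : Multiset α)
    (h : ∀ g ∈ L, g = a ∨ g = b ∨ g = c) :
    ∃ i j k, L = replicate i a + (replicate j b + replicate k c) := by
  induction L using Multiset.induction with
  | empty => exact ⟨0, 0, 0, by simp⟩
  | cons g L ih =>
    obtain ⟨i, j, k, rfl⟩ := ih fun g hg => h g (mem_cons_of_mem hg)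
    rcases h g (mem_cons_self _ _) with rfl | rfl | rfl
    · exact ⟨i + 1, j, k, by rw [replicate_succ, cons_add]⟩
    · exact ⟨i, j + 1, k, by rw [replicate_succ, cons_add, add_cons]⟩
    · exact ⟨i, j, k + 1, by rw [replicate_succ, add_cons, add_cons]⟩

theorem exists_mul_mod_eq_one {m x : ℕ} (hm : 2 ≤ m) (hx : x.Coprime m) :
    ∃ k, 0 < k ∧ k < m ∧ k * x % m = 1 := by
  obtain ⟨k, hk⟩ := Nat.exists_mul_mod_eq_one_of_coprime hx (by omega)
  refine ⟨k % m, Nat.pos_of_ne_zero fun h0 => ?_, Nat.mod_lt _ (by omega), ?_⟩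
  · rw [Nat.mul_mod, h0] at hk
    simp at hk
  · rw [Nat.mod_mul_mod, mul_comm]
    exact hk.2

/-- If all sums of suitable cardinalities agree, the three sequences are constant. -/
theorem exists_replicate_of_sum_eq {m x : ℕ} {x₀ : G} {RA RB RC : Multiset G} (hm : 2 ≤ m)
    (hx : x.Coprime m) (hA : card RA = m - 1) (hB : card RB = m - 1) (hC : card RC = m - 1)
    (h : ∀ k, 0 < k → k < m → ∀ KA ≤ RA, ∀ KB ≤ RB, ∀ KC ≤ RC, card KA = k * x % m →
      card KB = m - k → card KC = k → KA.sum + (KB.sum + KC.sum) = x₀) :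
    ∃ A B C, RA = replicate (m - 1) A ∧ RB = replicate (m - 1) B ∧ RC = replicate (m - 1) C := by
  have hmod : ∀ k, k * x % m ≤ m - 1 := fun k => by
    have := Nat.mod_lt (k * x) (by omega : 0 < m)
    omega
  have key : ∀ M : Multiset G, card M = m - 1 →
      (∃ c : G, ∀ g ∈ M, g + c = x₀) → ∃ g, M = replicate (m - 1) g := by
    rintro M hM ⟨c, hc⟩
    exact ⟨x₀ - c, Multiset.eq_replicate.2 ⟨hM, fun g hg => eq_sub_of_add_eq (hc g hg)⟩⟩
  have hAr : ∃ g, RA = replicate (m - 1) g := by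
    obtain ⟨k, hk0, hkm, hk⟩ := exists_mul_mod_eq_one hm hx
    obtain ⟨KB, hKB, hKBc⟩ := exists_le_card_eq (by omega : m - k ≤ card RB)
    obtain ⟨KC, hKC, hKCc⟩ := exists_le_card_eq (by omega : k ≤ card RC)
    exact key RA hA ⟨KB.sum + KC.sum, fun g hg => by
      simpa using h k hk0 hkm {g} (singleton_le.2 hg) KB hKB KC hKC (by simp [hk]) hKBc hKCc⟩
  have hBr : ∃ g, RB = replicate (m - 1) g := by
    obtain ⟨KA, hKA, hKAc⟩ := exists_le_card_eq ((hmod (m - 1)).trans hA.ge)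
    obtain ⟨KC, hKC, hKCc⟩ := exists_le_card_eq hC.ge
    exact key RB hB ⟨KA.sum + KC.sum, fun g hg => by
      have := h (m - 1) (by omega) (by omega) KA hKA {g} (singleton_le.2 hg) KC hKC hKAc
        (by rw [card_singleton]; omega) hKCc
      rwa [sum_singleton, add_left_comm] at this⟩
  have hCr : ∃ g, RC = replicate (m - 1) g := by
    obtain ⟨KA, hKA, hKAc⟩ := exists_le_card_eq ((hmod 1).trans hA.ge)
    obtain ⟨KB, hKB, hKBc⟩ := exists_le_card_eq hB.ge
    exact key RC hC ⟨KA.sum + KB.sum, fun g hg => by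
      have := h 1 one_pos (by omega) KA hKA KB hKB {g} (singleton_le.2 hg) hKAc hKBc (by simp)
      rwa [sum_singleton, ← add_assoc, add_comm] at this⟩
  obtain ⟨A, hA⟩ := hAr
  obtain ⟨B, hB⟩ := hBr
  obtain ⟨C, hC⟩ := hCr
  exact ⟨A, B, C, hA, hB, hC⟩

theorem exists_isTriple {m n : ℕ} [NeZero n] (hm : 2 ≤ m) {S : Multiset (ZMod m × ZMod (m * n))}
    (hS : NoShortZeroSum (m * n) S) (hc : card S = 3 * m - 3 + m * (n - 1)) :
    ∃ A B C x₀ : ZMod m × ZMod (m * n), ∃ x jA jB jC : ℕ,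
      IsTriple m n (reduceSnd m n) A B C x₀ x ∧ jA + jB + jC = n - 1 ∧
      (0 < jA → m • A = x₀) ∧ (0 < jB → m • B = x₀) ∧ (0 < jC → m • C = x₀) ∧
      S = replicate (m * jA + (m - 1)) A + (replicate (m * jB + (m - 1)) B +
        replicate (m * jC + (m - 1)) C) := by
  obtain ⟨L, R, h, hL⟩ := (blockSetup_reduceSnd (n := n) hm).exists_shape hS hc
  obtain ⟨x₀, hx₀, hord, hLx, hker⟩ := h.exists_generator hm
  obtain ⟨A', B', C', x, hbasis, hx0, hxm, hcop, hrel, hR⟩ :=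
    (etaBound_and_propertyC (by omega : 0 < m)).2.exists_pairing hm h.noShort_remainder
      (by rw [card_map, h.card_remainder])
  have hm0 : ∀ k : ZMod m × ZMod m, m • k = 0 := h.setup.nsmul_eq_zero
  obtain ⟨RA, RB, RC, rfl, hRA, hRB, hRC⟩ : ∃ RA RB RC, R = RA + (RB + RC) ∧
      RA.map (reduceSnd m n) = replicate (m - 1) A' ∧
      RB.map (reduceSnd m n) = replicate (m - 1) B' ∧
      RC.map (reduceSnd m n) = replicate (m - 1) C' := by
    obtain ⟨RA, hRA, hA⟩ := exists_le_of_le_map (hR ▸ Multiset.le_add_right _ _)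
    obtain ⟨R', rfl⟩ := Multiset.le_iff_exists_add.1 hRA
    rw [Multiset.map_add, hA, add_right_inj] at hR
    obtain ⟨RB, hRB, hB⟩ := exists_le_of_le_map (hR ▸ Multiset.le_add_right _ _)
    obtain ⟨RC, rfl⟩ := Multiset.le_iff_exists_add.1 hRB
    rw [Multiset.map_add, hB, add_right_inj] at hR
    exact ⟨RA, RB, RC, rfl, hA, hB, hR⟩
  have hforall : ∀ {M : Multiset (ZMod m × ZMod (m * n))} {g' : ZMod m × ZMod m},
      M.map (reduceSnd m n) = replicate (m - 1) g' → ∀ g ∈ M, reduceSnd m n g = g' :=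
    fun hM g hg => eq_of_mem_replicate (hM ▸ Multiset.mem_map_of_mem _ hg)
  have hcard : ∀ {M : Multiset (ZMod m × ZMod (m * n))} {g' : ZMod m × ZMod m},
      M.map (reduceSnd m n) = replicate (m - 1) g' → card M = m - 1 := fun {M g'} hM => by
    rw [← card_map (reduceSnd m n), hM, card_replicate]
  have hsum : ∀ k, 0 < k → k < m → ∀ KA ≤ RA, ∀ KB ≤ RB, ∀ KC ≤ RC, card KA = k * x % m →
      card KB = m - k → card KC = k → KA.sum + (KB.sum + KC.sum) = x₀ := by
    intro k hk0 hkm KA hA KB hB KC hC hAc hBc hCc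
    rw [← sum_add, ← sum_add]
    refine h.sum_eq hord hLx hker (add_le_add hA (add_le_add hB hC)) ?_ ?_ ?_
    · intro h0
      have := congrArg card h0
      rw [card_add, card_add, card_zero] at this
      omega
    · rw [sum_add, sum_add, _root_.map_add, _root_.map_add,
        map_sum_of_forall fun g hg => hforall hRA g (mem_of_le hA hg),
        map_sum_of_forall fun g hg => hforall hRB g (mem_of_le hB hg),
        map_sum_of_forall fun g hg => hforall hRC g (mem_of_le hC hg), hAc, hBc, hCc,
        mod_nsmul_of_nsmul_eq_zero (hm0 _), add_left_comm, add_comm (_ • A'), mul_nsmul',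
        ← nsmul_add, hrel, ← add_nsmul, Nat.sub_add_cancel hkm.le, hm0]
    · have := Nat.mod_lt (k * x) (by omega : 0 < m)
      rw [card_add, card_add]
      omega
  obtain ⟨A, B, C, rfl, rfl, rfl⟩ :=
    exists_replicate_of_sum_eq hm hcop (hcard hRA) (hcard hRB) (hcard hRC) hsum
  have hmem : ∀ g : ZMod m × ZMod (m * n), g ∈ replicate (m - 1) g := fun g =>
    mem_replicate.2 ⟨by omega, rfl⟩
  obtain rfl := hforall hRA A (hmem A)
  obtain rfl := hforall hRB B (hmem B)
  obtain rfl := hforall hRC C (hmem C)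
  obtain ⟨jA, jB, jC, rfl⟩ := exists_replicate_of_forall (a := A) (b := B) (c := C) L fun g hg => by
    have := (hL g hg).1
    simp only [mem_add, mem_replicate] at this
    tauto
  refine ⟨A, B, C, x₀, x, jA, jB, jC, ⟨hm, hx0, hxm, hcop, hx₀, hord, hker, hm0, hbasis, hrel,
    fun k hk0 hkm => ?_⟩, ?_, fun hj => ?_, fun hj => ?_, fun hj => ?_, ?_⟩
  · have hmod := Nat.mod_lt (k * x) (by omega : 0 < m)
    simpa using hsum k hk0 hkm (replicate (k * x % m) A) (replicate_mono _ (by omega))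
      (replicate (m - k) B) (replicate_mono _ (by omega))
      (replicate k C) (replicate_mono _ (by omega))
  · have := h.card_blocks
    simp only [card_map, card_add, card_replicate] at this
    omega
  · exact hLx A (by simp [mem_replicate, hj.ne'])
  · exact hLx B (by simp [mem_replicate, hj.ne'])
  · exact hLx C (by simp [mem_replicate, hj.ne'])
  · rw [h.eq, join_map_replicate]
    simp only [nsmul_add, nsmul_replicate, replicate_add]
    abel

end Triple

section Forms

open Multiset

variable {G K : Type*} [AddCommGroup G] [AddCommGroup K]

/-- The extremal sequences obtained from a basis. -/
def IsBasisForm (m n : ℕ) (S : Multiset G) : Prop :=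
  ∃ (e1 e2 : G) (x : ℤ) (s : ℕ),
    (∀ a b : ℤ, a • e1 + b • e2 = 0 → a • e1 = 0 ∧ b • e2 = 0) ∧
    AddSubgroup.closure ({e1, e2} : Set G) = ⊤ ∧
    addOrderOf e2 = m * n ∧ Int.gcd x m = 1 ∧ 1 ≤ s ∧ s ≤ n ∧
    S = replicate (m - 1) e1 + replicate (s * m - 1) e2 +
      replicate ((n + 1 - s) * m - 1) ((-x) • e1 + e2)

/-- The extremal sequences obtained from a generating pair. -/
def IsGeneratingForm (m n : ℕ) (S : Multiset G) : Prop :=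
  ∃ g1 g2 : G, AddSubgroup.closure ({g1, g2} : Set G) = ⊤ ∧ addOrderOf g2 = m * n ∧
    S = replicate (m - 1) g1 + replicate (m * n - 1) g2 + replicate (m - 1) (-g1 + g2)

namespace IsModBasis

variable {m : ℕ} {a b c : K}

theorem symm (h : IsModBasis m a b) : IsModBasis m b a where
  dvd i j h0 := (h.dvd j i (by rwa [add_comm])).symm
  exists_eq g := by
    obtain ⟨i, j, h⟩ := h.exists_eq g
    exact ⟨j, i, by rw [h, add_comm]⟩

theorem of_add_zsmul (h : IsModBasis m a b) (x : ℤ) (hc : c + x • a = b) :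
    IsModBasis m a c where
  dvd i j h0 := by
    obtain ⟨h1, h2⟩ := h.dvd (i - j * x) j (by rw [← hc, ← h0]; module)
    exact ⟨(dvd_sub_left (h2.mul_right x)).1 h1, h2⟩
  exists_eq g := by
    obtain ⟨i, j, h⟩ := h.exists_eq g
    exact ⟨i + j * x, j, by rw [h, ← hc]; module⟩

end IsModBasis

namespace IsTriple

variable {m n x : ℕ} {φ : G →+ K} {A B C x₀ : G}

theorem nsmul_self (h : IsTriple m n φ A B C x₀ x) : n • x₀ = 0 := by
  rw [← h.addOrderOf_eq, addOrderOf_nsmul_eq_zero]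

theorem swap (h : IsTriple m n φ A B C x₀ x) : IsTriple m n φ A C B x₀ (m - x) where
  two_le := h.two_le
  pos := by have := h.lt; omega
  lt := by have := h.pos; have := h.lt; omega
  coprime := (Nat.coprime_self_sub_left h.lt.le).2 h.coprime
  map_eq_zero := h.map_eq_zero
  addOrderOf_eq := h.addOrderOf_eq
  exists_zsmul := h.exists_zsmul
  nsmul_eq_zero := h.nsmul_eq_zero
  basis := h.basis.of_add_zsmul x (by rw [natCast_zsmul, h.map_eq])
  map_eq := by
    rw [← h.map_eq, add_assoc, ← add_nsmul, Nat.add_sub_cancel' h.lt.le, h.nsmul_eq_zero,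
      add_zero]
  rel k hk0 hkm := by
    have hmod : k * (m - x) % m = (m - k) * x % m := by
      refine Nat.ModEq.add_right_cancel' (k * x) ?_
      rw [← mul_add, ← add_mul, Nat.sub_add_cancel h.lt.le, Nat.sub_add_cancel hkm.le]
      exact ((Nat.modEq_zero_iff_dvd.2 (dvd_mul_left _ _)).trans
        (Nat.modEq_zero_iff_dvd.2 (dvd_mul_right _ _)).symm)
    rw [hmod, ← h.rel (m - k) (by omega) (by omega), Nat.sub_sub_self hkm.le,
      add_comm ((m - k) • C)]

theorem closure_eq_top (h : IsTriple m n φ A B C x₀ x) {U V : G}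
    (hb : IsModBasis m (φ U) (φ V)) (hV : m • V = x₀) :
    AddSubgroup.closure ({U, V} : Set G) = ⊤ := by
  refine AddSubgroup.eq_top_iff' _ |>.2 fun g => AddSubgroup.mem_closure_pair.2 ?_
  obtain ⟨i, j, hg⟩ := hb.exists_eq (φ g)
  obtain ⟨z, hz⟩ := h.exists_zsmul (g - i • U - j • V) (by
    rw [_root_.map_sub, _root_.map_sub, hg, _root_.map_zsmul, _root_.map_zsmul]; abel)
  refine ⟨i, j + z * m, ?_⟩
  rw [← hV, ← natCast_zsmul, smul_smul] at hz
  rw [add_zsmul, hz]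
  abel

theorem addOrderOf_eq_mul (h : IsTriple m n φ A B C x₀ x) {U V : G}
    (hb : IsModBasis m (φ U) (φ V)) (hV : m • V = x₀) : addOrderOf V = m * n := by
  refine Nat.dvd_antisymm (addOrderOf_dvd_of_nsmul_eq_zero ?_) ?_
  · rw [mul_nsmul, hV, h.nsmul_self]
  · have h0 := addOrderOf_nsmul_eq_zero V
    obtain ⟨d, hd⟩ : m ∣ addOrderOf V := by
      refine Int.natCast_dvd_natCast.1 (hb.dvd 0 (addOrderOf V) ?_).2
      rw [zero_smul, zero_add, natCast_zsmul, ← _root_.map_nsmul, h0, _root_.map_zero]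
    rw [hd, mul_nsmul, hV] at h0
    rw [hd, ← h.addOrderOf_eq]
    exact mul_dvd_mul_left m (addOrderOf_dvd_of_nsmul_eq_zero h0)

theorem independent {U V : G} (hb : IsModBasis m (φ U) (φ V)) (hU : m • U = 0) (a b : ℤ)
    (hab : a • U + b • V = 0) : a • U = 0 ∧ b • V = 0 := by
  obtain ⟨⟨c, rfl⟩, -⟩ := hb.dvd a b (by
    rw [← _root_.map_zsmul, ← _root_.map_zsmul, ← _root_.map_add, hab, _root_.map_zero])
  have : ((m : ℤ) * c) • U = 0 := by rw [mul_comm, mul_zsmul, natCast_zsmul, hU, zsmul_zero]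
  exact ⟨this, by rwa [this, zero_add] at hab⟩

theorem third_eq (h : IsTriple m n φ A B C x₀ x) : C = x₀ - m • B + B - x • A := by
  have := h.rel 1 one_pos h.two_le
  rw [one_mul, Nat.mod_eq_of_lt h.lt, one_nsmul] at this
  rw [← this, ← Nat.sub_add_cancel (show 1 ≤ m from h.pos.trans h.lt), add_nsmul, one_nsmul,
    Nat.add_sub_cancel]
  abel

theorem nsmul_diff (h : IsTriple m n φ A B C x₀ x) {k : ℕ} (hk0 : 0 < k) (hkm : k < m) :
    k • (x₀ - m • B) = x₀ - m • B + (k * x / m) • m • A := by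
  have h1 := h.rel k hk0 hkm
  have h2 : (k * x % m) • A = k • x • A - (k * x / m) • m • A := by
    rw [← mul_nsmul', ← mul_nsmul, eq_sub_iff_add_eq, ← add_nsmul, Nat.mod_add_div]
  have h3 : (m - k) • B = m • B - k • B := by
    rw [eq_sub_iff_add_eq, ← add_nsmul, Nat.sub_add_cancel hkm.le]
  rw [h2, h3, h.third_eq] at h1
  generalize hD : x₀ - m • B = D at h1 ⊢
  rw [eq_add_of_sub_eq hD, nsmul_sub, nsmul_add] at h1
  rw [← sub_eq_zero] at h1 ⊢
  rw [← h1]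
  abel

end IsTriple

end Forms

section TripleForms

open Multiset

namespace IsTriple

variable {G K : Type*} [AddCommGroup G] [AddCommGroup K]
  {m n x jA jB jC : ℕ} {φ : G →+ K} {A B C x₀ : G} {S : Multiset G}

theorem isBasisForm (h : IsTriple m n φ A B C x₀ x) {U V : G} {y : ℤ} {i j : ℕ}
    (hb : IsModBasis m (φ U) (φ V)) (hV : m • V = x₀) (hU : m • U = 0) (hy : Int.gcd y m = 1)
    (hij : i + j + 1 = n)
    (hS : S = replicate (m - 1) U + (replicate (m * i + (m - 1)) V +
      replicate (m * j + (m - 1)) ((-y) • U + V))) : IsBasisForm m n S := by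
  have hm := h.two_le
  refine ⟨U, V, y, i + 1, independent hb hU, h.closure_eq_top hb hV, h.addOrderOf_eq_mul hb hV,
    hy, by omega, by omega, ?_⟩
  rw [hS, ← add_assoc, show n + 1 - (i + 1) = j + 1 by omega, add_mul, add_mul, one_mul,
    Nat.add_sub_assoc (by omega), Nat.add_sub_assoc (by omega), mul_comm i, mul_comm j]

theorem nsmul_eq_zero_or_eq_one (h : IsTriple m n φ A B C x₀ x) (hB : m • B = x₀) :
    m • A = 0 ∨ x = 1 := by
  have hx0 := h.pos
  have hxm := h.lt
  refine or_iff_not_imp_right.2 fun hx => ?_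
  have h1 := Nat.div_add_mod (m + x - 1) x
  have h2 := Nat.mod_lt (m + x - 1) hx0
  set k := (m + x - 1) / x
  have hkm : k < m := by
    by_contra! hk
    have := Nat.mul_le_mul_left x hk
    have := Nat.mul_le_mul_right m (by omega : 2 ≤ x)
    omega
  have hk0 : 0 < k := Nat.div_pos (by omega) hx0
  have hk : k * x / m = 1 :=
    Nat.div_eq_of_lt_le (by rw [mul_comm k]; omega) (by rw [mul_comm k]; omega)
  have := h.nsmul_diff hk0 hkm
  rwa [hB, sub_self, nsmul_zero, zero_add, hk, one_nsmul, eq_comm] at this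

theorem isForm_of_nsmul_eq (h : IsTriple m n φ A B C x₀ x) (hB : m • B = x₀)
    (hj : jA + jB + jC + 1 = n) (hA : 0 < jA → m • A = x₀) (hC : 0 < jC → m • C = x₀)
    (hS : S = replicate (m * jA + (m - 1)) A + (replicate (m * jB + (m - 1)) B +
        replicate (m * jC + (m - 1)) C)) :
    IsBasisForm m n S ∨ IsGeneratingForm m n S := by
  have hm := h.two_le
  have hCeq : C = B - x • A := by rw [h.third_eq, hB, sub_self, zero_add]
  have hmC : m • C = x₀ - x • m • A := by
    rw [hCeq, nsmul_sub, hB, ← mul_nsmul, ← mul_nsmul', mul_comm]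
  by_cases hA0 : m • A = 0
  · rcases Nat.eq_zero_or_pos jA with rfl | hjA
    · refine Or.inl (h.isBasisForm (y := x) (i := jB) (j := jC) h.basis hB hA0 h.coprime
        (by omega) ?_)
      rw [hS, hCeq, mul_zero, zero_add, neg_smul, natCast_zsmul, sub_eq_neg_add]
    · have h0 := h.addOrderOf_eq
      rw [← hA hjA, hA0, addOrderOf_zero] at h0
      omega
  · obtain rfl := (h.nsmul_eq_zero_or_eq_one hB).resolve_left hA0
    rw [one_nsmul] at hmC hCeq
    obtain rfl : jC = 0 := by
      by_contra hjC
      rw [hC (by omega), eq_comm, sub_eq_self] at hmC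
      exact hA0 hmC
    rcases Nat.eq_zero_or_pos jA with rfl | hjA
    · refine Or.inr ⟨A, B, h.closure_eq_top h.basis hB, h.addOrderOf_eq_mul h.basis hB, ?_⟩
      rw [hS, hCeq, ← hj, mul_zero, zero_add, zero_add, add_zero, mul_add, mul_one,
        Nat.add_sub_assoc (by omega), sub_eq_neg_add, add_assoc]
    · rw [hA hjA, sub_self] at hmC
      have hb : IsModBasis m (φ C) (φ B) :=
        (h.basis.of_add_zsmul 1 (by rw [← h.map_eq, one_smul, one_smul])).symm.of_add_zsmul (-1)
          (by rw [← h.map_eq]; module)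
      refine Or.inl (h.isBasisForm (y := 1) (i := jB) (j := jA) hb hB hmC (by simp)
        (by omega) ?_)
      rw [hS, hCeq, mul_zero, zero_add, neg_smul, one_smul, neg_sub, sub_add_cancel]
      abel

theorem nsmul_eq_of_two_mul_lt (h : IsTriple m n φ A B C x₀ x) (hx : 2 * x < m) : m • B = x₀ := by
  have hx0 := h.pos
  have := h.nsmul_diff two_pos (by omega)
  rwa [Nat.div_eq_of_lt hx, zero_nsmul, add_zero, two_nsmul, add_eq_left, sub_eq_zero,
    eq_comm] at this

theorem isForm (h : IsTriple m n φ A B C x₀ x) (hj : jA + jB + jC + 1 = n)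
    (hA : 0 < jA → m • A = x₀) (hB : 0 < jB → m • B = x₀) (hC : 0 < jC → m • C = x₀)
    (hS : S = replicate (m * jA + (m - 1)) A + (replicate (m * jB + (m - 1)) B +
        replicate (m * jC + (m - 1)) C)) :
    IsBasisForm m n S ∨ IsGeneratingForm m n S := by
  have hm := h.two_le
  by_cases hBx : m • B = x₀
  · exact h.isForm_of_nsmul_eq hBx hj hA hC hS
  by_cases hCx : m • C = x₀
  · exact h.swap.isForm_of_nsmul_eq (jB := jC) (jC := jB) hCx (by omega) hA hB (by rw [hS]; abel)
  obtain rfl : jB = 0 := by by_contra hjB; exact hBx (hB (by omega))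
  obtain rfl : jC = 0 := by by_contra hjC; exact hCx (hC (by omega))
  have h2x : ¬ 2 * x < m := fun hx => hBx (h.nsmul_eq_of_two_mul_lt hx)
  have h2x' : ¬ 2 * (m - x) < m := fun hx => hCx (h.swap.nsmul_eq_of_two_mul_lt hx)
  obtain rfl : m = 2 * x := by omega
  obtain rfl : x = 1 := Nat.Coprime.eq_one_of_dvd h.coprime (dvd_mul_left _ _)
  rcases Nat.eq_zero_or_pos jA with rfl | hjA
  · refine absurd ?_ hBx
    have hx₀ : x₀ = 0 := by
      have := h.nsmul_self
      rwa [← hj, one_nsmul] at this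
    obtain ⟨z, hz⟩ := h.exists_zsmul ((2 * 1) • B) (by rw [_root_.map_nsmul, h.nsmul_eq_zero])
    rw [← hz, hx₀, zsmul_zero]
  · have hAx := hA hjA
    refine Or.inr ⟨B, A, h.closure_eq_top h.basis.symm hAx,
      h.addOrderOf_eq_mul h.basis.symm hAx, ?_⟩
    have hCeq : C = -B + A := by
      rw [h.third_eq, ← hAx]
      abel
    rw [hS, hCeq, ← hj, mul_zero, zero_add, mul_add, mul_one, Nat.add_sub_assoc (by omega)]
    simp only [add_zero]
    abel

end IsTriple

end TripleForms

section Converse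

open Multiset

variable {G : Type*} [AddCommGroup G] {m n : ℕ} {S : Multiset G}

theorem dvd_of_zsmul_add_zsmul_eq_zero {l : ℕ} {g₁ g₂ : G}
    (hgen : AddSubgroup.closure ({g₁, g₂} : Set G) = ⊤) (hl : 0 < l) (hord : addOrderOf g₂ = l)
    (hcard : Nat.card G = m * l) {a b : ℤ} (h0 : a • g₁ + b • g₂ = 0) : (m : ℤ) ∣ a := by
  set H := AddSubgroup.zmultiples g₂
  have hQ : Nat.card (G ⧸ H) = m := by
    have := H.card_eq_card_quotient_mul_card_addSubgroup
    rw [Nat.card_zmultiples, hord, hcard] at this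
    exact (Nat.eq_of_mul_eq_mul_right hl this).symm
  have hg₂ : ∀ b : ℤ, ((b • g₂ : G) : G ⧸ H) = 0 := fun b =>
    (QuotientAddGroup.eq_zero_iff _).2 (AddSubgroup.zsmul_mem_zmultiples g₂ b)
  have htop : AddSubgroup.zmultiples (g₁ : G ⧸ H) = ⊤ := by
    refine (AddSubgroup.eq_top_iff' _).2 fun q => ?_
    obtain ⟨g, rfl⟩ := QuotientAddGroup.mk_surjective q
    obtain ⟨i, j, rfl⟩ := AddSubgroup.mem_closure_pair.1 (hgen ▸ AddSubgroup.mem_top g)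
    exact AddSubgroup.mem_zmultiples_iff.2 ⟨i, by
      rw [QuotientAddGroup.mk_add, hg₂, add_zero, QuotientAddGroup.mk_zsmul]⟩
  have ho : addOrderOf (g₁ : G ⧸ H) = m := by
    rw [← Nat.card_zmultiples, htop, AddSubgroup.card_top, hQ]
  rw [← ho, addOrderOf_dvd_iff_zsmul_eq_zero, ← QuotientAddGroup.mk_zsmul,
    eq_neg_of_add_eq_zero_left h0, ← neg_smul, hg₂]

theorem IsBasisForm.card_eq (hm : 2 ≤ m) (h : IsBasisForm m n S) :
    card S = 2 * m + m * n - 3 := by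
  obtain ⟨e₁, e₂, x, s, -, -, -, -, hs, hsn, rfl⟩ := h
  obtain ⟨t, rfl⟩ := Nat.exists_eq_add_of_le hsn
  have h1 := Nat.le_mul_of_pos_left m hs
  have h2 := Nat.le_mul_of_pos_left m t.succ_pos
  simp only [card_add, card_replicate, show s + t + 1 - s = t.succ by omega]
  have : s * m + t.succ * m = m + m * (s + t) := by rw [Nat.succ_eq_add_one]; ring
  omega

theorem IsGeneratingForm.card_eq (hm : 2 ≤ m) (hn : 0 < n) (h : IsGeneratingForm m n S) :
    card S = 2 * m + m * n - 3 := by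
  obtain ⟨g₁, g₂, -, -, rfl⟩ := h
  have := Nat.le_mul_of_pos_right m hn
  simp only [card_add, card_replicate]
  omega

theorem IsBasisForm.noShortZeroSum (hm : 2 ≤ m) (hn : 0 < n) (hG : Nat.card G = m * (m * n))
    (h : IsBasisForm m n S) : NoShortZeroSum (m * n) S := by
  obtain ⟨e₁, e₂, x, s, hind, hgen, hord, hx, hs, hsn, rfl⟩ := h
  intro T hT hT0 hTs
  rw [add_assoc] at hT
  obtain ⟨i, hi, j, hj, k, hk, rfl⟩ := exists_of_le_replicate_add hT
  simp only [sum_add, sum_replicate] at hTs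
  have h0 : ((i : ℤ) - k * x) • e₁ + ((j + k : ℕ) : ℤ) • e₂ = 0 := by
    rw [← hTs, Nat.cast_add]; module
  have hmi := dvd_of_zsmul_add_zsmul_eq_zero hgen (by positivity) hord hG h0
  have hjk : m * n ∣ j + k := by
    rw [← hord, addOrderOf_dvd_iff_nsmul_eq_zero, ← natCast_zsmul]
    exact (hind _ _ h0).2
  simp only [card_add, card_replicate]
  by_contra! hc
  rcases Nat.eq_zero_or_pos (j + k) with h | hpos
  · obtain ⟨rfl, rfl⟩ : j = 0 ∧ k = 0 := by omega
    have : m ∣ i := Int.natCast_dvd_natCast.1 (by simpa using hmi)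
    obtain rfl := Nat.eq_zero_of_dvd_of_lt this (by omega)
    simp at hT0
  · have := Nat.le_of_dvd hpos hjk
    obtain rfl : i = 0 := by omega
    have hkx : (m : ℤ) ∣ k * x := by simpa using hmi
    have hk' : m ∣ k := Int.natCast_dvd_natCast.1
      (Int.dvd_of_dvd_mul_left_of_gcd_one hkx (by rwa [Int.gcd_comm]))
    have hj' : m ∣ j := (Nat.dvd_add_left hk').1 ((dvd_mul_right m n).trans hjk)
    obtain ⟨j, rfl⟩ := hj'
    obtain ⟨k, rfl⟩ := hk'
    have hle : ∀ {a b : ℕ}, 0 < b → m * a ≤ b * m - 1 → a < b := fun {a b} hb h => by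
      have := Nat.mul_pos hb (by omega : 0 < m)
      exact Nat.lt_of_mul_lt_mul_left (a := m) (by rw [mul_comm m b]; omega)
    have h1 := hle (by omega) hj
    have h2 := hle (by omega) hk
    rw [← mul_add] at this
    have := Nat.le_of_mul_le_mul_left this (by omega)
    omega

theorem IsGeneratingForm.noShortZeroSum (hm : 2 ≤ m) (hn : 0 < n)
    (hG : Nat.card G = m * (m * n)) (h : IsGeneratingForm m n S) :
    NoShortZeroSum (m * n) S := by
  obtain ⟨g₁, g₂, hgen, hord, rfl⟩ := h
  intro T hT hT0 hTs
  rw [add_assoc] at hT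
  obtain ⟨i, hi, j, hj, k, hk, rfl⟩ := exists_of_le_replicate_add hT
  simp only [sum_add, sum_replicate] at hTs
  have hmn : 0 < m * n := by positivity
  have h0 : ((i : ℤ) - k) • g₁ + ((j + k : ℕ) : ℤ) • g₂ = 0 := by
    rw [← hTs, Nat.cast_add]; module
  have hik : (i : ℤ) - k = 0 := Int.eq_zero_of_abs_lt_dvd
    (dvd_of_zsmul_add_zsmul_eq_zero hgen hmn hord hG h0) (by rw [abs_lt]; omega)
  obtain rfl : i = k := by omega
  rw [hik, zero_smul, zero_add, natCast_zsmul, ← addOrderOf_dvd_iff_nsmul_eq_zero, hord] at h0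
  simp only [card_add, card_replicate]
  by_contra! hc
  rcases Nat.eq_zero_or_pos (j + i) with h | hpos
  · obtain ⟨rfl, rfl⟩ : j = 0 ∧ i = 0 := by omega
    simp at hT0
  · have := Nat.le_of_dvd hpos h0
    omega

end Converse

/-- A sequence `S` over `G = C_m ⊕ C_{mn}` has length `2m + mn - 3 = η(G) - 1`
and no short zero-sum subsequence if and only if it is of form (a) or (b). -/
theorem stmt_6 (m n : ℕ) (hm : 2 ≤ m) (hn : 0 < n)
    (S : Multiset (ZMod m × ZMod (m * n))) :
    (S.card = 2 * m + m * n - 3 ∧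
      ¬ ∃ T ≤ S, T ≠ 0 ∧ T.sum = 0 ∧ Multiset.card T ≤ m * n) ↔
    ((∃ (e1 e2 : ZMod m × ZMod (m * n)) (x : ℤ) (s : ℕ),
        (∀ a b : ℤ, a • e1 + b • e2 = 0 → a • e1 = 0 ∧ b • e2 = 0) ∧
        AddSubgroup.closure ({e1, e2} : Set (ZMod m × ZMod (m * n))) = ⊤ ∧
        addOrderOf e2 = m * n ∧ Int.gcd x m = 1 ∧ 1 ≤ s ∧ s ≤ n ∧
        S = Multiset.replicate (m - 1) e1 + Multiset.replicate (s * m - 1) e2 +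
              Multiset.replicate ((n + 1 - s) * m - 1) ((-x) • e1 + e2)) ∨
      (∃ g1 g2 : ZMod m × ZMod (m * n),
        AddSubgroup.closure ({g1, g2} : Set (ZMod m × ZMod (m * n))) = ⊤ ∧
        addOrderOf g2 = m * n ∧
        S = Multiset.replicate (m - 1) g1 + Multiset.replicate (m * n - 1) g2 +
              Multiset.replicate (m - 1) (-g1 + g2))) := by
  change _ ↔ IsBasisForm m n S ∨ IsGeneratingForm m n S
  have hshort : (¬ ∃ T ≤ S, T ≠ 0 ∧ T.sum = 0 ∧ Multiset.card T ≤ m * n) ↔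
      NoShortZeroSum (m * n) S := by
    simp only [NoShortZeroSum, not_exists, not_and, not_le]
  rw [hshort]
  have hmn : m * n = m * (n - 1) + m := by
    rw [← Nat.mul_succ, Nat.succ_eq_add_one, Nat.sub_add_cancel hn]
  have hG : Nat.card (ZMod m × ZMod (m * n)) = m * (m * n) := by
    rw [Nat.card_prod, Nat.card_zmod, Nat.card_zmod]
  have : NeZero n := ⟨hn.ne'⟩
  constructor
  · rintro ⟨hc, hS⟩
    obtain ⟨A, B, C, x₀, x, jA, jB, jC, hT, hj, hA, hB, hC, rfl⟩ :=
      exists_isTriple hm hS (by omega)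
    exact hT.isForm (by omega) hA hB hC rfl
  · rintro (h | h)
    · exact ⟨h.card_eq hm, h.noShortZeroSum hm hn hG⟩
    · exact ⟨h.card_eq hm hn, h.noShortZeroSum hm hn hG⟩
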